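/- arXiv:2410.06449 — 3 statements merged into one kernel-verified Lean document; each statement's English description precedes it below -/
import Mathlib

section
/- Let G be a K_r-free graph and C a longest cycle in G of length c, where r ≤ ⌊c/2⌋ + 1. If there exists a vertex u outside C with exactly ⌊c/2⌋ neighbors on C, then the number of edges of G with both endpoints on C is at most ex(⌊c/2⌋, K_{r-1}) + ⌊c/2⌋·⌈c/2⌉. -/
open SimpleGraph

/-- `exK n r` is the Turán number ex(n, K_r): the maximum number of edges of an
`n`-vertex graph containing no copy of `K_r`. -/
noncomputable def exK (n r : ℕ) : ℕ :=
  sSup {m | ∃ G : SimpleGraph (Fin n), G.CliqueFree r ∧ G.edgeSet.ncard = m}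

theorem ncard_edgeSet_le_exK {n r : ℕ} {H : SimpleGraph (Fin n)} (hH : H.CliqueFree r) :
    H.edgeSet.ncard ≤ exK n r := by
  refine le_csSup ⟨Nat.card (Sym2 (Fin n)), ?_⟩ ⟨H, hH, rfl⟩
  rintro m ⟨K, -, rfl⟩
  exact Set.ncard_le_card _

/-- A `K_s`-free graph on at least `s` vertices is not extremal among `K_{s+1}`-free graphs. -/
theorem ncard_edgeSet_lt_exK {n s : ℕ} {H : SimpleGraph (Fin n)} (hH : H.CliqueFree s)
    (hs : s ≤ n) : H.edgeSet.ncard < exK n (s + 1) := by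
  obtain ⟨a, b, hab, hadj⟩ : ∃ a b, a ≠ b ∧ ¬ H.Adj a b := by
    by_contra! hcon
    obtain ⟨t, -, ht⟩ := Finset.exists_subset_card_eq (s := (Finset.univ : Finset (Fin n)))
      (by simpa using hs)
    exact hH t ⟨fun a _ b _ hab => hcon a b hab, ht⟩
  refine lt_of_lt_of_le (Set.ncard_lt_ncard ?_) (ncard_edgeSet_le_exK (hH.sup_edge a b))
  exact edgeSet_ssubset_edgeSet.2 (lt_sup_edge _ _ _ hab hadj)

/-- Edge count inside `A ∪ T`, where `A` lies in a neighbourhood and `T` spans at most one edge. -/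
theorem ncard_edges_union_le {V : Type*} [Fintype V] {G : SimpleGraph V} {s k : ℕ}
    (hfree : G.CliqueFree (s + 2)) {A T : Finset V} {u : V} (hu : ∀ a ∈ A, G.Adj u a)
    (hA : A.card = k) (hs : s ≤ k)
    (hT : ∀ x ∈ T, ∀ y ∈ T, ∀ x' ∈ T, ∀ y' ∈ T, G.Adj x y → G.Adj x' y' → s(x, y) = s(x', y')) :
    {e : Sym2 V | e ∈ G.edgeSet ∧ ∀ x ∈ e, x ∈ A ∨ x ∈ T}.ncard ≤
      exK k (s + 1) + k * T.card := by
  classical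
  let ψ : Fin k ≃ A := (A.equivFinOfCardEq hA).symm
  let φ : Fin k ↪ V := ψ.toEmbedding.trans (Function.Embedding.subtype _)
  have hφ : ∀ i, φ i ∈ A := fun i => (ψ i).2
  have hφ' : ∀ a ∈ A, ∃ i, φ i = a := fun a ha => ⟨ψ.symm ⟨a, ha⟩, by simp [φ]⟩
  let H : SimpleGraph (Fin k) := G.comap φ
  have hclique : ∀ {m : ℕ} {t : Finset (Fin k)}, H.IsNClique m t → G.IsNClique m (t.map φ) := by
    intro m t ht
    exact (ht.map (f := φ)).mono (map_comap_le φ G)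
  have hH : H.CliqueFree (s + 1) := by
    intro t ht
    refine hfree _ ((hclique ht).insert (a := u) ?_)
    intro b hb
    obtain ⟨i, -, rfl⟩ := Finset.mem_map.1 hb
    exact hu _ (hφ i)
  let X : Finset (V × V) := (A ×ˢ T).filter fun p => G.Adj p.1 p.2
  have hXle : X.card ≤ k * T.card := by
    rw [← hA, ← Finset.card_product]; exact Finset.card_filter_le _ _
  let ET : Set (Sym2 V) := {e | ∃ x ∈ T, ∃ y ∈ T, G.Adj x y ∧ e = s(x, y)}
  have hsub : {e : Sym2 V | e ∈ G.edgeSet ∧ ∀ x ∈ e, x ∈ A ∨ x ∈ T} ⊆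
      (Sym2.map φ '' H.edgeSet ∪ (fun p : V × V => s(p.1, p.2)) '' (X : Set (V × V))) ∪ ET := by
    rintro e ⟨he, hmem⟩
    induction e with | _ x y
    rw [mem_edgeSet] at he
    have hx := hmem x (by simp)
    have hy := hmem y (by simp)
    by_cases hxA : x ∈ A
    · by_cases hyA : y ∈ A
      · obtain ⟨i, rfl⟩ := hφ' x hxA
        obtain ⟨j, rfl⟩ := hφ' y hyA
        exact Or.inl (Or.inl ⟨s(i, j), he, rfl⟩)
      · exact Or.inl (Or.inr ⟨(x, y), by simp [X, hxA, hy.resolve_left hyA, he], rfl⟩)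
    · by_cases hyA : y ∈ A
      · exact Or.inl (Or.inr ⟨(y, x), by simp [X, hyA, hx.resolve_left hxA, he.symm], Sym2.eq_swap⟩)
      · exact Or.inr ⟨x, hx.resolve_left hxA, y, hy.resolve_left hyA, he, rfl⟩
  have hcount : {e : Sym2 V | e ∈ G.edgeSet ∧ ∀ x ∈ e, x ∈ A ∨ x ∈ T}.ncard ≤
      H.edgeSet.ncard + X.card + ET.ncard := by
    refine (Set.ncard_le_ncard hsub).trans ((Set.ncard_union_le _ _).trans ?_)
    gcongr
    refine (Set.ncard_union_le _ _).trans (add_le_add (Set.ncard_image_le) ?_)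
    exact (Set.ncard_image_le).trans (Set.ncard_coe_finset X).le
  have hHle := ncard_edgeSet_le_exK hH
  have hET : ET.ncard ≤ 1 := by
    rw [Set.ncard_le_one]
    rintro _ ⟨x, hx, y, hy, hxy, rfl⟩ _ ⟨x', hx', y', hy', hxy', rfl⟩
    exact hT x hx y hy x' hx' y' hy' hxy hxy'
  rcases ET.eq_empty_or_nonempty with h0 | ⟨_, p, hp, q, hq, hpq, -⟩
  · rw [h0, Set.ncard_empty] at hcount
    omega
  by_cases hfull : X = A ×ˢ T
  · have hAT : ∀ a ∈ A, ∀ t ∈ T, G.Adj a t := by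
      intro a ha t ht
      have : (a, t) ∈ X := by rw [hfull]; simp [ha, ht]
      exact (Finset.mem_filter.1 this).2
    have hHs : H.CliqueFree s := by
      intro t ht
      have hmem : ∀ b ∈ t.map φ, b ∈ A := by
        intro b hb
        obtain ⟨i, -, rfl⟩ := Finset.mem_map.1 hb
        exact hφ i
      refine hfree _ (((hclique ht).insert (a := p) ?_).insert (a := q) ?_)
      · exact fun b hb => (hAT b (hmem b hb) p hp).symm
      · intro b hb
        rcases Finset.mem_insert.1 hb with rfl | hb
        · exact hpq.symm
        · exact (hAT b (hmem b hb) q hq).symm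
    have := ncard_edgeSet_lt_exK hHs hs
    omega
  · have hlt : X.card < k * T.card := by
      rw [← hA, ← Finset.card_product]
      exact Finset.card_lt_card ((Finset.filter_subset _ _).ssubset_of_ne hfull)
    omega

theorem exists_isCycle_of_injOn {V : Type*} {G : SimpleGraph V} {n : ℕ} (hn : 2 ≤ n) (g : ℕ → V)
    (hinj : Set.InjOn g (Set.Iic n)) (hadj : ∀ i < n, G.Adj (g i) (g (i + 1)))
    (hlast : G.Adj (g n) (g 0)) :
    ∃ (w : V) (p : G.Walk w w), p.IsCycle ∧ p.length = n + 1 := by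
  rw [← cycleGraph_isContained_iff (by omega)]
  have key : ∀ x y : Fin (n + 1), (y - x).val = 1 → G.Adj (g x) (g y) := by
    intro x y h
    rcases le_or_gt x y with hle | hlt
    · rw [Fin.sub_val_of_le hle] at h
      have : (y : ℕ) = x + 1 := by omega
      rw [this]
      exact hadj _ (by omega)
    · rw [Fin.coe_sub_iff_lt.2 hlt] at h
      have hx : (x : ℕ) = n := by omega
      have hy : (y : ℕ) = 0 := by omega
      rw [hx, hy]
      exact hlast
  refine ⟨⟨⟨fun i => g i, ?_⟩, ?_⟩⟩
  · intro x y h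
    rcases cycleGraph_adj'.1 h with h | h
    · exact (key _ _ h).symm
    · exact key _ _ h
  · intro x y h
    exact Fin.ext (hinj (Nat.lt_succ_iff.1 x.2) (Nat.lt_succ_iff.1 y.2) h)

/-- `f` traverses a cycle of length `c` and no cycle of `G` has length `c + 1`. -/
structure IsUnextendableCycle {V : Type*} (G : SimpleGraph V) (c : ℕ) (f : ZMod c → V) : Prop where
  two_le : 2 ≤ c
  inj : Function.Injective f
  adj : ∀ i, G.Adj (f i) (f (i + 1))
  length_ne : ∀ (w : V) (p : G.Walk w w), p.IsCycle → p.length ≠ c + 1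

namespace IsUnextendableCycle

variable {V : Type*} {G : SimpleGraph V} {c : ℕ} {f : ZMod c → V}

theorem reverse (h : IsUnextendableCycle G c f) : IsUnextendableCycle G c fun i => f (-i) where
  two_le := h.two_le
  inj := h.inj.comp neg_injective
  adj i := by simpa using (h.adj (-(i + 1))).symm
  length_ne := h.length_ne

/-- The cycle cannot be reordered along `e` so as to insert a vertex outside of it. -/
theorem not_reorder (h : IsUnextendableCycle G c f) {u : V} (hu : ∀ i, f i ≠ u) (a : ZMod c)
    (e : ℕ → ℕ) (hmem : ∀ t, 1 ≤ t → t ≤ c → 1 ≤ e t ∧ e t ≤ c)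
    (hinj : ∀ t t', 1 ≤ t → t ≤ c → 1 ≤ t' → t' ≤ c → e t = e t' → t = t')
    (hadj : ∀ t, 1 ≤ t → t < c → G.Adj (f (a + e t)) (f (a + e (t + 1))))
    (hfirst : G.Adj u (f (a + e 1))) (hlast : G.Adj u (f (a + e c))) : False := by
  have hc := h.two_le
  suffices hcyc : ∃ (w : V) (p : G.Walk w w), p.IsCycle ∧ p.length = c + 1 by
    obtain ⟨w, p, hp, hlen⟩ := hcyc
    exact h.length_ne w p hp hlen
  refine exists_isCycle_of_injOn hc (fun t => if t = 0 then u else f (a + e t)) ?_ ?_ ?_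
  · intro t ht t' ht' heq
    simp only [Set.mem_Iic] at ht ht'
    dsimp only at heq
    split_ifs at heq with h1 h2 h2
    · omega
    · exact absurd heq.symm (hu _)
    · exact absurd heq (hu _)
    · have h3 := add_left_cancel (h.inj heq)
      rw [ZMod.natCast_eq_natCast_iff'] at h3
      refine hinj t t' (by omega) ht (by omega) ht' ?_
      obtain ⟨h4, h5⟩ := hmem t (by omega) ht
      obtain ⟨h6, h7⟩ := hmem t' (by omega) ht'
      rcases h5.eq_or_lt with h5 | h5 <;> rcases h7.eq_or_lt with h7 | h7
      · omega
      · rw [h5, Nat.mod_self, Nat.mod_eq_of_lt h7] at h3; omega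
      · rw [h7, Nat.mod_self, Nat.mod_eq_of_lt h5] at h3; omega
      · rwa [Nat.mod_eq_of_lt h5, Nat.mod_eq_of_lt h7] at h3
  · intro t ht
    rcases Nat.eq_zero_or_pos t with rfl | h0
    · simpa using hfirst
    · simpa [h0.ne'] using hadj t h0 ht
  · have : c ≠ 0 := by omega
    simpa [this] using hlast.symm

theorem not_adj_succ (h : IsUnextendableCycle G c f) {u : V} (hu : ∀ i, f i ≠ u) {a : ZMod c}
    (ha : G.Adj u (f a)) : ¬ G.Adj u (f (a + 1)) := by
  intro ha'
  refine h.not_reorder hu a id (fun t h1 h2 => ⟨h1, h2⟩) (fun _ _ _ _ _ _ => id) ?_ ?_ ?_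
  · intro t _ _
    simpa [add_assoc] using h.adj (a + t)
  · simpa using ha'
  · simpa using ha

theorem not_adj_succ_succ (h : IsUnextendableCycle G c f) {u : V} (hu : ∀ i, f i ≠ u)
    {a b : ZMod c} (ha : G.Adj u (f a)) (hb : G.Adj u (f b)) :
    ¬ G.Adj (f (a + 1)) (f (b + 1)) := by
  intro hab
  have hc := h.two_le
  have : NeZero c := ⟨by omega⟩
  have hne : a ≠ b := fun heq => hab.ne (by rw [heq])
  obtain ⟨j, hjc, hj⟩ : ∃ j : ℕ, j < c ∧ b = a + j :=
    ⟨(b - a).val, ZMod.val_lt _, by simp⟩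
  have hj0 : j ≠ 0 := by rintro rfl; simp at hj; exact hne hj.symm
  refine h.not_reorder hu a (fun t => if t ≤ j then j + 1 - t else t) ?_ ?_ ?_ ?_ ?_
  · intro t h1 h2
    split_ifs <;> omega
  · intro t t' _ _ _ _
    split_ifs <;> omega
  · intro t h1 h2
    rcases lt_trichotomy t j with hlt | rfl | hgt
    · have h3 : j + 1 - t = (j - t) + 1 := by omega
      have h4 : j + 1 - (t + 1) = j - t := by omega
      simp only [hlt.le, Nat.succ_le_of_lt hlt, if_true, h3, h4, Nat.cast_add, Nat.cast_one]
      simpa only [add_assoc] using (h.adj (a + (j - t : ℕ))).symm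
    · simpa [hj, add_assoc] using hab
    · have h3 : ¬ t ≤ j := by omega
      have h4 : ¬ t + 1 ≤ j := by omega
      simpa [h3, h4, add_assoc] using h.adj (a + t)
  · simpa [Nat.one_le_iff_ne_zero, hj0, ← hj] using hb
  · simpa [hjc] using ha

theorem not_adj_pred_pred (h : IsUnextendableCycle G c f) {u : V} (hu : ∀ i, f i ≠ u)
    {a b : ZMod c} (ha : G.Adj u (f a)) (hb : G.Adj u (f b)) :
    ¬ G.Adj (f (a - 1)) (f (b - 1)) := by
  have := h.reverse.not_adj_succ_succ (u := u) (fun i => hu _) (a := -a) (b := -b)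
    (by simpa using ha) (by simpa using hb)
  simpa [sub_eq_add_neg, add_comm] using this

end IsUnextendableCycle

/-- If `S` and its shift by `d` are disjoint in `ZMod c` and `c ≤ 2 * #S + 1`, then at most one
element lies outside both. -/
theorem eq_of_notMem_of_sub_notMem {c : ℕ} [NeZero c] {S : Finset (ZMod c)} (d : ZMod c)
    (hS : ∀ a ∈ S, a + d ∉ S) (hc : c ≤ 2 * S.card + 1) {x y : ZMod c}
    (hx : x ∉ S) (hx' : x - d ∉ S) (hy : y ∉ S) (hy' : y - d ∉ S) : x = y := by
  classical
  by_contra hne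
  let S' := S.map (addRightEmbedding d)
  have hmem : ∀ z, z ∈ S' → z - d ∈ S ∧ z ∉ S := by
    intro z hz
    obtain ⟨a, ha, rfl⟩ := Finset.mem_map.1 hz
    simpa [ha] using hS a ha
  have hd : Disjoint S S' :=
    Finset.disjoint_left.2 fun z hz hz' => (hmem z hz').2 hz
  have hd' : Disjoint (S ∪ S') {x, y} := by
    rw [Finset.disjoint_right]
    intro z hz hz'
    rcases Finset.mem_union.1 hz' with h1 | h1
    · simp only [Finset.mem_insert, Finset.mem_singleton] at hz
      rcases hz with rfl | rfl <;> contradiction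
    · have := (hmem z h1).1
      simp only [Finset.mem_insert, Finset.mem_singleton] at hz
      rcases hz with rfl | rfl <;> contradiction
  have hle := Finset.card_le_univ ((S ∪ S') ∪ {x, y})
  rw [Finset.card_union_of_disjoint hd', Finset.card_union_of_disjoint hd, Finset.card_pair hne,
    Finset.card_map, ZMod.card] at hle
  omega

theorem IsUnextendableCycle.sym2_eq_of_adj {V : Type*} {G : SimpleGraph V} {c : ℕ} [NeZero c]
    {f : ZMod c → V} (h : IsUnextendableCycle G c f) {u : V} (hu : ∀ i, f i ≠ u)
    {S : Finset (ZMod c)} (hS : ∀ i, i ∈ S ↔ G.Adj u (f i)) (hc : c ≤ 2 * S.card + 1)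
    {x y x' y' : ZMod c} (hx : x ∉ S) (hy : y ∉ S) (hx' : x' ∉ S) (hy' : y' ∉ S)
    (hxy : G.Adj (f x) (f y)) (hxy' : G.Adj (f x') (f y')) : s(x, y) = s(x', y') := by
  have hsucc : ∀ a ∈ S, a + 1 ∉ S := fun a ha ha' =>
    h.not_adj_succ hu ((hS a).1 ha) ((hS _).1 ha')
  have hpred : ∀ a ∈ S, a + (-1) ∉ S := fun a ha ha' =>
    hsucc _ ha' (by simpa using ha)
  have hP : ∀ {x y}, x ∉ S → x - 1 ∉ S → y ∉ S → y - 1 ∉ S → x = y :=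
    eq_of_notMem_of_sub_notMem 1 hsucc hc
  have hQ : ∀ {x y}, x ∉ S → x + 1 ∉ S → y ∉ S → y + 1 ∉ S → x = y := by
    intro x y h1 h2 h3 h4
    exact eq_of_notMem_of_sub_notMem (-1) hpred hc h1 (by simpa using h2) h3 (by simpa using h4)
  have hno : ∀ {p}, p ∉ S → p - 1 ∉ S → p + 1 ∈ S := by
    intro p hp hp1
    by_contra hp2
    have := hQ hp1 (by simpa using hp) hp hp2
    exact (h.adj (p - 1)).ne (by rw [sub_add_cancel, this])
  have hends : ∀ {x y}, x ∉ S → y ∉ S → G.Adj (f x) (f y) →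
      (x - 1 ∉ S ∧ y + 1 ∉ S) ∨ (y - 1 ∉ S ∧ x + 1 ∉ S) := by
    intro x y hx hy hxy
    have h1 : ¬ (x - 1 ∈ S ∧ y - 1 ∈ S) := fun ⟨h1, h2⟩ =>
      h.not_adj_succ_succ hu ((hS _).1 h1) ((hS _).1 h2) (by simpa using hxy)
    have h2 : ¬ (x + 1 ∈ S ∧ y + 1 ∈ S) := fun ⟨h1, h2⟩ =>
      h.not_adj_pred_pred hu ((hS _).1 h1) ((hS _).1 h2) (by simpa using hxy)
    have h3 := hno hx
    have h4 := hno hy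
    tauto
  rcases hends hx hy hxy with ⟨h1, h2⟩ | ⟨h1, h2⟩ <;>
    rcases hends hx' hy' hxy' with ⟨h3, h4⟩ | ⟨h3, h4⟩
  · rw [hP hx h1 hx' h3, hQ hy h2 hy' h4]
  · rw [hP hx h1 hy' h3, hQ hy h2 hx' h4, Sym2.eq_swap]
  · rw [hP hy h1 hx' h3, hQ hx h2 hy' h4, Sym2.eq_swap]
  · rw [hP hy h1 hy' h3, hQ hx h2 hx' h4]

theorem SimpleGraph.Walk.IsCycle.exists_zmod_param {V : Type*} {G : SimpleGraph V} {v : V}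
    {C : G.Walk v v} (hC : C.IsCycle) :
    ∃ f : ZMod C.length → V, Function.Injective f ∧ (∀ i, G.Adj (f i) (f (i + 1))) ∧
      ∀ x, x ∈ C.support ↔ ∃ i, f i = x := by
  have h3 := hC.three_le_length
  have : NeZero C.length := ⟨by omega⟩
  have hcast : ∀ n ≤ C.length, C.getVert (n : ZMod C.length).val = C.getVert n := by
    intro n hn
    rcases hn.eq_or_lt with rfl | hn
    · simp
    · rw [ZMod.val_natCast_of_lt hn]
  refine ⟨fun i => C.getVert i.val, ?_, ?_, ?_⟩
  · intro i j hij
    have hi := ZMod.val_lt i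
    have hj := ZMod.val_lt j
    exact ZMod.val_injective _ (hC.getVert_injOn' (show i.val ≤ _ by omega)
      (show j.val ≤ _ by omega) hij)
  · intro i
    have hi := ZMod.val_lt i
    have := hcast (i.val + 1) hi
    rw [Nat.cast_add, ZMod.natCast_zmod_val, Nat.cast_one] at this
    dsimp only
    rw [this]
    exact C.adj_getVert_succ hi
  · intro x
    rw [Walk.mem_support_iff_exists_getVert]
    constructor
    · rintro ⟨n, rfl, hn⟩
      exact ⟨n, hcast n hn⟩
    · rintro ⟨i, rfl⟩
      exact ⟨i.val, rfl, (ZMod.val_lt i).le⟩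

theorem stmt_6 {V : Type*} [Fintype V] (G : SimpleGraph V) (r : ℕ)
    (hfree : G.CliqueFree r) (v : V) (C : G.Walk v v) (hC : C.IsCycle)
    (hmax : ∀ (w : V) (C' : G.Walk w w), C'.IsCycle → C'.length ≤ C.length)
    (hr : r ≤ C.length / 2 + 1)
    (u : V) (hu : u ∉ C.support)
    (hnb : (G.neighborSet u ∩ {x | x ∈ C.support}).ncard = C.length / 2) :
    {e : Sym2 V | e ∈ G.edgeSet ∧ ∀ x ∈ e, x ∈ C.support}.ncard
      ≤ exK (C.length / 2) (r - 1) + (C.length / 2) * ((C.length + 1) / 2) := by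
  classical
  have h3 := hC.three_le_length
  have : NeZero C.length := ⟨by omega⟩
  obtain ⟨f, hinj, hadj, hsupp⟩ := hC.exists_zmod_param
  have hf : IsUnextendableCycle G C.length f :=
    ⟨by omega, hinj, hadj, fun w p hp => by have := hmax w p hp; omega⟩
  have hfu : ∀ i, f i ≠ u := fun i hi => hu ((hsupp u).2 ⟨i, hi⟩)
  obtain ⟨s, rfl⟩ : ∃ s, r = s + 2 := by
    refine ⟨r - 2, ?_⟩
    by_contra hcon
    exact hfree.mono (show r ≤ 2 by omega) {f 0, f (0 + 1)}
      ⟨by simpa [isClique_insert] using fun _ => hadj 0, Finset.card_pair (hadj 0).ne⟩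
  let S : Finset (ZMod C.length) := Finset.univ.filter fun i => G.Adj u (f i)
  have hS : ∀ i, i ∈ S ↔ G.Adj u (f i) := by simp [S]
  have hcard : (S.image f).card = C.length / 2 := by
    rw [← hnb, ← Set.ncard_coe_finset]
    congr 1
    ext x
    simp only [Finset.coe_image, Set.mem_image, SetLike.mem_coe, hS, Set.mem_inter_iff,
      mem_neighborSet, Set.mem_ofPred_eq, hsupp]
    constructor
    · rintro ⟨i, hi, rfl⟩
      exact ⟨hi, i, rfl⟩
    · rintro ⟨hi, i, rfl⟩
      exact ⟨i, hi, rfl⟩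
  have hScard : S.card = C.length / 2 := by rwa [Finset.card_image_of_injective _ hinj] at hcard
  have hTcard : (Sᶜ.image f).card = (C.length + 1) / 2 := by
    rw [Finset.card_image_of_injective _ hinj, Finset.card_compl, ZMod.card, hScard]
    omega
  have hset : {e : Sym2 V | e ∈ G.edgeSet ∧ ∀ x ∈ e, x ∈ C.support} =
      {e : Sym2 V | e ∈ G.edgeSet ∧ ∀ x ∈ e, x ∈ S.image f ∨ x ∈ Sᶜ.image f} := by
    have : ∀ x, x ∈ C.support ↔ x ∈ S.image f ∨ x ∈ Sᶜ.image f := by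
      intro x
      rw [hsupp, ← Finset.mem_union, ← Finset.image_union, Finset.union_compl]
      simp
    simp only [this]
  rw [hset, ← hTcard]
  refine ncard_edges_union_le hfree (u := u) ?_ hcard (by omega) ?_
  · intro a ha
    obtain ⟨i, hi, rfl⟩ := Finset.mem_image.1 ha
    exact (hS i).1 hi
  · simp only [Finset.forall_mem_image, Finset.mem_compl]
    intro x hx y hy x' hx' y' hy' hxy hxy'
    have := hf.sym2_eq_of_adj hfu hS (by omega) hx hy hx' hy' hxy hxy'
    simpa using congrArg (Sym2.map f) this
end

section
/- Let G be a 2-connected n-vertex graph whose longest cycle C has length c with 4 ≤ c ≤ n-1. If every vertex u outside C satisfies |N(u) ∩ V(C)| < ⌊c/2⌋, then the number of edges of G having at most one endpoint on C is at most (⌊c/2⌋ - 1/2)(n - c). -/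
open SimpleGraph

/-- A graph is 2-connected if it has at least 3 vertices and deleting any single
vertex leaves it connected. -/
def TwoConnected {V : Type*} (G : SimpleGraph V) : Prop :=
  3 ≤ Nat.card V ∧ ∀ v : V, ((⊤ : G.Subgraph).deleteVerts {v}).coe.Connected

section Paths

variable {V : Type*}

/-- `f` runs cyclically through the vertices of a cycle of `G` of length `c`. -/
structure CyclicEnum (G : SimpleGraph V) (c : ℕ) (f : ℕ → V) : Prop where
  adj : ∀ i, G.Adj (f i) (f (i + 1))
  periodic : ∀ i, f (i + c) = f i
  inj : ∀ i j, f i = f j → i ≡ j [MOD c]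

namespace CyclicEnum

variable {G : SimpleGraph V} {c : ℕ} {f : ℕ → V}

theorem inj_window (hf : CyclicEnum G c f) {i s t : ℕ} (hs : s < c) (ht : t < c)
    (h : f (i + s) = f (i + t)) : s = t :=
  Nat.ModEq.eq_of_lt_of_lt (Nat.ModEq.add_left_cancel' i (hf.inj _ _ h)) hs ht

theorem exists_offset (hf : CyclicEnum G c f) (hc : 0 < c) (i j : ℕ) :
    ∃ d < c, f (i + d) = f j := by
  have hper : ∀ n i, f (i + n * c) = f i := by
    intro n
    induction n with
    | zero => simp
    | succ n ih => intro i; rw [Nat.succ_mul, ← add_assoc, hf.periodic, ih]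
  refine ⟨(j + i * c - i) % c, Nat.mod_lt _ hc, ?_⟩
  have hi : i ≤ i * c := Nat.le_mul_of_pos_right i hc
  rw [← hper ((j + i * c - i) / c), ← hper i j]
  congr 1
  have := Nat.mod_add_div' (j + i * c - i) c
  omega

end CyclicEnum

theorem SimpleGraph.Walk.IsCycle.cyclicEnum {G : SimpleGraph V} {v : V} {C : G.Walk v v}
    (hC : C.IsCycle) : CyclicEnum G C.length fun i => C.getVert (i % C.length) where
  adj i := by
    have h3 := hC.three_le_length
    have hlt := Nat.mod_lt i (by omega : 0 < C.length)
    have h := C.adj_getVert_succ hlt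
    rw [Nat.add_mod, Nat.mod_eq_of_lt (by omega : 1 < C.length)]
    rcases Nat.lt_or_ge (i % C.length + 1) C.length with hl | hl
    · rwa [Nat.mod_eq_of_lt hl]
    · have he : i % C.length + 1 = C.length := by omega
      rw [he, Walk.getVert_length] at h
      rwa [he, Nat.mod_self, Walk.getVert_zero]
  periodic i := by simp
  inj i j h := by
    have h3 := hC.three_le_length
    have hi := Nat.mod_lt i (by omega : 0 < C.length)
    have hj := Nat.mod_lt j (by omega : 0 < C.length)
    exact hC.getVert_injOn' (by simp only [Set.mem_ofPred_eq]; omega)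
      (by simp only [Set.mem_ofPred_eq]; omega) h

theorem SimpleGraph.Walk.IsCycle.mem_support_iff_exists {G : SimpleGraph V} {v : V} {C : G.Walk v v}
    (hC : C.IsCycle) (u : V) : u ∈ C.support ↔ ∃ i, C.getVert (i % C.length) = u := by
  have h3 := hC.three_le_length
  constructor
  · rw [Walk.mem_support_iff_exists_getVert]
    rintro ⟨n, rfl, hn⟩
    rcases hn.lt_or_eq with h | rfl
    · exact ⟨n, by rw [Nat.mod_eq_of_lt h]⟩
    · exact ⟨0, by simp⟩
  · rintro ⟨i, rfl⟩
    exact C.getVert_mem_support _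

variable [DecidableEq V]

/-- `PathOn G a b X`: there is a path of `G` from `a` to `b` with vertex set `X`. -/
inductive PathOn (G : SimpleGraph V) : V → V → Finset V → Prop
  | single (a : V) : PathOn G a a {a}
  | cons {a b c : V} {X : Finset V} (h : G.Adj a b) (ha : a ∉ X) (p : PathOn G b c X) :
      PathOn G a c (insert a X)

namespace PathOn

variable {G : SimpleGraph V} {a b c : V} {X Y : Finset V}

theorem start_mem (p : PathOn G a b X) : a ∈ X := by
  cases p <;> simp

theorem end_mem (p : PathOn G a b X) : b ∈ X := by
  induction p <;> simp_all

theorem append (p : PathOn G a b X) (q : PathOn G b c Y) (h : ∀ v ∈ X, v ∈ Y → v = b) :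
    PathOn G a c (X ∪ Y) := by
  induction p with
  | single a => rwa [Finset.union_eq_right.2 (by simpa using q.start_mem)]
  | @cons a d e X hd ha p ih =>
    rw [Finset.insert_union]
    refine .cons hd ?_ (ih q (by grind))
    have := p.end_mem
    grind

theorem edge (h : G.Adj a b) : PathOn G a b {a, b} :=
  .cons h (by simpa using h.ne) (.single b)

theorem snoc (p : PathOn G a b X) (h : G.Adj b c) (hc : c ∉ X) : PathOn G a c (insert c X) := by
  have := p.append (edge h) (by grind)
  have hb := p.end_mem
  rwa [show X ∪ {b, c} = insert c X by grind] at this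

theorem reverse (p : PathOn G a b X) : PathOn G b a X := by
  induction p with
  | single a => exact .single a
  | cons h ha p ih => exact ih.snoc h.symm ha

theorem join (p : PathOn G a b X) {d : V} (h : G.Adj b c) (q : PathOn G c d Y)
    (hXY : Disjoint X Y) : PathOn G a d (X ∪ Y) := by
  have hb := p.end_mem
  have := p.append (q := q.cons h (Finset.disjoint_left.1 hXY hb))
    (by have := Finset.disjoint_left.1 hXY; grind)
  rwa [show X ∪ insert b Y = X ∪ Y by grind] at this

theorem eq_singleton (p : PathOn G a a X) : X = {a} := by
  cases p with
  | single => rfl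
  | cons h ha q => exact absurd q.end_mem ha

/-- Split a path at its first vertex in `D`. -/
theorem first_split (p : PathOn G a b X) (D : Set V) (h : ∃ v ∈ X, v ∈ D) :
    ∃ v Y Z, PathOn G a v Y ∧ PathOn G v b Z ∧ v ∈ D ∧ (∀ u ∈ Y, u ∈ D → u = v) ∧
      (∀ u ∈ Y, u ∈ Z → u = v) ∧ X = Y ∪ Z := by
  induction p with
  | single a => exact ⟨a, {a}, {a}, .single a, .single a, by simp_all, by simp, by simp, by simp⟩
  | @cons a d e X hd ha p ih =>
    by_cases haD : a ∈ D
    · exact ⟨a, {a}, insert a X, .single a, .cons hd ha p, haD, by simp, by simp, by simp⟩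
    · obtain ⟨v, Y, Z, h1, h2, h3, h4, h5, rfl⟩ := ih (by grind)
      exact ⟨v, insert a Y, Z, .cons hd (by grind) h1, h2, h3, by grind, by grind, by grind⟩

/-- Split a path at its last vertex in `D`. -/
theorem last_split (p : PathOn G a b X) (D : Set V) (h : ∃ v ∈ X, v ∈ D) :
    ∃ v Y Z, PathOn G a v Y ∧ PathOn G v b Z ∧ v ∈ D ∧ (∀ u ∈ Z, u ∈ D → u = v) ∧
      (∀ u ∈ Y, u ∈ Z → u = v) ∧ X = Y ∪ Z := by
  obtain ⟨v, Y, Z, h1, h2, h3, h4, h5, rfl⟩ := p.reverse.first_split D h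
  exact ⟨v, Z, Y, h2.reverse, h1.reverse, h3, h4, by grind, by grind⟩

/-- Split a path at one of its vertices. -/
theorem split_at (p : PathOn G a b X) {v : V} (h : v ∈ X) :
    ∃ Y Z, PathOn G a v Y ∧ PathOn G v b Z ∧ (∀ u ∈ Y, u ∈ Z → u = v) ∧ X = Y ∪ Z := by
  obtain ⟨w, Y, Z, h1, h2, h3, -, h5, rfl⟩ := p.first_split {v} ⟨v, h, rfl⟩
  obtain rfl : w = v := h3
  exact ⟨Y, Z, h1, h2, h5, rfl⟩

/-- The penultimate vertex of a path. -/
theorem exists_pred (p : PathOn G a b X) (h : a ≠ b) :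
    ∃ d, G.Adj d b ∧ PathOn G a d (X.erase b) := by
  cases p.reverse with
  | single => exact absurd rfl h
  | @cons _ d _ Y hd hb q => exact ⟨d, hd.symm, by simpa [hb] using q.reverse⟩

theorem exists_walk (p : PathOn G a b X) :
    ∃ w : G.Walk a b, w.IsPath ∧ w.length + 1 = X.card ∧ ∀ v, v ∈ w.support ↔ v ∈ X := by
  induction p with
  | single a => exact ⟨.nil, by simp, by simp, by simp⟩
  | @cons a d e X hd ha p ih =>
    obtain ⟨w, h1, h2, h3⟩ := ih
    refine ⟨.cons hd w, by simp [h1, h3, ha], by simp [h2, ha], by simp [h3]⟩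

theorem of_walk {w : G.Walk a b} (hw : w.IsPath) : PathOn G a b w.support.toFinset := by
  induction w with
  | nil => simpa using .single _
  | cons h p ih =>
    rw [Walk.cons_isPath_iff] at hw
    simpa using .cons h (by simpa using hw.2) (ih hw.1)

/-- Closing a path on at least three vertices by an edge gives a cycle. -/
theorem exists_cycle (p : PathOn G a b X) (h : G.Adj b a) (h3 : 3 ≤ X.card) :
    ∃ w : G.Walk b b, w.IsCycle ∧ w.length = X.card := by
  obtain ⟨w, h1, h2, h3⟩ := p.exists_walk
  refine ⟨.cons h w, ?_, by simpa using h2⟩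
  rw [Walk.cons_isCycle_iff]
  refine ⟨h1, fun he => ?_⟩
  cases w with
  | nil => exact h.ne rfl
  | cons hd q =>
    rw [Walk.cons_isPath_iff] at h1
    rw [Walk.edges_cons, List.mem_cons] at he
    rcases he with he | he
    · obtain rfl : b = _ := by simpa [h.ne] using he
      have := (Walk.isPath_iff_nil.1 h1.1).eq_nil
      subst this
      simp at h2
      omega
    · exact h1.2 (q.snd_mem_support_of_mem_edges he)

end PathOn

theorem exists_first_hit {G : SimpleGraph V}
    (hconn : ∀ w a b, a ≠ w → b ≠ w → ∃ X, PathOn G a b X ∧ w ∉ X)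
    (w : V) (A D : Set V) (hA : ∃ a ∈ A, a ≠ w) (hD : ∃ d ∈ D, d ≠ w) :
    ∃ t d X, PathOn G t d X ∧ t ∈ A ∧ d ∈ D ∧ (∀ u ∈ X, u ∈ A → u = t) ∧
      (∀ u ∈ X, u ∈ D → u = d) ∧ w ∉ X := by
  obtain ⟨a, ha, haw⟩ := hA
  obtain ⟨d, hd, hdw⟩ := hD
  obtain ⟨X, p, hw⟩ := hconn w a d haw hdw
  obtain ⟨t, Y, Z, -, h2, h3, h4, -, rfl⟩ := p.last_split A ⟨a, p.start_mem, ha⟩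
  obtain ⟨e, Y', Z', h1', -, h3', h4', -, rfl⟩ := h2.first_split D ⟨d, h2.end_mem, hd⟩
  exact ⟨t, e, Y', h1', h3, h3', by grind, h4', by grind⟩

/-- In a graph where deleting any vertex leaves the rest connected (`hconn`), a path from `z` to `C`
leaving `Z` can be replaced by two disjoint paths from `Z` to `C`, one of them still starting
at `z`. -/
theorem exists_disjoint_paths {G : SimpleGraph V}
    (hconn : ∀ w a b, a ≠ w → b ≠ w → ∃ X, PathOn G a b X ∧ w ∉ X)
    {C : Set V} (hC : ∀ v, ∃ u ∈ C, u ≠ v) {z x : V} {X : Finset V} (p : PathOn G z x X)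
    (hx : x ∈ C) (Z : Set V) (hz : z ∈ Z) (hXZ : ∀ v ∈ X, v ∈ Z → v = z) (hZ : ∃ t ∈ Z, t ≠ z) :
    ∃ y Y t y' Y', PathOn G z y Y ∧ PathOn G t y' Y' ∧ y ∈ C ∧ y' ∈ C ∧ t ∈ Z ∧ t ≠ z ∧
      (∀ v ∈ Y, v ∈ Z → v = z) ∧ (∀ v ∈ Y', v ∈ Z → v = t) ∧ (∀ v ∈ Y, v ∉ Y') := by
  induction p generalizing Z with
  | single x =>
    obtain ⟨t, d, T, h1, h2, h3, h4, -, h6⟩ := exists_first_hit hconn x Z C hZ (hC x)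
    have := h1.start_mem
    exact ⟨x, {x}, t, d, T, .single x, h1, hx, h3, h2, by grind, by simp, h4, by simpa⟩
  | @cons z z₁ x X hzz hzX p ih =>
    have hz₁ := p.start_mem
    obtain ⟨y, Y, t, y', Y', q, q', hy, hy', ht, htz, hYZ, hYZ', hYY⟩ :=
      ih hx (insert z₁ Z) (by simp) (by grind) ⟨z, by simp [hz], hzz.ne⟩
    have hq := q.start_mem
    have hq' := q'.start_mem
    have hz₁Z : z₁ ∉ Z := by grind
    by_cases htz0 : t = z
    · subst htz0
      obtain ⟨t', d, T, r, h2, h3, h4, h5, h6⟩ := exists_first_hit hconn t {v | v ∈ Z ∧ v ≠ t}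
        {v | (v ∈ Y ∨ v ∈ Y' ∨ v ∈ C) ∧ v ≠ t}
        (by obtain ⟨u, hu, hut⟩ := hZ; exact ⟨u, ⟨hu, hut⟩, hut⟩)
        (by obtain ⟨u, hu, hut⟩ := hC t; exact ⟨u, ⟨.inr (.inr hu), hut⟩, hut⟩)
      obtain ⟨h2, h2'⟩ := h2
      have hTZ : ∀ u ∈ T, u ∈ Z → u = t' := fun u hu huZ => h4 u hu ⟨huZ, by grind⟩
      have hTY : ∀ u ∈ T, u ∈ Y → u = d := fun u hu h => h5 u hu ⟨.inl h, by grind⟩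
      have hTY' : ∀ u ∈ T, u ∈ Y' → u = d := fun u hu h => h5 u hu ⟨.inr (.inl h), by grind⟩
      have hYZ₀ : ∀ v ∈ Y, v ∉ Z := by grind
      have hYZ₀' : ∀ v ∈ Y', v ∈ Z → v = t := by grind
      have hzY : t ∉ Y := by grind
      have hdt : d ≠ t := h3.2
      replace h3 := h3.1
      clear hconn hC ih h4 h5 hXZ hYZ hYZ' hZ hzX hz₁ p
      have hd := r.end_mem
      have ht' := r.start_mem
      by_cases hdY : d ∈ Y
      · obtain ⟨Ya, Yb, -, qb, hab, rfl⟩ := q.split_at hdY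
        exact ⟨y', Y', t', y, T ∪ Yb, q', r.append qb (by grind), hy', hy, h2, h2',
          by grind, by grind, by grind⟩
      by_cases hdY' : d ∈ Y'
      · obtain ⟨Ya, Yb, qa, qb, hab, rfl⟩ := q'.split_at hdY'
        have := qa.start_mem
        exact ⟨y, insert t Y, t', y', T ∪ Yb, q.cons hzz (by grind), r.append qb (by grind), hy, hy',
          h2, h2', by grind, by grind, by grind⟩
      · exact ⟨y', Y', t', d, T, q', r, hy', by grind, h2, h2', by grind, by grind, by grind⟩
    · exact ⟨y, insert z Y, t, y', Y', q.cons hzz (by grind), q', hy, hy', by grind, htz0, by grind,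
        by grind, by grind⟩

namespace CyclicEnum

variable {G : SimpleGraph V} {c : ℕ} {f : ℕ → V}

theorem arc (hf : CyclicEnum G c f) (i : ℕ) {n : ℕ} (hn : n < c) :
    PathOn G (f i) (f (i + n)) ((Finset.range (n + 1)).image fun t => f (i + t)) := by
  induction n with
  | zero => simpa using PathOn.single (G := G) (f i)
  | succ n ih =>
    rw [Finset.range_add_one, Finset.image_insert]
    refine (ih (by omega)).snoc (hf.adj _) ?_
    simp only [Finset.mem_image, Finset.mem_range, not_exists, not_and]
    intro t ht h
    have := hf.inj_window (by omega) hn h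
    omega

theorem card_le_of_ear (hf : CyclicEnum G c f) (hc : 3 ≤ c)
    (hmax : ∀ a b X, PathOn G a b X → G.Adj b a → 3 ≤ X.card → X.card ≤ c)
    {i d : ℕ} (hd : 0 < d) (hdc : d < c) {X : Finset V} (p : PathOn G (f i) (f (i + d)) X)
    (hX : ∀ v ∈ X, ∀ j, f j = v → v = f i ∨ v = f (i + d)) : X.card ≤ d + 1 := by
  have harc := hf.arc (i + d) (n := c - d - 1) (by omega)
  set A := (Finset.range (c - d - 1 + 1)).image fun t => f (i + d + t) with hA
  have hAcard : A.card = c - d := by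
    rw [hA, Finset.card_image_of_injOn, Finset.card_range]
    · omega
    · intro s hs t ht h
      simp only [Finset.coe_range, Set.mem_Iio] at hs ht
      exact hf.inj_window (by omega) (by omega) h
  have hXA : ∀ v ∈ X, v ∈ A → v = f (i + d) := by
    intro v hv hvA
    obtain ⟨t, ht, rfl⟩ := Finset.mem_image.1 hvA
    rw [Finset.mem_range] at ht
    refine (hX _ hv _ rfl).resolve_left fun h => ?_
    have := hf.inj_window (i := i) (s := d + t) (t := 0) (by omega) (by omega)
      (by simpa [add_assoc] using h)
    omega
  have hint : X ∩ A = {f (i + d)} := by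
    have := p.end_mem
    have := harc.start_mem
    ext v
    grind
  have hcard := Finset.card_union_add_card_inter X A
  rw [hint, Finset.card_singleton, hAcard] at hcard
  have hadj := hf.adj (i + d + (c - d - 1))
  rw [show i + d + (c - d - 1) + 1 = i + c by omega, hf.periodic] at hadj
  by_cases h3 : 3 ≤ (X ∪ A).card
  · have := hmax _ _ _ (p.append harc hXA) hadj h3
    omega
  · omega

theorem card_le_of_ear' (hf : CyclicEnum G c f) (hc : 3 ≤ c)
    (hmax : ∀ a b X, PathOn G a b X → G.Adj b a → 3 ≤ X.card → X.card ≤ c)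
    {i d : ℕ} (hd : 0 < d) (hdc : d < c) {X : Finset V} (p : PathOn G (f i) (f (i + d)) X)
    (hX : ∀ v ∈ X, ∀ j, f j = v → v = f i ∨ v = f (i + d)) : X.card ≤ c - d + 1 := by
  have h : f (i + d + (c - d)) = f i := by
    rw [show i + d + (c - d) = i + c by omega, hf.periodic]
  refine hf.card_le_of_ear hc hmax (i := i + d) (d := c - d) (by omega) (by omega)
    (by rw [h]; exact p.reverse) fun v hv j hj => ?_
  rw [h]
  exact (hX v hv j hj).symm

/-- A path between two vertices of a longest cycle that is otherwise disjoint from it. -/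
theorem card_le_half (hf : CyclicEnum G c f) (hc : 3 ≤ c)
    (hmax : ∀ a b X, PathOn G a b X → G.Adj b a → 3 ≤ X.card → X.card ≤ c)
    {C : Set V} (hC : ∀ v, v ∈ C ↔ ∃ i, f i = v) {x y : V} (hx : x ∈ C) (hy : y ∈ C) (hxy : x ≠ y)
    {X : Finset V} (p : PathOn G x y X) (hX : ∀ v ∈ X, v ∈ C → v = x ∨ v = y) :
    X.card ≤ c / 2 + 1 := by
  obtain ⟨i, rfl⟩ := (hC x).1 hx
  obtain ⟨j, rfl⟩ := (hC y).1 hy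
  obtain ⟨d, hd, hdj⟩ := hf.exists_offset (by omega) i j
  rw [← hdj] at p hX hxy
  have hd0 : 0 < d := by
    rcases Nat.eq_zero_or_pos d with rfl | h
    · exact absurd rfl hxy
    · exact h
  have hX' : ∀ v ∈ X, ∀ j, f j = v → v = f i ∨ v = f (i + d) :=
    fun v hv j hj => hX v hv ((hC v).2 ⟨j, hj⟩)
  have := hf.card_le_of_ear hc hmax hd0 hd p hX'
  have := hf.card_le_of_ear' hc hmax hd0 hd p hX'
  omega

end CyclicEnum

theorem two_mul_card_le_of_no_consecutive {J : Finset ℕ} {a b : ℕ} (hab : a ≤ b + 1)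
    (hJ : ∀ d ∈ J, a ≤ d ∧ d ≤ b) (h : ∀ d ∈ J, d + 1 ∉ J) : 2 * J.card ≤ b + 2 - a := by
  have hdisj : Disjoint J (J.image (· + 1)) := by
    rw [Finset.disjoint_right]
    intro d hd
    obtain ⟨e, he, rfl⟩ := Finset.mem_image.1 hd
    exact h e he
  have hsub : J ∪ J.image (· + 1) ⊆ Finset.Icc a (b + 1) := by
    intro d hd
    rw [Finset.mem_union, Finset.mem_image] at hd
    rw [Finset.mem_Icc]
    rcases hd with hd | ⟨e, he, rfl⟩
    · have := hJ d hd
      omega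
    · have := hJ e he
      omega
  have := Finset.card_le_card hsub
  rw [Finset.card_union_of_disjoint hdisj,
    Finset.card_image_of_injective _ (add_left_injective 1), Nat.card_Icc] at this
  omega

/-- If a path leaves a longest cycle at `x` and its end `b` has neighbours other than `x` on the
cycle, then these neighbours are few. -/
theorem CyclicEnum.card_add_card_neighbors_le {G : SimpleGraph V} {c : ℕ} {f : ℕ → V}
    (hf : CyclicEnum G c f) (hc : 3 ≤ c)
    (hmax : ∀ a b X, PathOn G a b X → G.Adj b a → 3 ≤ X.card → X.card ≤ c)
    {C : Finset V} (hC : ∀ v, v ∈ C ↔ ∃ i, f i = v) {x b : V} (hx : x ∈ C) (hb : b ∉ C)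
    {X : Finset V} (p : PathOn G x b X) (hX : ∀ v ∈ X, v ∈ C → v = x)
    {B : Finset V} (hB : ∀ y ∈ B, y ∈ C ∧ y ≠ x ∧ G.Adj b y) (hB0 : B.Nonempty) :
    2 * (X.card + B.card) ≤ c + 2 := by
  classical
  obtain ⟨i, rfl⟩ := (hC x).1 hx
  set J := (Finset.range c).filter fun d => f (i + d) ∈ B with hJdef
  have hBJ : B ⊆ J.image fun d => f (i + d) := by
    intro y hy
    obtain ⟨j, rfl⟩ := (hC y).1 (hB y hy).1
    obtain ⟨d, hd, hdj⟩ := hf.exists_offset (by omega) i j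
    exact Finset.mem_image.2 ⟨d, by simp [hJdef, hd, hdj, hy], hdj⟩
  have hBcard := (Finset.card_le_card hBJ).trans Finset.card_image_le
  have hJ0 : ∀ d ∈ J, 0 < d ∧ d < c ∧ f (i + d) ∈ B := by
    intro d hd
    rw [hJdef, Finset.mem_filter, Finset.mem_range] at hd
    refine ⟨Nat.pos_of_ne_zero ?_, hd⟩
    rintro rfl
    exact (hB _ hd.2).2.1 rfl
  have hJ : ∀ d ∈ J, X.card ≤ d ∧ d ≤ c - X.card := by
    intro d hd
    obtain ⟨hd0, hdc, hdB⟩ := hJ0 d hd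
    obtain ⟨h1, h2, h3⟩ := hB _ hdB
    have hdX : f (i + d) ∉ X := fun h => h2 (hX _ h h1)
    have q := p.snoc h3 hdX
    have hq : ∀ v ∈ insert (f (i + d)) X, ∀ j, f j = v → v = f i ∨ v = f (i + d) := by
      intro v hv j hj
      rcases Finset.mem_insert.1 hv with rfl | hv
      · exact .inr rfl
      · exact .inl (hX v hv ((hC v).2 ⟨j, hj⟩))
    have e1 := hf.card_le_of_ear hc hmax hd0 hdc q hq
    have e2 := hf.card_le_of_ear' hc hmax hd0 hdc q hq
    rw [Finset.card_insert_of_notMem hdX] at e1 e2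
    omega
  have hJJ : ∀ d ∈ J, d + 1 ∉ J := by
    intro d hd hd'
    obtain ⟨-, -, hdB⟩ := hJ0 d hd
    obtain ⟨-, -, hdB'⟩ := hJ0 _ hd'
    have h1 := (hB _ hdB).2.2
    have h2 := (hB _ hdB').2.2
    have hne := (hf.adj (i + d)).ne
    rw [← add_assoc] at h2
    have q := (PathOn.edge h1.symm).snoc h2 (by simp [hne.symm, h2.ne.symm])
    have := hf.card_le_of_ear hc hmax one_pos (by omega) q (by
      intro v hv j hj
      have : v ∈ C := (hC v).2 ⟨j, hj⟩
      grind)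
    rw [Finset.card_insert_of_notMem (by simp [hne.symm, h2.ne.symm]),
      Finset.card_pair h1.ne.symm] at this
    omega
  obtain ⟨y, hy⟩ := hB0
  obtain ⟨d, hd, -⟩ := Finset.mem_image.1 (hBJ hy)
  have := hJ d hd
  have := two_mul_card_le_of_no_consecutive (by omega) hJ hJJ
  omega

theorem exists_long_ear {G : SimpleGraph V}
    (hconn : ∀ w a b, a ≠ w → b ≠ w → ∃ X, PathOn G a b X ∧ w ∉ X)
    {C : Set V} (hC : ∀ v, ∃ u ∈ C, u ≠ v) {x b : V} (hx : x ∈ C) {X : Finset V}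
    (p : PathOn G x b X) (hX : ∀ v ∈ X, v ∈ C → v = x) {N : Finset V} (hN : N.Nonempty)
    (hNX : N ⊆ X) (hNb : ∀ v ∈ N, G.Adj b v) :
    ∃ y y' W, PathOn G y y' W ∧ y ∈ C ∧ y' ∈ C ∧ y ≠ y' ∧
      (∀ v ∈ W, v ∈ C → v = y ∨ v = y') ∧ N.card + 2 ≤ W.card := by
  obtain ⟨z, X₀, Z, p₀, pZ, hzN, hX₀N, hX₀Z, rfl⟩ :=
    p.first_split {v | v ∈ N} (by obtain ⟨v, hv⟩ := hN; exact ⟨v, hNX hv, hv⟩)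
  have hbz := (hNb z hzN).ne
  have hzX₀ := p₀.end_mem
  have hxX₀ := p₀.start_mem
  have hzZ := pZ.start_mem
  have hbZ := pZ.end_mem
  have hNZ : ∀ v ∈ N, v ∈ Z := by
    intro v hv
    rcases Finset.mem_union.1 (hNX hv) with h | h
    · rwa [hX₀N v h hv]
    · exact h
  obtain ⟨y₁, Y₁, t, y₂, Y₂, q₁, q₂, hy₁, hy₂, htZ, htz, hY₁Z, hY₂Z, hYY⟩ :=
    exists_disjoint_paths hconn hC p₀.reverse hx {v | v ∈ Z} hzZ
      (fun v hv hvZ => hX₀Z v hv hvZ) ⟨b, hbZ, hbz⟩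
  obtain ⟨y, R, R', r, -, hy, hRC, -, rfl⟩ := q₁.first_split C ⟨y₁, q₁.end_mem, hy₁⟩
  obtain ⟨y', T, T', s, -, hy', hTC, -, rfl⟩ := q₂.first_split C ⟨y₂, q₂.end_mem, hy₂⟩
  have hRZ : ∀ v ∈ R, v ∈ Z → v = z := fun v hv => hY₁Z v (Finset.mem_union_left _ hv)
  have hTZ : ∀ v ∈ T, v ∈ Z → v = t := fun v hv => hY₂Z v (Finset.mem_union_left _ hv)
  have hRT : ∀ v ∈ R, v ∉ T := fun v hv hv' =>
    hYY v (Finset.mem_union_left _ hv) (Finset.mem_union_left _ hv')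
  clear hYY hY₁Z hY₂Z q₁ q₂ hy₁ hy₂
  have hzR := r.start_mem
  have hyR := r.end_mem
  have htT := s.start_mem
  have hyT := s.end_mem
  have hZC : ∀ v ∈ Z, v ∈ C → v = y := by
    intro v hv hvC
    have hvx := hX v (Finset.mem_union_right _ hv) hvC
    have hvz := hX₀Z x hxX₀ (hvx ▸ hv)
    rw [hvx, hvz]
    exact hRC z hzR (hvz ▸ hx)
  obtain ⟨Za, Zb, pa, pb, hab, rfl⟩ := pZ.split_at htZ
  have hza : z ∈ Za := pa.start_mem
  have hta := pa.end_mem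
  have htb := pb.start_mem
  have hbb := pb.end_mem
  obtain ⟨i, Zi, Zr, pi, pr, hiN, hZrN, hir, rfl⟩ :=
    pa.last_split {v | v ∈ N ∧ v ≠ t} ⟨z, hza, hzN, htz.symm⟩
  have htr := pr.end_mem
  have hzi := pi.start_mem
  have hdisj : Disjoint Zi Zb := by
    rw [Finset.disjoint_left]
    intro v hv hv'
    have hvt := hab v (Finset.mem_union_left _ hv) hv'
    subst hvt
    exact hiN.2 (hir v hv htr).symm
  have hNW : ∀ v ∈ N, v ∈ Zi ∪ Zb := by
    intro v hv
    have hii := pi.end_mem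
    have h1 : v ∈ Zr → v = t ∨ v = i := fun h => by
      by_cases hvt : v = t
      · exact .inl hvt
      · exact .inr (hZrN v h ⟨hv, hvt⟩)
    have := hNZ v hv
    grind
  have m := pi.join (hNb i hiN.1).symm pb.reverse hdisj
  set M := Zi ∪ Zb with hM
  have hMZ : ∀ v ∈ M, v ∈ Zi ∪ Zr ∪ Zb := by grind
  have hzM : z ∈ M := by grind
  have hbM : b ∈ M := by grind
  have m₁ := r.reverse.append m fun v hv hv' => hRZ v hv (hMZ v hv')
  have m₂ := m₁.append s fun v hv hv' => by
    rcases Finset.mem_union.1 hv with h | h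
    · exact absurd hv' (hRT v h)
    · exact hTZ v hv' (hMZ v h)
  have hyy : y ≠ y' := by
    rintro rfl
    exact hRT _ hyR hyT
  refine ⟨y, y', _, m₂, hy, hy', hyy, ?_, ?_⟩
  · intro v hv hvC
    rcases Finset.mem_union.1 hv with h | h
    · rcases Finset.mem_union.1 h with h | h
      · exact .inl (hRC v h hvC)
      · exact .inl (hZC v (hMZ v h) hvC)
    · exact .inr (hTC v h hvC)
  · have hbN : b ∉ N := fun h => (hNb b h).ne rfl
    have hyM : y' ∉ M := fun h => hyy (hZC y' (hMZ y' h) hy').symm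
    have hyN : y' ∉ insert b N := by
      intro h
      rcases Finset.mem_insert.1 h with h | h
      · exact hyM (h ▸ hbM)
      · exact hyM (hNW y' h)
    rw [← Nat.add_assoc N.card 1 1, ← Finset.card_insert_of_notMem hbN,
      ← Finset.card_insert_of_notMem hyN]
    refine Finset.card_le_card ?_
    intro v hv
    have := hNW v
    grind

theorem exists_deficient [Finite V] {G : SimpleGraph V} [DecidableRel G.Adj] {c : ℕ} {f : ℕ → V}
    (hf : CyclicEnum G c f) (hc : 3 ≤ c)
    (hmax : ∀ a b X, PathOn G a b X → G.Adj b a → 3 ≤ X.card → X.card ≤ c)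
    (hconn : ∀ w a b, a ≠ w → b ≠ w → ∃ X, PathOn G a b X ∧ w ∉ X)
    {C : Finset V} (hC : ∀ v, v ∈ C ↔ ∃ i, f i = v) {S : Finset V} (hSC : Disjoint S C)
    (hS : S.Nonempty) (hdegC : ∀ s ∈ S, (C.filter (G.Adj s)).card < c / 2)
    (hdeg : ∀ s ∈ S, c / 2 ≤ ((S ∪ C).filter (G.Adj s)).card)
    (hdeg₂ : ∀ s ∈ S, ∀ t ∈ S, G.Adj s t →
      2 * (c / 2) + 1 ≤ ((S ∪ C).filter (G.Adj s)).card + ((S ∪ C).filter (G.Adj t)).card) :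
    False := by
  have hSC' := Finset.disjoint_left.1 hSC
  have hC₂ : ∀ v, ∃ u ∈ (C : Set V), u ≠ v := by
    intro v
    by_cases h : f 0 = v
    · refine ⟨f 1, (hC _).2 ⟨1, rfl⟩, ?_⟩
      rw [← h]
      exact (hf.adj 0).ne.symm
    · exact ⟨f 0, (hC _).2 ⟨0, rfl⟩, h⟩
  -- a longest path from the cycle into `S`
  obtain ⟨x, b, X, p, hx, hb, hX, hlong⟩ : ∃ x b X, PathOn G x b X ∧ x ∈ C ∧ b ∈ S ∧
      (∀ v ∈ X, v ∈ C → v = x) ∧ ∀ x' b' X', PathOn G x' b' X' → x' ∈ C → b' ∈ S →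
        (∀ v ∈ X', v ∈ C → v = x') → X'.card ≤ X.card := by
    obtain ⟨w, hw⟩ := hC₂ (f 0)
    obtain ⟨s, hs⟩ := hS
    have hwS : s ≠ f 0 := fun h => hSC' hs ((hC s).2 ⟨0, h.symm⟩)
    obtain ⟨x, b, X, p, hx, hb, hX, -⟩ :=
      exists_first_hit hconn (f 0) {v | v ∈ C} {v | v ∈ S} ⟨w, hw⟩ ⟨s, hs, hwS⟩
    obtain ⟨X, ⟨x, b, h1, h2, h3, h4⟩, hlong⟩ := Set.exists_max_image
      {X : Finset V | ∃ x b, PathOn G x b X ∧ x ∈ C ∧ b ∈ S ∧ ∀ v ∈ X, v ∈ C → v = x}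
      Finset.card (Set.toFinite _) ⟨X, x, b, p, hx, hb, hX⟩
    exact ⟨x, b, X, h1, h2, h3, h4, fun x' b' X' g1 g2 g3 g4 => hlong X' ⟨x', b', g1, g2, g3, g4⟩⟩
  -- neighbours in `S` of the end of a longest path lie on the path
  have hN : ∀ b' ∈ S, PathOn G x b' X → ∀ s ∈ S, G.Adj b' s → s ∈ X := by
    intro b' hb' p' s hs hadj
    by_contra hsX
    have := hlong x s _ (p'.snoc hadj hsX) hx hs (by have := hSC' hs; grind)
    rw [Finset.card_insert_of_notMem hsX] at this
    omega
  have hXx := p.start_mem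
  have hxS : x ∉ S := fun h => hSC' h hx
  have hsplit : ∀ b' ∈ S, (∃ y ∈ C, y ≠ x ∧ G.Adj b' y) → PathOn G x b' X →
      2 * (X.card + (((C.erase x).filter (G.Adj b')).card)) ≤ c + 2 ∧
      1 ≤ ((C.erase x).filter (G.Adj b')).card := by
    intro b' hb' ⟨y, hy, hyx, hby⟩ p'
    have hne : ((C.erase x).filter (G.Adj b')).Nonempty := ⟨y, by simp [hy, hyx, hby]⟩
    exact ⟨hf.card_add_card_neighbors_le hc hmax hC hx (hSC' hb') p' hX
      (by intro y hy; simp at hy; tauto) hne, hne.card_pos⟩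
  have hbound : ∀ b' ∈ S, PathOn G x b' X → ((S ∪ C).filter (G.Adj b')) ⊆
      X.erase b' ∪ (C.erase x).filter (G.Adj b') := by
    intro b' hb' p' v hv
    have h1 := hN b' hb' p' v
    have h2 : G.Adj b' v → v ≠ b' := fun h => h.ne.symm
    grind
  by_cases hB : ∃ y ∈ C, y ≠ x ∧ G.Adj b y
  · obtain ⟨h1, h2⟩ := hsplit b hb hB p
    have hbX := p.end_mem
    have hle := Finset.card_le_card (hbound b hb p)
    have hun := Finset.card_union_le (X.erase b) ((C.erase x).filter (G.Adj b))
    have hXe := Finset.card_erase_of_mem hbX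
    have hd := hdeg b hb
    have hX0 : 0 < X.card := Finset.card_pos.2 ⟨_, hbX⟩
    -- all inequalities are tight
    have heq : ((S ∪ C).filter (G.Adj b)) = X.erase b ∪ (C.erase x).filter (G.Adj b) :=
      Finset.eq_of_subset_of_card_le (hbound b hb p) (by omega)
    have hcard : ((S ∪ C).filter (G.Adj b)).card ≤ c / 2 := by omega
    have hadj : ∀ v ∈ X, v ≠ b → G.Adj b v ∧ (v ∈ S ∨ v ∈ C) := by
      intro v hv hvb
      have : v ∈ (S ∪ C).filter (G.Adj b) := by
        rw [heq]
        exact Finset.mem_union_left _ (Finset.mem_erase.2 ⟨hvb, hv⟩)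
      simpa [and_comm] using this
    have hxb : x ≠ b := by rintro rfl; exact hxS hb
    obtain ⟨b', hb'b, p'⟩ := p.exists_pred hxb
    have hb'X := Finset.mem_erase.1 p'.end_mem
    have hxb' : x ≠ b' := by
      rintro rfl
      have hX2 : ∀ v ∈ X, v ≠ b → v = x := by
        intro v hv hvb
        simpa [p'.eq_singleton] using Finset.mem_erase.2 ⟨hvb, hv⟩
      have hsub : (S ∪ C).filter (G.Adj b) ⊆ C.filter (G.Adj b) := by
        rw [heq]
        intro v hv
        have := hX2 v
        have := (hadj x hXx hxb).1
        grind
      have := hdegC b hb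
      have := Finset.card_le_card hsub
      omega
    have hb'S : b' ∈ S := (hadj b' hb'X.2 hb'X.1).2.resolve_right fun h => hxb' (hX b' hb'X.2 h).symm
    obtain ⟨e, heb', pe⟩ := p'.exists_pred hxb'
    have he := pe.end_mem
    simp only [Finset.mem_erase] at he
    have pb : PathOn G x b' X := by
      have h3 := pe.snoc (hadj e he.2.2 he.2.1).1.symm (by simp)
      have h4 := h3.snoc hb'b.symm (by simp [hb'X.1])
      rwa [Finset.insert_comm, Finset.insert_erase (Finset.mem_erase.2 hb'X),
        Finset.insert_erase hbX] at h4
    have hd' := hdeg₂ b hb b' hb'S hb'b.symm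
    by_cases hB' : ∃ y ∈ C, y ≠ x ∧ G.Adj b' y
    · obtain ⟨h1', h2'⟩ := hsplit b' hb'S hB' pb
      have hle' := Finset.card_le_card (hbound b' hb'S pb)
      have hun' := Finset.card_union_le (X.erase b') ((C.erase x).filter (G.Adj b'))
      rw [Finset.card_erase_of_mem hb'X.2] at hun'
      omega
    · have hle' := Finset.card_le_card (hbound b' hb'S pb)
      have hemp : (C.erase x).filter (G.Adj b') = ∅ := by
        ext v
        simp
        grind
      rw [hemp, Finset.union_empty, Finset.card_erase_of_mem hb'X.2] at hle'
      omega
  · have hd := hdeg b hb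
    obtain ⟨y, y', W, q, hy, hy', hyy, hW, hWc⟩ := exists_long_ear hconn hC₂ hx p
      (fun v hv h => hX v hv h) (N := (S ∪ C).filter (G.Adj b))
      (Finset.card_pos.1 (by omega))
      (fun v hv => by
        have := hN b hb p v
        grind)
      (by simp)
    have := hf.card_le_half hc hmax (C := C) hC hy hy' hyy q hW
    omega

/-- The number of edges of `G` inside `S ∪ C` with an end in `S`. -/
noncomputable def incidentCount [Fintype V] (G : SimpleGraph V) (S C : Finset V) : ℕ :=
  {e : Sym2 V | e ∈ G.edgeSet ∧ (∀ x ∈ e, x ∈ S ∪ C) ∧ ∃ x ∈ e, x ∈ S}.ncard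

theorem incidentCount_le [Fintype V] (G : SimpleGraph V) [DecidableRel G.Adj] (S C : Finset V)
    (s : V) : incidentCount G S C ≤
      incidentCount G (S.erase s) C + ((S ∪ C).filter (G.Adj s)).card := by
  unfold incidentCount
  rw [← Set.ncard_coe_finset ((S ∪ C).filter (G.Adj s))]
  refine (Set.ncard_le_ncard (t := _ ∪ (fun v => s(s, v)) '' (((S ∪ C).filter (G.Adj s) : Finset V) :
    Set V)) ?_ (Set.toFinite _)).trans ((Set.ncard_union_le _ _).trans
      (Nat.add_le_add_left (Set.ncard_image_le (Set.toFinite _)) _))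
  rintro e ⟨he, hSC, x, hxe, hx⟩
  by_cases hs : s ∈ e
  · right
    obtain ⟨v, rfl⟩ := hs
    exact ⟨v, by simpa [← Finset.mem_union] using ⟨hSC v (by simp), he⟩, rfl⟩
  · left
    refine ⟨he, fun y hy => ?_, x, hxe, Finset.mem_erase.2 ⟨fun h => hs (h ▸ hxe), hx⟩⟩
    have hys : y ≠ s := fun h => hs (h ▸ hy)
    have := hSC y hy
    grind

theorem incidentCount_add_card_le [Fintype V] {G : SimpleGraph V} {c : ℕ} {f : ℕ → V}
    (hf : CyclicEnum G c f) (hc : 3 ≤ c)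
    (hmax : ∀ a b X, PathOn G a b X → G.Adj b a → 3 ≤ X.card → X.card ≤ c)
    (hconn : ∀ w a b, a ≠ w → b ≠ w → ∃ X, PathOn G a b X ∧ w ∉ X) [DecidableRel G.Adj]
    {C : Finset V} (hC : ∀ v, v ∈ C ↔ ∃ i, f i = v)
    (hdegC : ∀ s ∉ C, (C.filter (G.Adj s)).card < c / 2) (S : Finset V) (hSC : Disjoint S C) :
    2 * incidentCount G S C + S.card ≤ 2 * (c / 2) * S.card := by
  induction S using Finset.strongInduction with
  | H S ih =>
    by_contra! hcon
    have hSC' := Finset.disjoint_left.1 hSC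
    have herase : ∀ s ∈ S, 2 * incidentCount G (S.erase s) C + (S.erase s).card ≤
        2 * (c / 2) * (S.erase s).card := fun s hs =>
      ih _ (Finset.erase_ssubset hs) (hSC.mono_left (Finset.erase_subset _ _))
    have hcard : ∀ s ∈ S, S.card = (S.erase s).card + 1 := fun s hs =>
      (Finset.card_erase_add_one hs).symm
    refine exists_deficient hf hc hmax hconn hC hSC ?_ (fun s hs => hdegC s (hSC' hs)) ?_ ?_
    · rw [Finset.nonempty_iff_ne_empty]
      rintro rfl
      simp [incidentCount] at hcon
    · intro s hs
      have h1 := herase s hs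
      have h2 := incidentCount_le G S C s
      rw [hcard s hs, mul_add] at hcon
      omega
    · intro s hs t ht hst
      have hts : t ∈ S.erase s := Finset.mem_erase.2 ⟨hst.ne.symm, ht⟩
      have h1 := ih ((S.erase s).erase t)
        ((Finset.erase_ssubset hts).trans (Finset.erase_ssubset hs))
        (hSC.mono_left ((Finset.erase_subset _ _).trans (Finset.erase_subset _ _)))
      have h2 := incidentCount_le G S C s
      have h3 := incidentCount_le G (S.erase s) C t
      have h4 : (S.erase s ∪ C).filter (G.Adj t) = ((S ∪ C).filter (G.Adj t)).erase s := by
        have := hSC' hs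
        ext v
        grind
      have hmem : s ∈ (S ∪ C).filter (G.Adj t) := by simp [hs, hst.symm]
      have h5 := Finset.card_pos.2 ⟨s, hmem⟩
      rw [h4, Finset.card_erase_of_mem hmem] at h3
      rw [hcard s hs, ← Finset.card_erase_add_one hts, mul_add, mul_add] at hcon
      omega

theorem TwoConnected.exists_path {G : SimpleGraph V} (h : TwoConnected G) (w a b : V) (ha : a ≠ w)
    (hb : b ≠ w) : ∃ X, PathOn G a b X ∧ w ∉ X := by
  obtain ⟨p⟩ := (h.2 w).preconnected ⟨a, by simpa using ha⟩ ⟨b, by simpa using hb⟩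
  obtain ⟨q, hq⟩ : ∃ q : G.Walk a b, w ∉ q.support := by
    have hw : w ∉ (p.map (Subgraph.hom _)).support := by
      rw [Walk.support_map, List.mem_map]
      rintro ⟨⟨u, hu⟩, -, huw⟩
      exact hu.2 huw
    exact ⟨p.map (Subgraph.hom _), hw⟩
  exact ⟨_, PathOn.of_walk q.bypass_isPath, by
    simpa using fun h => hq (q.support_bypass_subset_support h)⟩

end Paths

theorem stmt_13 {V : Type*} [Fintype V] (G : SimpleGraph V)
    (h2c : TwoConnected G) (v : V) (C : G.Walk v v) (hC : C.IsCycle)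
    (hmax : ∀ (w : V) (C' : G.Walk w w), C'.IsCycle → C'.length ≤ C.length)
    (hc4 : 4 ≤ C.length) (hcn : C.length ≤ Fintype.card V - 1)
    (hdeg : ∀ u : V, u ∉ C.support →
      (G.neighborSet u ∩ {x | x ∈ C.support}).ncard < C.length / 2) :
    ({e : Sym2 V | e ∈ G.edgeSet ∧ ∃ x ∈ e, x ∉ C.support}.ncard : ℝ)
      ≤ ((C.length / 2 : ℕ) - 1 / 2) * ((Fintype.card V : ℝ) - (C.length : ℝ)) := by
  classical
  set D : Finset V := C.support.toFinset with hD
  have hDcard : D.card = C.length := by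
    have hdup := List.toFinset_card_of_nodup hC.support_nodup
    rw [List.length_tail, Walk.length_support, Nat.add_sub_cancel] at hdup
    rw [← hdup]
    congr 1
    ext u
    rw [hD, List.mem_toFinset, List.mem_toFinset]
    refine ⟨fun hu => ?_, List.mem_of_mem_tail⟩
    rcases (Walk.mem_support_iff C).1 hu with rfl | hu
    · exact Walk.end_mem_tail_support hC.not_nil
    · exact hu
  have key := incidentCount_add_card_le hC.cyclicEnum (by omega)
    (fun a b X p hba h3 => by
      obtain ⟨w, hw, hwX⟩ := p.exists_cycle hba h3
      exact hwX ▸ hmax b w hw)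
    h2c.exists_path (C := D) (fun u => by rw [hD, List.mem_toFinset, hC.mem_support_iff_exists])
    (fun s hs => by
      refine lt_of_eq_of_lt ?_ (hdeg s (by simpa [hD] using hs))
      rw [← Set.ncard_coe_finset]
      congr 1
      ext u
      simp [hD, and_comm])
    Dᶜ disjoint_compl_left
  have hset : incidentCount G Dᶜ D =
      {e : Sym2 V | e ∈ G.edgeSet ∧ ∃ x ∈ e, x ∉ C.support}.ncard := by
    unfold incidentCount
    congr 1
    ext e
    simp [hD, em']
  have hcompl : ((Dᶜ.card : ℕ) : ℝ) = (Fintype.card V : ℝ) - C.length := by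
    rw [Finset.card_compl, hDcard, Nat.cast_sub (by omega)]
  rw [hset] at key
  have key' : (2 : ℝ) * ({e : Sym2 V | e ∈ G.edgeSet ∧ ∃ x ∈ e, x ∉ C.support}.ncard : ℝ) +
      (Dᶜ.card : ℝ) ≤ 2 * ((C.length / 2 : ℕ) : ℝ) * (Dᶜ.card : ℝ) := by
    exact_mod_cast key
  rw [hcompl] at key'
  linarith
end

section
/- Let G be a 2-connected n-vertex graph that contains no K_r and no cycle of length ≥ k, where n ≥ k ≥ 5, t = ⌊(k-1)/2⌋, and r ≤ t + 1. Then e(G) ≤ max{ t(n-t) + ex(t, K_{r-1}), (t - 1/2)(n - 1), ex(k-1, K_r) + (t - 1/2)(n - k + 1) }. -/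
open SimpleGraph

theorem ZMod.val_sub_add_val_sub {c : ℕ} [NeZero c] {a b : ZMod c} (h : a ≠ b) :
    (b - a).val + (a - b).val = c := by
  have h1 : b - a ≠ 0 := sub_ne_zero.mpr h.symm
  have h2 : a - b = -(b - a) := by ring
  rw [h2, ZMod.neg_val, if_neg h1]
  have := ZMod.val_lt (b - a)
  omega

theorem ZMod.val_sub_lt_of_between {c : ℕ} [NeZero c] {x y z : ZMod c} (hxy : x ≠ y)
    (h : (y - x).val < (z - x).val) : (z - y).val < (z - x).val := by
  have h1 : z - y = (z - x) - (y - x) := by ring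
  have h2 : (y - x).val ≠ 0 := by
    rw [Ne, ZMod.val_eq_zero]
    exact sub_ne_zero.mpr hxy.symm
  rw [h1, ZMod.val_sub h.le]
  omega

theorem ZMod.sum_gap_le {c : ℕ} [NeZero c] (Z : Finset (ZMod c)) (g : ZMod c → ℕ)
    (hc : ∀ z ∈ Z, g z ≤ c) (h : ∀ z ∈ Z, ∀ z' ∈ Z, z ≠ z' → g z ≤ (z' - z).val) :
    ∑ z ∈ Z, g z ≤ c := by
  have key : ∀ z ∈ Z, ∀ z' ∈ Z, ∀ a < g z, ∀ b < g z', a ≤ b → z + (a : ZMod c) = z' + b →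
      z = z' ∧ a = b := by
    intro z hz z' hz' a ha b hb hab e
    have e1 : z - z' = ((b - a : ℕ) : ZMod c) := by
      rw [Nat.cast_sub hab, sub_eq_sub_iff_add_eq_add, e, add_comm]
    have hb' := hc z' hz'
    have e2 : (z - z').val = b - a := by
      rw [e1, ZMod.val_natCast, Nat.mod_eq_of_lt (by omega)]
    have hzz : z = z' := by
      by_contra hne
      have := h z' hz' z hz (Ne.symm hne)
      omega
    refine ⟨hzz, ?_⟩
    rw [hzz, sub_self, ZMod.val_zero] at e2
    omega
  calc ∑ z ∈ Z, g z = (Z.sigma fun z => Finset.range (g z)).card := by simp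
    _ ≤ (Finset.univ : Finset (ZMod c)).card := by
        refine Finset.card_le_card_of_injOn (fun p => p.1 + (p.2 : ZMod c)) (by simp) ?_
        rintro ⟨z, a⟩ hp ⟨z', b⟩ hq e
        simp only [Finset.coe_sigma, Set.mem_sigma_iff, Finset.mem_coe, Finset.mem_range] at hp hq
        have : z = z' ∧ a = b := by
          rcases le_total a b with hab | hab
          · exact key z hp.1 z' hq.1 a hp.2 b hq.2 hab e
          · have := key z' hq.1 z hp.1 b hq.2 a hp.2 hab e.symm
            exact ⟨this.1.symm, this.2.symm⟩
        rw [this.1, this.2]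
    _ = c := by simp [ZMod.card]

theorem ZMod.card_mul_le_of_gap {c : ℕ} [NeZero c] {Z : Finset (ZMod c)} {g : ℕ}
    (hZ : 2 ≤ Z.card) (h : ∀ z ∈ Z, ∀ z' ∈ Z, z ≠ z' → g ≤ (z' - z).val) : Z.card * g ≤ c := by
  have := ZMod.sum_gap_le Z (fun _ => g) ?_ h
  · simpa using this
  · intro z hz
    obtain ⟨z', hz', hne⟩ := Finset.exists_mem_ne (show 1 < Z.card by omega) z
    exact (h z hz z' hz' hne.symm).trans (ZMod.val_lt _).le

/-- Two nonempty sets of residues on a cycle, not both the same singleton: each pair of members of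
the two sets is `p` apart, and any two residues are `q` apart. -/
theorem ZMod.two_mul_add_card_mul_le_of_gap {c : ℕ} [NeZero c] {X Y : Finset (ZMod c)} {p q : ℕ}
    (hX : 2 ≤ X.card) (hY : Y.Nonempty)
    (hXY : ∀ x ∈ X, ∀ y ∈ Y, x ≠ y → p ≤ (y - x).val ∧ p ≤ (x - y).val)
    (h : ∀ z ∈ X ∪ Y, ∀ z' ∈ X ∪ Y, z ≠ z' → q ≤ (z' - z).val) :
    2 * p + ((X ∪ Y).card - 2) * q ≤ c := by
  classical
  obtain ⟨y₀, hy₀⟩ := hY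
  obtain ⟨x₀, hx₀, hne₀⟩ := Finset.exists_mem_ne (show 1 < X.card by omega) y₀
  -- an element of one set whose successor lies in the other one
  have step : ∀ A B : Finset (ZMod c), (∃ a ∈ A, ∃ b ∈ B, a ≠ b) →
      (∀ a ∈ A, ∀ b ∈ B, a ≠ b → p ≤ (b - a).val) →
      ∃ a ∈ A, ∀ z ∈ A ∪ B, a ≠ z → p ≤ (z - a).val := by
    rintro A B ⟨a, ha, b, hb, hab⟩ hAB
    obtain ⟨⟨a', b'⟩, hm, hmin⟩ := Finset.exists_min_image
      ((A ×ˢ B).filter fun u => u.1 ≠ u.2) (fun u => (u.2 - u.1).val)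
      ⟨(a, b), by simp [ha, hb, hab]⟩
    simp only [Finset.mem_filter, Finset.mem_product] at hm hmin
    refine ⟨a', hm.1.1, fun z hz hne => ?_⟩
    by_contra hlt
    have hp := hAB a' hm.1.1 b' hm.1.2 hm.2
    rcases Finset.mem_union.mp hz with hz | hz
    · have h1 : (z - a').val < (b' - a').val := by omega
      have h2 := ZMod.val_sub_lt_of_between hne h1
      have h3 := hmin (z, b') ⟨⟨hz, hm.1.2⟩, by intro e; simp only at e; simp [e] at h1⟩
      simp only at h3
      omega
    · exact hlt (hAB a' hm.1.1 z hz hne)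
  obtain ⟨z₁, z₂, hz₁, hz₂, hne, h₁, h₂⟩ : ∃ z₁ z₂, z₁ ∈ X ∪ Y ∧ z₂ ∈ X ∪ Y ∧ z₁ ≠ z₂ ∧
      (∀ z ∈ X ∪ Y, z₁ ≠ z → p ≤ (z - z₁).val) ∧ (∀ z ∈ X ∪ Y, z₂ ≠ z → p ≤ (z - z₂).val) := by
    obtain ⟨x, hx, hx'⟩ := step X Y ⟨x₀, hx₀, y₀, hy₀, hne₀⟩
      fun x hx y hy hn => (hXY x hx y hy hn).1
    obtain ⟨y, hy, hy'⟩ := step Y X ⟨y₀, hy₀, x₀, hx₀, hne₀.symm⟩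
      fun y hy x hx hn => (hXY x hx y hy hn.symm).2
    by_cases hxy : x = y
    · subst hxy
      obtain ⟨x', hx'', hne'⟩ := Finset.exists_mem_ne (by omega : 1 < X.card) x
      obtain ⟨z, hz, hz'⟩ := step ((X ∪ Y).erase x) {x}
        ⟨x', by simp [hx'', hne'], x, by simp, hne'⟩ (by
          intro a ha b hb hab
          simp only [Finset.mem_singleton] at hb
          subst hb
          rcases Finset.mem_union.mp (Finset.mem_of_mem_erase ha) with ha | ha
          · exact (hXY a ha b hy hab).1
          · exact (hXY b hx a ha hab.symm).2)
      refine ⟨x, z, by simp [hx], Finset.mem_of_mem_erase hz, (Finset.ne_of_mem_erase hz).symm,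
        hx', fun w hw hn => hz' w ?_ hn⟩
      by_cases hwx : w = x
      · simp [hwx]
      · exact Finset.mem_union_left _ (Finset.mem_erase.mpr ⟨hwx, hw⟩)
    · exact ⟨x, y, by simp [hx], by simp [hy], hxy, hx',
        fun w hw => hy' w (by rwa [Finset.union_comm])⟩
  have hsum := ZMod.sum_gap_le (X ∪ Y) (fun z => if z ∈ ({z₁, z₂} : Finset (ZMod c)) then p else q)
    ?_ ?_
  · rw [Finset.sum_ite] at hsum
    have hsub : ({z₁, z₂} : Finset (ZMod c)) ⊆ X ∪ Y := by
      intro z; simp only [Finset.mem_insert, Finset.mem_singleton]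
      rintro (rfl | rfl) <;> assumption
    have e1 : (X ∪ Y).filter (· ∈ ({z₁, z₂} : Finset (ZMod c))) = {z₁, z₂} := by
      rw [Finset.filter_mem_eq_inter, Finset.inter_eq_right.mpr hsub]
    have e2 : (X ∪ Y).filter (· ∉ ({z₁, z₂} : Finset (ZMod c))) = (X ∪ Y) \ {z₁, z₂} := by
      rw [Finset.filter_notMem_eq_sdiff]
    rw [e1, e2, Finset.sum_const, Finset.sum_const, Finset.card_sdiff_of_subset hsub,
      Finset.card_pair hne] at hsum
    simpa using hsum
  · intro z hz
    have : 2 ≤ (X ∪ Y).card := hX.trans (Finset.card_le_card Finset.subset_union_left)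
    obtain ⟨z', hz', hn⟩ := Finset.exists_mem_ne (show 1 < (X ∪ Y).card by omega) z
    have hlt := ZMod.val_lt (z' - z)
    have hq := h z hz z' hz' hn.symm
    have hp1 := fun e : z₁ = z => h₁ z' hz' (by rw [e]; exact hn.symm)
    have hp2 := fun e : z₂ = z => h₂ z' hz' (by rw [e]; exact hn.symm)
    split_ifs with hi
    · simp only [Finset.mem_insert, Finset.mem_singleton] at hi
      rcases hi with rfl | rfl
      · exact (hp1 rfl).trans hlt.le
      · exact (hp2 rfl).trans hlt.le
    · omega
  · intro z hz z' hz' hn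
    split_ifs with hi
    · simp only [Finset.mem_insert, Finset.mem_singleton] at hi
      rcases hi with rfl | rfl
      · exact h₁ z' hz' hn
      · exact h₂ z' hz' hn
    · exact h z hz z' hz' hn

/-- The list `l` is a path inside `D` whose head is adjacent to `a` and whose last vertex is
adjacent to `b`. -/
def Through {V : Type*} (H : SimpleGraph V) (D : Finset V) (a b : V) (l : List V) : Prop :=
  (a :: (l ++ [b])).IsChain H.Adj ∧ l.Nodup ∧ ∀ x ∈ l, x ∈ D

theorem Through.reverse {V : Type*} {H : SimpleGraph V} {D : Finset V} {a b : V} {l : List V}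
    (h : Through H D a b l) : Through H D b a l.reverse := by
  refine ⟨?_, by simpa using h.2.1, by simpa using h.2.2⟩
  have : b :: (l.reverse ++ [a]) = (a :: (l ++ [b])).reverse := by simp
  rw [this, List.isChain_reverse]
  exact h.1.imp fun _ _ e => e.symm

theorem through_cons_append_iff {V : Type*} {H : SimpleGraph V} {D : Finset V} {a b x : V}
    {s r : List V} : Through H D a b (s ++ x :: r) ↔
      ((a :: s) ++ [x]).IsChain H.Adj ∧ (x :: (r ++ [b])).IsChain H.Adj ∧ (s ++ x :: r).Nodup ∧
        ∀ y ∈ s ++ x :: r, y ∈ D := by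
  have : a :: (s ++ x :: r ++ [b]) = (a :: s) ++ x :: (r ++ [b]) := by simp
  rw [Through, this, List.isChain_split, and_assoc]

/-- Contract the edge `u v` onto `u`, leaving `v` isolated. -/
def SimpleGraph.contractOnto {V : Type*} (H : SimpleGraph V) (u v : V) : SimpleGraph V where
  Adj x y := x ≠ y ∧ x ≠ v ∧ y ≠ v ∧ (H.Adj x y ∨ (x = u ∧ H.Adj v y) ∨ (y = u ∧ H.Adj x v))
  symm := ⟨by
    rintro x y ⟨h1, h2, h3, h4⟩
    refine ⟨h1.symm, h3, h2, ?_⟩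
    rcases h4 with h | ⟨h, h'⟩ | ⟨h, h'⟩
    · exact Or.inl h.symm
    · exact Or.inr (Or.inr ⟨h, h'.symm⟩)
    · exact Or.inr (Or.inl ⟨h, h'.symm⟩)⟩
  loopless := ⟨fun x h => h.1 rfl⟩

theorem SimpleGraph.contractOnto_adj {V : Type*} {H : SimpleGraph V} {u v x y : V} :
    (H.contractOnto u v).Adj x y ↔ x ≠ y ∧ x ≠ v ∧ y ≠ v ∧
      (H.Adj x y ∨ (x = u ∧ H.Adj v y) ∨ (y = u ∧ H.Adj x v)) := Iff.rfl

theorem Through.lift_contractOnto {V : Type*} {H : SimpleGraph V} [DecidableEq V] {D : Finset V}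
    {a b u v : V} {l : List V} (hu : u ∈ D) (hv : v ∈ D) (huv : H.Adj u v) (ha : a ∉ D)
    (hb : b ∉ D) (h : Through (H.contractOnto u v) (D.erase v) a b l) :
    ∃ l', Through H D a b l' ∧ l.length ≤ l'.length := by
  have hmono : ∀ s : List V, u ∉ s → s.IsChain (H.contractOnto u v).Adj → s.IsChain H.Adj := by
    intro s hs
    refine fun h => h.imp_of_mem_imp fun x y hx hy hxy => ?_
    rcases hxy.2.2.2 with h | ⟨rfl, -⟩ | ⟨rfl, -⟩
    · exact h
    · exact absurd hx hs
    · exact absurd hy hs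
  have hau : a ≠ u := fun e => ha (e ▸ hu)
  have hbu : b ≠ u := fun e => hb (e ▸ hu)
  by_cases hul : u ∈ l
  · obtain ⟨s, r, rfl⟩ := List.append_of_mem hul
    obtain ⟨h1, h2, hnd, hD⟩ := through_cons_append_iff.mp h
    have hvs : v ∉ s ∧ v ∉ r := by
      constructor <;> intro hh
      · exact Finset.notMem_erase v D (hD v (by simp [hh]))
      · exact Finset.notMem_erase v D (hD v (by simp [hh]))
    have hnd' := hnd
    rw [List.nodup_middle, List.nodup_cons, List.mem_append, not_or] at hnd'
    obtain ⟨p, hp⟩ : ∃ p, (a :: s).getLast? = some p :=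
      ⟨_, List.getLast?_eq_some_getLast (List.cons_ne_nil a s)⟩
    obtain ⟨q, hq⟩ : ∃ q, (r ++ [b]).head? = some q := by cases r <;> simp
    rw [List.isChain_append, hp] at h1
    rw [List.isChain_cons, hq] at h2
    have c1 := hmono (a :: s) (by simp [hau.symm, hnd'.1.1]) h1.1
    have c2 := hmono (r ++ [b]) (by simp [hbu.symm, hnd'.1.2]) h2.2
    have a1 : H.Adj p u ∨ H.Adj p v := by
      obtain ⟨hpu, -, -, h | ⟨rfl, h⟩ | ⟨-, h⟩⟩ := h1.2.2 p (by simp) u (by simp)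
      · exact Or.inl h
      · exact absurd rfl hpu
      · exact Or.inr h
    have a2 : H.Adj u q ∨ H.Adj v q := by
      obtain ⟨hpu, -, -, h | ⟨-, h⟩ | ⟨rfl, h⟩⟩ := h2.1 q (by simp)
      · exact Or.inl h
      · exact Or.inr h
      · exact absurd rfl hpu
    have build : ∀ M : List V, M.Nodup → (∀ x ∈ M, x = u ∨ x = v) → M.IsChain H.Adj → M ≠ [] →
        (∀ y ∈ M.head?, H.Adj p y) → (∀ y ∈ M.getLast?, H.Adj y q) →
        Through H D a b (s ++ (M ++ r)) := by
      intro M hM hMuv hMc hne hh hl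
      refine ⟨?_, ?_, ?_⟩
      · have : a :: (s ++ (M ++ r) ++ [b]) = (a :: s) ++ (M ++ (r ++ [b])) := by simp
        rw [this, List.isChain_append, List.isChain_append, hp, hq]
        refine ⟨c1, ⟨hMc, c2, ?_⟩, ?_⟩
        · intro x hx y hy
          simp only [Option.mem_def, Option.some.injEq] at hy
          exact hy ▸ hl x hx
        · intro x hx y hy
          simp only [Option.mem_def, Option.some.injEq] at hx
          rw [List.head?_append_of_ne_nil _ hne] at hy
          exact hx ▸ hh y hy
      · have h1 := hnd'.2
        rw [List.nodup_append] at h1 ⊢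
        refine ⟨h1.1, List.nodup_append.mpr ⟨hM, h1.2.1, ?_⟩, ?_⟩
        · rintro x hx y hy rfl
          rcases hMuv x hx with rfl | rfl
          · exact hnd'.1.2 hy
          · exact hvs.2 hy
        · rintro x hx y hy rfl
          rcases List.mem_append.mp hy with hy | hy
          · rcases hMuv x hy with rfl | rfl
            · exact hnd'.1.1 hx
            · exact hvs.1 hx
          · exact h1.2.2 x hx x hy rfl
      · intro x hx
        rcases List.mem_append.mp hx with hx | hx
        · exact Finset.mem_of_mem_erase (hD x (by simp [hx]))
        · rcases List.mem_append.mp hx with hx | hx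
          · rcases hMuv x hx with rfl | rfl <;> assumption
          · exact Finset.mem_of_mem_erase (hD x (by simp [hx]))
    have huv' := huv.ne
    rcases a1 with a1 | a1 <;> rcases a2 with a2 | a2
    · exact ⟨_, build [u] (by simp) (by simp) (by simp) (by simp) (by simpa using a1)
        (by simpa using a2), by simp⟩
    · exact ⟨_, build [u, v] (by simp [huv']) (by simp) (by simp [huv]) (by simp)
        (by simpa using a1) (by simpa using a2), by simp⟩
    · exact ⟨_, build [v, u] (by simp [huv'.symm]) (by simp) (by simp [huv.symm]) (by simp)
        (by simpa using a1) (by simpa using a2), by simp⟩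
    · exact ⟨_, build [v] (by simp) (by simp) (by simp) (by simp) (by simpa using a1)
        (by simpa using a2), by simp⟩
  · exact ⟨l, ⟨hmono _ (by simp [hul, hau.symm, hbu.symm]) h.1, h.2.1,
      fun x hx => Finset.mem_of_mem_erase (h.2.2 x hx)⟩, le_rfl⟩

/-- The positions on the cycle `γ` that are adjacent to `x`. -/
noncomputable def feet {V : Type*} {c : ℕ} [NeZero c] (H : SimpleGraph V) (γ : ZMod c → V)
    (x : V) : Finset (ZMod c) :=
  open Classical in Finset.univ.filter fun i => H.Adj x (γ i)

theorem mem_feet {V : Type*} {c : ℕ} [NeZero c] {H : SimpleGraph V} {γ : ZMod c → V} {x : V}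
    {i : ZMod c} : i ∈ feet H γ x ↔ H.Adj x (γ i) := by
  simp [feet]

/-- `D` induces a connected piece hanging off the cycle `γ`, such that no detour through `D` is
longer than the arc it bypasses, and such that `D` cannot be separated from `γ` by one vertex. -/
structure Hangs {V : Type*} {c : ℕ} [NeZero c] (H : SimpleGraph V) (γ : ZMod c → V)
    (D : Finset V) : Prop where
  notMem : ∀ i, γ i ∉ D
  detour : ∀ i j l, i ≠ j → l ≠ [] → Through H D (γ i) (γ j) l → l.length + 1 ≤ (j - i).val
  conn : ∀ K ⊆ D, K.Nonempty → (∀ x ∈ K, ∀ y ∈ D, H.Adj x y → y ∈ K) → K = D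
  two : ∀ K ⊆ D, K.Nonempty → (∀ x ∈ K, feet H γ x = ∅) → ∀ w ∈ D, w ∉ K →
    ∃ x ∈ K, ∃ y ∈ D, y ∉ K ∧ y ≠ w ∧ H.Adj x y
  feet_ne : ∀ w, ∃ x ∈ D, ∃ i ∈ feet H γ x, i ≠ w

theorem feet_contractOnto_of_ne {V : Type*} {c : ℕ} [NeZero c] {H : SimpleGraph V}
    {γ : ZMod c → V} {u v x : V} (hu : ∀ i, γ i ≠ u) (hv : ∀ i, γ i ≠ v)
    (hxγ : ∀ i, γ i ≠ x) (hxu : x ≠ u) (hxv : x ≠ v) :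
    feet (H.contractOnto u v) γ x = feet H γ x := by
  ext i
  simp [mem_feet, contractOnto_adj, hxu, hxv, hu i, hv i, (hxγ i).symm]

theorem feet_contractOnto_self {V : Type*} {c : ℕ} [NeZero c] [DecidableEq V] {H : SimpleGraph V}
    {γ : ZMod c → V} {u v : V} (hu : ∀ i, γ i ≠ u) (hv : ∀ i, γ i ≠ v) (huv : u ≠ v) :
    feet (H.contractOnto u v) γ u = feet H γ u ∪ feet H γ v := by
  ext i
  simp [mem_feet, contractOnto_adj, huv, hu i, hv i, (hu i).symm]

/-- Contracting an edge keeps a piece hanging unless some part of it is attached to the rest only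
through the two ends of that edge. -/
theorem Hangs.contractOnto {V : Type*} {c : ℕ} [NeZero c] [DecidableEq V] {H : SimpleGraph V}
    {γ : ZMod c → V} {D : Finset V} (h : Hangs H γ D) {u v : V} (hu : u ∈ D) (hv : v ∈ D)
    (huv : H.Adj u v)
    (hK : ∀ K ⊆ (D.erase u).erase v, K.Nonempty → (∀ x ∈ K, feet H γ x = ∅) →
      ∃ x ∈ K, ∃ y ∈ D, y ∉ K ∧ y ≠ u ∧ y ≠ v ∧ H.Adj x y) :
    Hangs (H.contractOnto u v) γ (D.erase v) := by
  have hγ : ∀ x ∈ D, ∀ i, γ i ≠ x := fun x hx i e => h.notMem i (e ▸ hx)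
  have hne := huv.ne
  have fself := feet_contractOnto_self (H := H) (hγ u hu) (hγ v hv) hne
  have fne : ∀ x ∈ D, x ≠ u → x ≠ v → feet (H.contractOnto u v) γ x = feet H γ x :=
    fun x hx => feet_contractOnto_of_ne (hγ u hu) (hγ v hv) (hγ x hx)
  refine ⟨fun i hi => h.notMem i (Finset.mem_of_mem_erase hi), ?_, ?_, ?_, ?_⟩
  · intro i j l hij hl hT
    obtain ⟨l', hT', hle⟩ := hT.lift_contractOnto hu hv huv (h.notMem i) (h.notMem j)
    have : l' ≠ [] := by
      rintro rfl
      exact hl (List.length_eq_zero_iff.mp (by simpa using hle))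
    have := h.detour i j l' hij this hT'
    omega
  · intro K hKD hKn hcl
    by_cases huK : u ∈ K
    · have := h.conn (insert v K) (by
        intro x hx
        rcases Finset.mem_insert.mp hx with rfl | hx
        · exact hv
        · exact Finset.mem_of_mem_erase (hKD hx)) (by simp) (by
        intro x hx y hy hxy
        by_cases hyv : y = v
        · simp [hyv]
        by_cases hyu : y = u
        · simp [hyu, huK]
        refine Finset.mem_insert_of_mem ?_
        rcases Finset.mem_insert.mp hx with rfl | hx
        · exact hcl u huK y (by simp [hyv, hy])
            ⟨fun e => hyu e.symm, hne, hyv, Or.inr (Or.inl ⟨rfl, hxy⟩)⟩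
        · exact hcl x hx y (by simp [hyv, hy])
            ⟨hxy.ne, Finset.ne_of_mem_erase (hKD hx), hyv, Or.inl hxy⟩)
      rw [← this, Finset.erase_insert (fun hvK => Finset.notMem_erase v D (hKD hvK))]
    · have hcl' : ∀ x ∈ K, ∀ y ∈ D, H.Adj x y → y ∈ K := by
        intro x hx y hy hxy
        have hxv := Finset.ne_of_mem_erase (hKD hx)
        have hxu : x ≠ u := fun e => huK (e ▸ hx)
        by_cases hyv : y = v
        · exact absurd (hcl x hx u (by simp [hne, hu])
            ⟨hxu, hxv, hne, Or.inr (Or.inr ⟨rfl, hyv ▸ hxy⟩)⟩) huK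
        · exact hcl x hx y (by simp [hyv, hy]) ⟨hxy.ne, hxv, hyv, Or.inl hxy⟩
      have := h.conn K (fun x hx => Finset.mem_of_mem_erase (hKD hx)) hKn hcl'
      exact absurd (this ▸ hu) huK
  · intro K hKD hKn hf w hw hwK
    have hKD' : K ⊆ D := fun x hx => Finset.mem_of_mem_erase (hKD hx)
    have hwv := Finset.ne_of_mem_erase hw
    by_cases huK : u ∈ K
    · have hfu := hf u huK
      rw [fself, Finset.union_eq_empty] at hfu
      obtain ⟨x, hx, y, hy, hyK, hyw, hxy⟩ := h.two (insert v K)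
        (Finset.insert_subset hv hKD') (by simp) (by
          intro x hx
          rcases Finset.mem_insert.mp hx with rfl | hx
          · exact hfu.2
          · by_cases hxu : x = u
            · exact hxu ▸ hfu.1
            · rw [← fne x (hKD' hx) hxu (Finset.ne_of_mem_erase (hKD hx))]
              exact hf x hx) w (Finset.mem_of_mem_erase hw) (by simp [hwv, hwK])
      rw [Finset.mem_insert, not_or] at hyK
      have hyu : y ≠ u := fun e => hyK.2 (e ▸ huK)
      rcases Finset.mem_insert.mp hx with rfl | hx
      · exact ⟨u, huK, y, by simp [hyK.1, hy], hyK.2, hyw, hyu.symm, hne, hyK.1,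
          Or.inr (Or.inl ⟨rfl, hxy⟩)⟩
      · exact ⟨x, hx, y, by simp [hyK.1, hy], hyK.2, hyw, hxy.ne, Finset.ne_of_mem_erase (hKD hx),
          hyK.1, Or.inl hxy⟩
    · have hf' : ∀ x ∈ K, feet H γ x = ∅ := by
        intro x hx
        rw [← fne x (hKD' hx) (fun e => huK (e ▸ hx)) (Finset.ne_of_mem_erase (hKD hx))]
        exact hf x hx
      by_cases hwu : w = u
      · obtain ⟨x, hx, y, hy, hyK, hyu, hyv, hxy⟩ := hK K (by
          intro x hx
          simp only [Finset.mem_erase]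
          exact ⟨Finset.ne_of_mem_erase (hKD hx), fun e => huK (e ▸ hx), hKD' hx⟩) hKn hf'
        exact ⟨x, hx, y, by simp [hyv, hy], hyK, hwu ▸ hyu, hxy.ne, Finset.ne_of_mem_erase (hKD hx),
          hyv, Or.inl hxy⟩
      · obtain ⟨x, hx, y, hy, hyK, hyw, hxy⟩ := h.two K hKD' hKn hf' w
          (Finset.mem_of_mem_erase hw) hwK
        have hxv := Finset.ne_of_mem_erase (hKD hx)
        have hxu : x ≠ u := fun e => huK (e ▸ hx)
        by_cases hyv : y = v
        · exact ⟨x, hx, u, by simp [hne, hu], huK, fun e => hwu e.symm, hxu, hxv, hne,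
            Or.inr (Or.inr ⟨rfl, hyv ▸ hxy⟩)⟩
        · exact ⟨x, hx, y, by simp [hyv, hy], hyK, hyw, hxy.ne, hxv, hyv, Or.inl hxy⟩
  · intro w
    obtain ⟨x, hx, i, hi, hiw⟩ := h.feet_ne w
    by_cases hxv : x = v
    · exact ⟨u, by simp [hne, hu], i, by rw [fself]; simp [← hxv, hi], hiw⟩
    · by_cases hxu : x = u
      · exact ⟨u, by simp [hne, hu], i, by rw [fself]; simp [← hxu, hi], hiw⟩
      · exact ⟨x, by simp [hxv, hx], i, by rwa [fne x hx hxu hxv], hiw⟩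

/-- Twice the number of edges meeting `D`, where edges leaving `D` are counted towards `γ` only. -/
noncomputable def load {V : Type*} {c : ℕ} [NeZero c] (H : SimpleGraph V) (γ : ZMod c → V)
    (D : Finset V) : ℕ :=
  open Classical in ∑ x ∈ D, ((D.filter (H.Adj x)).card + 2 * (feet H γ x).card)

open Classical in
theorem load_le_contractOnto {V : Type*} {c : ℕ} [NeZero c] [DecidableEq V] {H : SimpleGraph V}
    {γ : ZMod c → V} {D : Finset V} (h : Hangs H γ D) {u v : V} (hu : u ∈ D) (hv : v ∈ D)
    (huv : H.Adj u v) : load H γ D ≤ load (H.contractOnto u v) γ (D.erase v) + 2 +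
      2 * ((D.filter fun z => H.Adj u z ∧ H.Adj v z).card + (feet H γ u ∩ feet H γ v).card) := by
  have hγ : ∀ x ∈ D, ∀ i, γ i ≠ x := fun x hx i e => h.notMem i (e ▸ hx)
  have hne := huv.ne
  set E := (D.erase v).erase u with hE
  have huE : u ∈ D.erase v := by simp [hne, hu]
  have hEv : ∀ x ∈ E, x ≠ u ∧ x ≠ v ∧ x ∈ D := by
    intro x hx; simpa [hE] using hx
  have split : ∀ f : V → ℕ, ∑ x ∈ D, f x = ∑ x ∈ E, f x + f u + f v := by
    intro f
    rw [← Finset.sum_erase_add D f hv, ← Finset.sum_erase_add (D.erase v) f huE]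
  have split' : ∀ f : V → ℕ, ∑ x ∈ D.erase v, f x = ∑ x ∈ E, f x + f u := by
    intro f
    rw [← Finset.sum_erase_add (D.erase v) f huE]
  have hfu : (feet H γ u).card + (feet H γ v).card =
      (feet (H.contractOnto u v) γ u).card + (feet H γ u ∩ feet H γ v).card := by
    rw [feet_contractOnto_self (hγ u hu) (hγ v hv) hne, Finset.card_union_add_card_inter]
  have hcu : ∑ y ∈ E, ((if H.Adj u y then 1 else 0) + (if H.Adj v y then 1 else 0)) =
      ∑ y ∈ E, ((if (H.contractOnto u v).Adj u y then 1 else 0) +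
        (if H.Adj u y ∧ H.Adj v y then 1 else 0)) := by
    refine Finset.sum_congr rfl fun y hy => ?_
    obtain ⟨h1, h2, -⟩ := hEv y hy
    have : (H.contractOnto u v).Adj u y ↔ H.Adj u y ∨ H.Adj v y := by
      simp [contractOnto_adj, h1.symm, hne, h2, h1]
    simp only [this]
    by_cases a : H.Adj u y <;> by_cases b : H.Adj v y <;> simp [a, b]
  have hcE : ∑ x ∈ E, ∑ y ∈ E, (if (H.contractOnto u v).Adj x y then 1 else 0) =
      ∑ x ∈ E, ∑ y ∈ E, (if H.Adj x y then 1 else 0) := by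
    refine Finset.sum_congr rfl fun x hx => Finset.sum_congr rfl fun y hy => ?_
    obtain ⟨h1, h2, -⟩ := hEv y hy
    obtain ⟨h3, h4, -⟩ := hEv x hx
    have : (H.contractOnto u v).Adj x y ↔ H.Adj x y := by
      simp only [contractOnto_adj, ne_eq, h1, h2, h3, h4, false_and, or_false, not_false_eq_true,
        true_and, and_iff_right_iff_imp]
      exact fun e => e.ne
    simp only [this]
  have hfE : ∑ x ∈ E, 2 * (feet (H.contractOnto u v) γ x).card =
      ∑ x ∈ E, 2 * (feet H γ x).card := by
    refine Finset.sum_congr rfl fun x hx => ?_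
    obtain ⟨h1, h2, h3⟩ := hEv x hx
    rw [feet_contractOnto_of_ne (hγ u hu) (hγ v hv) (hγ x h3) h1 h2]
  have hcom : ∑ y ∈ E, (if H.Adj u y ∧ H.Adj v y then 1 else 0) ≤
      (D.filter fun z => H.Adj u z ∧ H.Adj v z).card := by
    rw [Finset.card_filter, split]
    omega
  have hsu : ∀ (K : SimpleGraph V) (z : V),
      ∑ x ∈ E, (if K.Adj x z then 1 else 0) = ∑ x ∈ E, (if K.Adj z x then 1 else 0) := by
    intro K z
    refine Finset.sum_congr rfl fun x _ => ?_
    simp only [K.adj_comm x z]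
  simp only [load, Finset.card_filter]
  simp only [split, split', Finset.sum_add_distrib, hsu]
  simp only [Finset.sum_add_distrib] at hcu
  simp only [SimpleGraph.irrefl, huv, huv.symm, if_true, if_false, false_and, and_false]
  omega

theorem Through.change_ends {V : Type*} {H : SimpleGraph V} {D : Finset V} {a b a' b' h e : V}
    {l : List V} (hl : Through H D a b l) (hh : l.head? = some h) (he : l.getLast? = some e)
    (ha : H.Adj h a') (hb : H.Adj e b') : Through H D a' b' l := by
  refine ⟨?_, hl.2⟩
  have h1 := hl.1
  rw [List.isChain_cons, List.isChain_append] at h1 ⊢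
  refine ⟨?_, h1.2.1, by simp, ?_⟩
  · intro y hy
    rw [List.head?_append_of_ne_nil _ (by rintro rfl; simp at hh), hh] at hy
    simp only [Option.mem_def, Option.some.injEq] at hy
    exact hy ▸ ha.symm
  · intro x hx y hy
    rw [he] at hx
    simp only [Option.mem_def, Option.some.injEq, List.head?_cons] at hx hy
    exact hx ▸ hy ▸ hb

theorem Through.of_isChain {V : Type*} {H : SimpleGraph V} {D : Finset V} {a b h e : V}
    {l : List V} (hc : l.IsChain H.Adj) (hn : l.Nodup) (hD : ∀ x ∈ l, x ∈ D)
    (hh : l.head? = some h) (he : l.getLast? = some e)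
    (ha : H.Adj h a) (hb : H.Adj e b) : Through H D a b l := by
  refine ⟨?_, hn, hD⟩
  rw [List.isChain_cons, List.isChain_append]
  refine ⟨?_, hc, by simp, ?_⟩
  · intro y hy
    rw [List.head?_append_of_ne_nil _ (by rintro rfl; simp at hh), hh] at hy
    simp only [Option.mem_def, Option.some.injEq] at hy
    exact hy ▸ ha.symm
  · intro x hx y hy
    rw [he] at hx
    simp only [Option.mem_def, Option.some.injEq, List.head?_cons] at hx hy
    exact hx ▸ hy ▸ hb

theorem Through.isChain {V : Type*} {H : SimpleGraph V} {D : Finset V} {a b : V}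
    {l : List V} (hl : Through H D a b l) : l.IsChain H.Adj :=
  (List.isChain_cons.mp hl.1).2.left_of_append

/-- The part of `K` reachable from `x` inside `K`. -/
theorem SimpleGraph.exists_reachable_part {V : Type*} (H : SimpleGraph V) {K : Finset V} {x : V}
    (hx : x ∈ K) : ∃ K₀ ⊆ K, x ∈ K₀ ∧ (∀ a ∈ K₀, ∀ b ∈ K, H.Adj a b → b ∈ K₀) ∧
      ∀ z ∈ K₀, ∃ q : List V, q.IsChain H.Adj ∧ q.Nodup ∧ (∀ y ∈ q, y ∈ K) ∧
        q.head? = some x ∧ q.getLast? = some z := by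
  classical
  refine ⟨K.filter fun z => ∃ p : H.Walk x z, ∀ y ∈ p.support, y ∈ K, Finset.filter_subset _ _,
    by simpa [hx] using ⟨Walk.nil, by simpa using hx⟩, ?_, ?_⟩
  · intro a ha b hb hab
    simp only [Finset.mem_filter] at ha ⊢
    obtain ⟨-, p, hp⟩ := ha
    refine ⟨hb, p.concat hab, fun y hy => ?_⟩
    rw [Walk.support_concat, List.mem_append] at hy
    rcases hy with hy | hy
    · exact hp y hy
    · simp only [List.mem_singleton] at hy
      exact hy ▸ hb
  · intro z hz
    obtain ⟨-, p, hp⟩ := Finset.mem_filter.mp hz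
    refine ⟨p.bypass.support, p.bypass.isChain_adj_support, p.bypass_isPath.support_nodup,
      fun y hy => hp y (p.support_bypass_subset_support hy), ?_, ?_⟩
    · rw [List.head?_eq_some_head p.bypass.support_ne_nil, Walk.head_support]
    · rw [List.getLast?_eq_some_getLast p.bypass.support_ne_nil, Walk.getLast_support]

/-- A longest path through `D` between two distinct positions of the cycle. -/
structure IsLongestDetour {V : Type*} {c : ℕ} (H : SimpleGraph V) (γ : ZMod c → V)
    (D : Finset V) (i j : ZMod c) (l : List V) : Prop where
  ne : i ≠ j
  through : Through H D (γ i) (γ j) l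
  le : ∀ i' j' l', i' ≠ j' → Through H D (γ i') (γ j') l' → l'.length ≤ l.length

theorem IsLongestDetour.reverse {V : Type*} {c : ℕ} {H : SimpleGraph V} {γ : ZMod c → V}
    {D : Finset V} {i j : ZMod c} {l : List V} (h : IsLongestDetour H γ D i j l) :
    IsLongestDetour H γ D j i l.reverse :=
  ⟨h.ne.symm, h.through.reverse, by simpa using h.le⟩

theorem IsLongestDetour.of_length {V : Type*} {c : ℕ} {H : SimpleGraph V} {γ : ZMod c → V}
    {D : Finset V} {i j i' j' : ZMod c} {l l' : List V} (h : IsLongestDetour H γ D i j l)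
    (hne : i' ≠ j') (hT : Through H D (γ i') (γ j') l') (hl : l.length ≤ l'.length) :
    IsLongestDetour H γ D i' j' l' :=
  ⟨hne, hT, fun a b k hab hk => (h.le a b k hab hk).trans hl⟩

theorem Hangs.exists_isLongestDetour {V : Type*} {c : ℕ} [NeZero c] {H : SimpleGraph V}
    {γ : ZMod c → V} {D : Finset V} (h : Hangs H γ D) (hD : 2 ≤ D.card) :
    ∃ i j l, IsLongestDetour H γ D i j l ∧ 2 ≤ l.length := by
  classical
  obtain ⟨x, y, i, j, hx, hy, hxy, hi, hj, hij⟩ : ∃ x y i j, x ∈ D ∧ y ∈ D ∧ x ≠ y ∧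
      i ∈ feet H γ x ∧ j ∈ feet H γ y ∧ i ≠ j := by
    obtain ⟨x, hx, i, hi, -⟩ := h.feet_ne 0
    obtain ⟨y, hy, j, hj, hji⟩ := h.feet_ne i
    by_cases hxy : x = y
    · subst hxy
      obtain ⟨z, hz, hzf⟩ : ∃ z ∈ D.erase x, feet H γ z ≠ ∅ := by
        by_contra! hcon
        obtain ⟨w, hw, hwx⟩ := Finset.exists_mem_ne (show 1 < D.card by omega) x
        obtain ⟨p, hp, q, hq, hq', hqx, -⟩ := h.two (D.erase x) (Finset.erase_subset _ _)
          ⟨w, by simp [hw, hwx]⟩ hcon x hx (by simp)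
        exact hq' (by simp [hq, hqx])
      obtain ⟨k, hk⟩ := Finset.nonempty_iff_ne_empty.mpr hzf
      have hz' := Finset.mem_erase.mp hz
      by_cases hki : k = i
      · exact ⟨x, z, j, k, hx, hz'.2, hz'.1.symm, hj, hk, hki ▸ hji⟩
      · exact ⟨x, z, i, k, hx, hz'.2, hz'.1.symm, hi, hk, fun e => hki e.symm⟩
    · exact ⟨x, y, i, j, hx, hy, hxy, hi, hj, hji.symm⟩
  obtain ⟨K, hKD, hxK, hcl, hpath⟩ := H.exists_reachable_part hx
  have hK := h.conn K hKD ⟨x, hxK⟩ hcl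
  obtain ⟨q, hqc, hqn, hqD, hqh, hql⟩ := hpath y (hK ▸ hy)
  have hT : Through H D (γ i) (γ j) q :=
    Through.of_isChain hqc hqn hqD hqh hql (mem_feet.mp hi) (mem_feet.mp hj)
  have hq2 : 2 ≤ q.length := by
    match q, hqh, hql with
    | [a], hqh, hql => simp at hqh hql; exact absurd (hqh.symm.trans hql) hxy
    | a :: b :: r, _, _ => simp
  let P : ℕ → Prop := fun m => ∃ i j l, i ≠ j ∧ Through H D (γ i) (γ j) l ∧ l.length = m
  have hb : ∀ m, P m → m ≤ D.card := by
    rintro m ⟨a, b, l, -, hl, rfl⟩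
    rw [← List.toFinset_card_of_nodup hl.2.1]
    exact Finset.card_le_card fun z hz => hl.2.2 z (by simpa using hz)
  have hPq : P q.length := ⟨i, j, q, hij, hT, rfl⟩
  obtain ⟨a, b, l, hab, hl, hlen⟩ := Nat.findGreatest_spec (hb _ hPq) hPq
  refine ⟨a, b, l, ⟨hab, hl, fun i' j' l' hne hl' => ?_⟩, ?_⟩
  · have hP' : P l'.length := ⟨i', j', l', hne, hl', rfl⟩
    rw [hlen]
    exact Nat.le_findGreatest (hb _ hP') hP'
  · rw [hlen]
    exact hq2.trans (Nat.le_findGreatest (hb _ hPq) hPq)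

theorem List.IsChain.disjoint_of_avoid {V : Type*} {H : SimpleGraph V} {K : Finset V} {a : V}
    {s : List V} (hc : (a :: s).IsChain H.Adj) (ha : ∀ x ∈ K, ¬H.Adj a x)
    (hs : ∀ y ∈ s, y ∉ K → ∀ x ∈ K, ¬H.Adj y x) : ∀ y ∈ s, y ∉ K := by
  induction s generalizing a with
  | nil => simp
  | cons b s ih =>
    rw [List.isChain_cons_cons] at hc
    have hb : b ∉ K := fun hb => ha b hb hc.1
    intro y hy
    rcases List.mem_cons.mp hy with rfl | hy
    · exact hb
    · exact ih hc.2 (hs b (by simp) hb) (fun y hy => hs y (by simp [hy])) y hy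

theorem IsLongestDetour.exists_adj_outside {V : Type*} {c : ℕ} [NeZero c] [DecidableEq V]
    {H : SimpleGraph V} {γ : ZMod c → V} {D : Finset V} (h : Hangs H γ D) {i j : ZMod c}
    {s r : List V} {u v : V} (hl : IsLongestDetour H γ D i j (s ++ u :: v :: r))
    {K : Finset V} (hK : K ⊆ (D.erase u).erase v) (hKn : K.Nonempty)
    (hf : ∀ x ∈ K, feet H γ x = ∅) : ∃ x ∈ K, ∃ y ∈ D, y ∉ K ∧ y ≠ u ∧ y ≠ v ∧ H.Adj x y := by
  by_contra! hcon
  have hKD : K ⊆ D := fun x hx => Finset.mem_of_mem_erase (Finset.mem_of_mem_erase (hK hx))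
  have huK : u ∉ K := fun hx => by simpa using hK hx
  have hvK : v ∉ K := fun hx => by simpa using hK hx
  have huD : u ∈ D := hl.through.2.2 u (by simp)
  have hvD : v ∈ D := hl.through.2.2 v (by simp)
  obtain ⟨x, hx, y, hy, hyK, hyu, hxy⟩ := h.two K hKD hKn hf u huD huK
  have hyv : y = v := by
    by_contra hne
    exact hcon x hx y hy hyK hyu hne hxy
  subst hyv
  obtain ⟨K₀, hK₀, hx₀, hcl, hpath⟩ := H.exists_reachable_part hx
  obtain ⟨x', hx', z, hz, hzK, hzy, hxz⟩ := h.two K₀ (hK₀.trans hKD) ⟨x, hx₀⟩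
    (fun a ha => hf a (hK₀ ha)) y hvD (fun e => hvK (hK₀ e))
  have hzK' : z ∉ K := fun e => hzK (hcl x' hx' z e hxz)
  have hzu : z = u := by
    by_contra hne
    exact hcon x' (hK₀ hx') z hz hzK' hne hzy hxz
  subst hzu
  obtain ⟨q, hqc, hqn, hqK, hqh, hql⟩ := hpath x' hx'
  obtain ⟨h1, h2, hnd, hD⟩ := through_cons_append_iff.mp hl.through
  have hγK : ∀ k, ∀ x ∈ K, ¬H.Adj (γ k) x := by
    intro k x hx hadj
    have := hf x hx
    have h' : k ∈ feet H γ x := mem_feet.mpr hadj.symm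
    simp [this] at h'
  have hnd' := hnd
  simp only [List.nodup_append, List.nodup_cons, List.mem_cons, not_or] at hnd'
  have hav : ∀ w ∈ D, w ≠ z → w ≠ y → w ∉ K → ∀ x ∈ K, ¬H.Adj w x := fun w hw hwz hwy hwK x hx e =>
    hcon x hx w hw hwK hwz hwy e.symm
  have hs : ∀ w ∈ s, w ∉ K := by
    refine List.IsChain.disjoint_of_avoid h1.left_of_append (hγK i) fun w hw => ?_
    exact hav w (hD w (by simp [hw])) (hnd'.2.2 w hw z (by simp)) (hnd'.2.2 w hw y (by simp))
  have hr : ∀ w ∈ r, w ∉ K := by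
    have hc' : (γ j :: r.reverse).IsChain H.Adj := by
      have e : γ j :: r.reverse = (r ++ [γ j]).reverse := by simp
      rw [e, List.isChain_reverse]
      have : (r ++ [γ j]).IsChain H.Adj := by
        rw [List.cons_append, List.isChain_cons_cons] at h2
        exact h2.2.tail
      exact this.imp fun _ _ e => e.symm
    have := List.IsChain.disjoint_of_avoid hc' (hγK j) fun w hw => ?_
    · intro w hw
      exact this w (by simpa using hw)
    · rw [List.mem_reverse] at hw
      exact hav w (hD w (by simp [hw])) (fun e => hnd'.2.1.1.2 (e ▸ hw))
        (fun e => hnd'.2.1.2.1 (e ▸ hw))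
  have hqne : q ≠ [] := by rintro rfl; simp at hqh
  have hT : Through H D (γ i) (γ j) (s ++ z :: (q.reverse ++ y :: r)) := by
    rw [through_cons_append_iff]
    refine ⟨h1, ?_, ?_, ?_⟩
    · have e : z :: (q.reverse ++ y :: r ++ [γ j]) = z :: (q.reverse ++ (y :: r ++ [γ j])) := by
        simp
      rw [e, List.isChain_cons, List.isChain_append]
      refine ⟨?_, ?_, ?_, ?_⟩
      · intro w hw
        rw [List.head?_append_of_ne_nil _ (by simpa using hqne), List.head?_reverse, hql] at hw
        simp only [Option.mem_def, Option.some.injEq] at hw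
        exact hw ▸ hxz.symm
      · rw [List.isChain_reverse]
        exact hqc.imp fun _ _ e => e.symm
      · exact h2.tail
      · intro a ha b hb
        rw [List.getLast?_reverse, hqh] at ha
        simp only [Option.mem_def, Option.some.injEq, List.cons_append, List.head?_cons] at ha hb
        exact ha ▸ hb ▸ hxy
    · simp only [List.nodup_append, List.nodup_cons, List.mem_cons, List.mem_append, not_or,
        List.mem_reverse, List.nodup_reverse]
      refine ⟨hnd'.1, ⟨⟨fun e => huK (hqK z e), hnd'.2.1.1⟩, hqn, hnd'.2.1.2, ?_⟩, ?_⟩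
      · rintro a ha b (rfl | hb) rfl
        · exact hvK (hqK a ha)
        · exact hr a hb (hqK a ha)
      · rintro a ha b (rfl | hb | rfl | hb) rfl
        · exact hnd'.2.2 a ha a (by simp) rfl
        · exact hs a ha (hqK a hb)
        · exact hnd'.2.2 a ha a (by simp) rfl
        · exact hnd'.2.2 a ha a (by simp [hb]) rfl
    · intro w hw
      simp only [List.mem_append, List.mem_cons, List.mem_reverse] at hw
      rcases hw with hw | rfl | hw | rfl | hw
      · exact hD w (by simp [hw])
      · exact huD
      · exact hKD (hqK w hw)
      · exact hvD
      · exact hD w (by simp [hw])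
  have := hl.le i j _ hl.ne hT
  have hq : 0 < q.length := List.length_pos_iff.mpr hqne
  simp only [List.length_append, List.length_cons, List.length_reverse] at this
  omega

theorem Through.gap {V : Type*} {c : ℕ} [NeZero c] {H : SimpleGraph V} {γ : ZMod c → V}
    {D : Finset V} (h : Hangs H γ D) {a b x y : V} {l : List V} (hl : Through H D a b l)
    (hx : l.head? = some x) (hy : l.getLast? = some y) {i j : ZMod c} (hi : i ∈ feet H γ x)
    (hj : j ∈ feet H γ y) (hij : i ≠ j) :
    l.length + 1 ≤ (j - i).val ∧ l.length + 1 ≤ (i - j).val := by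
  have hT := hl.change_ends hx hy (mem_feet.mp hi) (mem_feet.mp hj)
  have hn : l ≠ [] := by rintro rfl; simp at hx
  exact ⟨h.detour i j l hij hn hT,
    by simpa using h.detour j i l.reverse hij.symm (by simpa using hn) hT.reverse⟩

theorem Hangs.pair_gap {V : Type*} {c : ℕ} [NeZero c] {H : SimpleGraph V} {γ : ZMod c → V}
    {D : Finset V} (h : Hangs H γ D) {x y : V} (hx : x ∈ D) (hy : y ∈ D) (hxy : H.Adj x y)
    {i j : ZMod c} (hi : i ∈ feet H γ x) (hj : j ∈ feet H γ y) (hij : i ≠ j) :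
    3 ≤ (j - i).val := by
  refine h.detour i j [x, y] hij (by simp) (Through.of_isChain (by simpa using hxy)
    (by simpa using hxy.ne) (by simp [hx, hy]) rfl rfl (mem_feet.mp hi) (mem_feet.mp hj))

open Classical in
theorem IsLongestDetour.common_subset {V : Type*} {c : ℕ} {H : SimpleGraph V} {γ : ZMod c → V}
    {D : Finset V} {i j : ZMod c} {s r : List V} {u v : V}
    (hl : IsLongestDetour H γ D i j (s ++ u :: v :: r)) :
    (D.filter fun z => H.Adj u z ∧ H.Adj v z) ⊆
      (((s ++ u :: v :: r).toFinset).erase u).erase v := by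
  intro z hz
  obtain ⟨hzD, huz, hvz⟩ := Finset.mem_filter.mp hz
  simp only [Finset.mem_erase, List.mem_toFinset]
  refine ⟨hvz.ne.symm, huz.ne.symm, ?_⟩
  by_contra hzl
  obtain ⟨h1, h2, hnd, hD⟩ := through_cons_append_iff.mp hl.through
  have hT : Through H D (γ i) (γ j) (s ++ u :: z :: v :: r) := by
    rw [through_cons_append_iff]
    refine ⟨h1, ?_, ?_, ?_⟩
    · simp only [List.cons_append, List.isChain_cons_cons] at h2 ⊢
      exact ⟨huz, hvz.symm, h2.2⟩
    · have e : s ++ u :: z :: v :: r = (s ++ [u]) ++ z :: (v :: r) := by simp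
      rw [e, List.nodup_middle, List.nodup_cons]
      exact ⟨by simpa using hzl, by simpa using hnd⟩
    · intro y hy
      by_cases hyz : y = z
      · exact hyz ▸ hzD
      · exact hD y (by simpa [hyz] using hy)
  have := hl.le i j _ hl.ne hT
  simp at this

open Classical in
/-- The inequality that holds for consecutive vertices of a longest detour in a minimal
counterexample to the bound on the load. -/
def Tight {V : Type*} {c : ℕ} [NeZero c] (H : SimpleGraph V) (γ : ZMod c → V) (D : Finset V)
    (t : ℕ) : Prop :=
  ∀ i j s u v r, IsLongestDetour H γ D i j (s ++ u :: v :: r) →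
    t ≤ 1 + (D.filter fun z => H.Adj u z ∧ H.Adj v z).card + (feet H γ u ∩ feet H γ v).card

theorem IsLongestDetour.card_common_feet {V : Type*} {c : ℕ} [NeZero c] {H : SimpleGraph V}
    {γ : ZMod c → V} {D : Finset V} {t : ℕ} (hE : Tight H γ D t) {i j : ZMod c} {s r : List V}
    {u v : V} (hl : IsLongestDetour H γ D i j (s ++ u :: v :: r)) :
    t + 1 ≤ (s ++ u :: v :: r).length + (feet H γ u ∩ feet H γ v).card ∧
      ((s ++ u :: v :: r).length + (feet H γ u ∩ feet H γ v).card ≤ t + 1 →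
        ∀ y ∈ s ++ u :: v :: r, y ≠ u → y ≠ v → H.Adj u y ∧ H.Adj v y) := by
  classical
  have h1 := hE i j s u v r hl
  have h2 := hl.common_subset
  have hnd := hl.through.2.1
  have huv : u ≠ v := by
    rintro rfl
    simp [List.nodup_append] at hnd
  have hcard : ((((s ++ u :: v :: r).toFinset).erase u).erase v).card + 2 =
      (s ++ u :: v :: r).length := by
    have e1 := Finset.card_erase_add_one (s := ((s ++ u :: v :: r).toFinset).erase u) (a := v)
      (by simp [huv.symm])
    have e2 := Finset.card_erase_add_one (s := (s ++ u :: v :: r).toFinset) (a := u) (by simp)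
    rw [List.toFinset_card_of_nodup hnd] at e2
    omega
  have h3 := Finset.card_le_card h2
  refine ⟨?_, fun hle y hy hyu hyv => ?_⟩
  · omega
  · have := Finset.eq_of_subset_of_card_le h2 (by omega)
    have hy' : y ∈ D.filter fun z => H.Adj u z ∧ H.Adj v z := by
      rw [this]
      simp only [Finset.mem_erase, List.mem_toFinset]
      exact ⟨hyv, hyu, hy⟩
    exact (Finset.mem_filter.mp hy').2

theorem IsLongestDetour.head_spec {V : Type*} {c : ℕ} [NeZero c] {H : SimpleGraph V}
    {γ : ZMod c → V} {D : Finset V} {t : ℕ} (h : Hangs H γ D) (hc : c ≤ 2 * t + 1)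
    (hE : Tight H γ D t) {i j : ZMod c} {l : List V} {x y : V}
    (hl : IsLongestDetour H γ D i j l) (h2 : 2 ≤ l.length) (hx : l.head? = some x)
    (hy : l.getLast? = some y) :
    feet H γ x = feet H γ y ∧ (feet H γ x).card + l.length = t + 1 ∧ l.length + 1 ≤ t ∧
      ∀ z ∈ l, z ≠ x → H.Adj x z := by
  obtain ⟨x', r, rfl⟩ : ∃ x' r, l = x :: x' :: r := by
    match l, hx, h2 with
    | a :: b :: r, hx, _ => exact ⟨b, r, by simp at hx; rw [hx]⟩
  obtain ⟨s, y', hs⟩ : ∃ s y', x :: x' :: r = s ++ [y', y] := by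
    obtain ⟨s, y', hs⟩ : ∃ s y', x :: x' :: r = s ++ [y'] ++ [y] := by
      obtain ⟨q, hq⟩ := List.getLast?_eq_some_iff.mp hy
      have hqn : q ≠ [] := by rintro rfl; simp at hq
      exact ⟨q.dropLast, q.getLast hqn, by rw [List.dropLast_append_getLast, hq]⟩
    exact ⟨s, y', by simpa using hs⟩
  set l := x :: x' :: r with hldef
  have hmem : ∀ z ∈ l, z ∈ D := hl.through.2.2
  have hxD : x ∈ D := hmem x (by simp [hldef])
  have hxD' : x' ∈ D := hmem x' (by simp [hldef])
  have hyD : y ∈ D := hmem y (by simp [hs])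
  have hyD' : y' ∈ D := hmem y' (by simp [hs])
  have hch := hl.through.isChain
  have hxx' : H.Adj x x' := by
    rw [hldef, List.isChain_cons_cons] at hch
    exact hch.1
  have hyy' : H.Adj y' y := by
    rw [hs] at hch
    exact (List.isChain_pair.mp hch.right_of_append)
  have hlX := IsLongestDetour.card_common_feet (s := []) hE hl
  have hlY := hl
  rw [hs] at hlY
  have hlY := IsLongestDetour.card_common_feet (s := s) hE hlY
  rw [List.nil_append, ← hldef] at hlX
  rw [← hs] at hlY
  set X := feet H γ x ∩ feet H γ x' with hX
  set Y := feet H γ y' ∩ feet H γ y with hY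
  set m := l.length with hm
  have hgap : ∀ {a b}, a ∈ feet H γ x → b ∈ feet H γ y → a ≠ b →
      m + 1 ≤ (b - a).val ∧ m + 1 ≤ (a - b).val := fun ha hb hab =>
    hl.through.gap h hx hy ha hb hab
  have hmt : m + 1 ≤ t := by
    have ha : i ∈ feet H γ x := by
      have := hl.through.1
      rw [hldef, List.cons_append, List.isChain_cons_cons] at this
      exact mem_feet.mpr this.1.symm
    have hb : j ∈ feet H γ y := by
      have := hl.through.reverse.1
      rw [hs] at this
      simp only [List.reverse_append, List.reverse_cons, List.reverse_nil, List.nil_append,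
        List.cons_append, List.isChain_cons_cons] at this
      exact mem_feet.mpr this.1.symm
    have h1 := hgap ha hb hl.ne
    have h2 := ZMod.val_sub_add_val_sub hl.ne
    omega
  have hXc : 2 ≤ X.card := by omega
  have hYc : 2 ≤ Y.card := by omega
  have hq : ∀ z ∈ X ∪ Y, ∀ z' ∈ X ∪ Y, z ≠ z' → 3 ≤ (z' - z).val := by
    intro z hz z' hz' hne
    rcases Finset.mem_union.mp hz with hz | hz <;> rcases Finset.mem_union.mp hz' with hz' | hz' <;>
      obtain ⟨hz1, hz2⟩ := Finset.mem_inter.mp hz <;>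
      obtain ⟨hz1', hz2'⟩ := Finset.mem_inter.mp hz'
    · exact h.pair_gap hxD hxD' hxx' hz1 hz2' hne
    · have := (hgap hz1 hz2' hne).1
      omega
    · have := (hgap hz1' hz2 hne.symm).2
      omega
    · exact h.pair_gap hyD' hyD hyy' hz1 hz2' hne
  have hXY : X = Y := by
    by_contra hne
    have h1 := ZMod.two_mul_add_card_mul_le_of_gap (X := X) (Y := Y) (p := m + 1) hXc
      (Finset.card_pos.mp (by omega)) (fun a ha b hb hab =>
        hgap (Finset.mem_inter.mp ha).1 (Finset.mem_inter.mp hb).2 hab) hq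
    have h2 : t + 2 ≤ (X ∪ Y).card + m := by
      by_contra hlt
      have e1 : X = X ∪ Y := Finset.eq_of_subset_of_card_le Finset.subset_union_left (by omega)
      have e2 : Y = X ∪ Y := Finset.eq_of_subset_of_card_le Finset.subset_union_right (by omega)
      exact hne (e1.trans e2.symm)
    omega
  have hbound : ∀ Z : Finset (ZMod c), 2 ≤ Z.card →
      (∀ z ∈ Z, ∀ z' ∈ Z, z ≠ z' → m + 1 ≤ (z' - z).val) → Z.card + m ≤ t + 1 := by
    intro Z hZ hg
    have h1 := ZMod.card_mul_le_of_gap hZ hg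
    by_contra! hlt
    obtain ⟨a, ha⟩ := Nat.exists_eq_add_of_le (show 2 ≤ m from h2)
    obtain ⟨b, hb⟩ := Nat.exists_eq_add_of_le hmt
    have : (b + 3) * (m + 1) ≤ Z.card * (m + 1) := Nat.mul_le_mul_right _ (by omega)
    rw [hb, ha] at *
    nlinarith
  have hgX : ∀ z ∈ X, ∀ z' ∈ X, z ≠ z' → m + 1 ≤ (z' - z).val := fun z hz z' hz' hne =>
    (hgap (Finset.mem_inter.mp hz).1 (Finset.mem_inter.mp (hXY ▸ hz')).2 hne).1
  have hXm := hbound X hXc hgX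
  have hfx : feet H γ x = X := by
    refine Finset.Subset.antisymm (fun z hz => ?_) Finset.inter_subset_left
    by_contra hzX
    have := hbound (insert z X) (by rw [Finset.card_insert_of_notMem hzX]; omega) (by
      intro a ha b hb hab
      rcases Finset.mem_insert.mp ha with rfl | ha' <;>
        rcases Finset.mem_insert.mp hb with rfl | hb'
      · exact absurd rfl hab
      · exact (hgap hz (Finset.mem_inter.mp (hXY ▸ hb')).2 hab).1
      · exact (hgap hz (Finset.mem_inter.mp (hXY ▸ ha')).2 hab.symm).2
      · exact hgX a ha' b hb' hab)
    rw [Finset.card_insert_of_notMem hzX] at this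
    omega
  have hfy : feet H γ y = X := by
    refine Finset.Subset.antisymm (fun z hz => ?_) (hXY ▸ Finset.inter_subset_right)
    by_contra hzX
    have := hbound (insert z X) (by rw [Finset.card_insert_of_notMem hzX]; omega) (by
      intro a ha b hb hab
      rcases Finset.mem_insert.mp ha with rfl | ha' <;>
        rcases Finset.mem_insert.mp hb with rfl | hb'
      · exact absurd rfl hab
      · exact (hgap (Finset.mem_inter.mp hb').1 hz hab.symm).2
      · exact (hgap (Finset.mem_inter.mp ha').1 hz hab).1
      · exact hgX a ha' b hb' hab)
    rw [Finset.card_insert_of_notMem hzX] at this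
    omega
  refine ⟨hfx.trans hfy.symm, by rw [hfx]; omega, hmt, fun z hz hzx => ?_⟩
  by_cases hzx' : z = x'
  · exact hzx' ▸ hxx'
  · exact (hlX.2 (by omega) z hz hzx hzx').1

theorem IsLongestDetour.clique {V : Type*} {c : ℕ} [NeZero c] {H : SimpleGraph V}
    {γ : ZMod c → V} {D : Finset V} {t : ℕ} (h : Hangs H γ D) (hc : c ≤ 2 * t + 1)
    (hE : Tight H γ D t) {i j : ZMod c} {l : List V} {x : V}
    (hl : IsLongestDetour H γ D i j l) (h2 : 2 ≤ l.length) (hx : l.head? = some x) :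
    ∀ u ∈ l, feet H γ u = feet H γ x ∧ ∀ z ∈ l, z ≠ u → H.Adj u z := by
  obtain ⟨y, hy⟩ : ∃ y, l.getLast? = some y :=
    ⟨_, List.getLast?_eq_some_getLast (by rintro rfl; simp at h2)⟩
  obtain ⟨h3, h4, h5, h6⟩ := hl.head_spec h hc hE h2 hx hy
  intro u hu
  by_cases hux : u = x
  · exact ⟨by rw [hux], hux ▸ h6⟩
  by_cases huy : u = y
  · obtain ⟨h7, -, -, h8⟩ := hl.reverse.head_spec h hc hE (by simpa using h2)
      (by rwa [List.head?_reverse]) (by rwa [List.getLast?_reverse])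
    exact ⟨huy ▸ h7, fun z hz => huy ▸ h8 z (by simpa using hz)⟩
  obtain ⟨s, r, rfl⟩ := List.append_of_mem hu
  have hs : s ≠ [] := by
    rintro rfl
    simp at hx
    exact hux hx
  have hr : r ≠ [] := by
    rintro rfl
    simp at hy
    exact huy hy
  obtain ⟨s₁, p, hsp⟩ : ∃ s₁ p, s = s₁ ++ [p] :=
    ⟨_, _, (List.dropLast_append_getLast hs).symm⟩
  have hch := hl.through.isChain
  have hnd := hl.through.2.1
  rw [List.isChain_split] at hch
  have hpu : H.Adj p u := by
    have := hch.1
    rw [hsp, List.append_assoc] at this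
    exact List.isChain_pair.mp this.right_of_append
  rw [List.head?_append_of_ne_nil _ hs] at hx
  rw [List.getLast?_append_of_ne_nil _ (by simp), List.getLast?_cons_of_ne_nil hr] at hy
  have hfu : (feet H γ u).Nonempty := by
    have e : s ++ u :: r = s₁ ++ p :: u :: r := by simp [hsp]
    rw [e] at hl
    have := (IsLongestDetour.card_common_feet hE hl).1
    rw [← e] at this
    have : 0 < (feet H γ p ∩ feet H γ u).card := by omega
    exact (Finset.card_pos.mp this).mono Finset.inter_subset_right
  obtain ⟨a, ha⟩ := hfu
  obtain ⟨b, hb, hba⟩ := Finset.exists_mem_ne (show 1 < (feet H γ y).card by rw [← h3]; omega) a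
  have hrr : ∀ z ∈ r, H.Adj x z := by
    intro z hz
    refine h6 z (by simp [hz]) ?_
    rintro rfl
    simp only [List.nodup_append, List.nodup_cons, List.mem_cons] at hnd
    exact hnd.2.2 z (List.mem_of_mem_head? hx) z (by simp [hz]) rfl
  have hch' : (u :: (s.reverse ++ r)).IsChain H.Adj := by
    rw [List.isChain_cons, List.isChain_append]
    refine ⟨?_, ?_, ?_, ?_⟩
    · intro z hz
      rw [hsp] at hz
      simp at hz
      exact hz ▸ hpu.symm
    · rw [List.isChain_reverse]
      exact hch.1.left_of_append.imp fun _ _ e => e.symm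
    · exact hch.2.tail
    · intro z hz w hw
      rw [List.getLast?_reverse, hx] at hz
      simp only [Option.mem_def, Option.some.injEq] at hz
      exact hz ▸ hrr w (List.mem_of_mem_head? hw)
  have hperm : (u :: (s.reverse ++ r)).Perm (s ++ u :: r) :=
    ((List.Perm.append_right r (List.reverse_perm s)).cons u).trans List.perm_middle.symm
  have hl' : IsLongestDetour H γ D a b (u :: (s.reverse ++ r)) := by
    refine hl.of_length hba.symm (Through.of_isChain hch' (hperm.nodup_iff.mpr hnd)
      (fun z hz => hl.through.2.2 z (hperm.mem_iff.mp hz)) rfl ?_ (mem_feet.mp ha)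
      (mem_feet.mp hb)) hperm.length_eq.ge
    rw [List.getLast?_cons_of_ne_nil (by simp [hr]), List.getLast?_append_of_ne_nil _ hr, hy]
  obtain ⟨h7, -, -, h8⟩ := hl'.head_spec h hc hE (hperm.length_eq ▸ h2) rfl (y := y) (by
    rw [List.getLast?_cons_of_ne_nil (by simp [hr]), List.getLast?_append_of_ne_nil _ hr, hy])
  exact ⟨h7.trans h3.symm, fun z hz => h8 z (hperm.mem_iff.mpr hz)⟩

theorem IsLongestDetour.mem_of_mem {V : Type*} {c : ℕ} [NeZero c] {H : SimpleGraph V}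
    {γ : ZMod c → V} {D : Finset V} {X : Finset (ZMod c)} (h : Hangs H γ D) {i j : ZMod c}
    {l : List V} (hl : IsLongestDetour H γ D i j l) (hln : l ≠ []) (hX : 2 ≤ X.card)
    (hfeet : ∀ u ∈ l, feet H γ u = X) (hcl : ∀ u ∈ l, ∀ z ∈ l, z ≠ u → H.Adj u z) {z : V}
    (hz : z ∈ D) : z ∈ l := by
  classical
  have hlD := hl.through.2.2
  have hnd := hl.through.2.1
  by_contra hzl
  obtain ⟨u, hu, w, hw, hwl, huw⟩ : ∃ u ∈ l, ∃ w ∈ D, w ∉ l ∧ H.Adj u w := by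
    by_contra! hcon
    have := h.conn l.toFinset (fun y hy => hlD y (by simpa using hy))
      ((List.toFinset_nonempty_iff l).mpr hln) (fun x hx y hy hxy => by
        by_contra hyl
        exact hcon x (by simpa using hx) y hy (by simpa using hyl) hxy)
    rw [← this] at hz
    exact hzl (by simpa using hz)
  have hchain : ∀ l' : List V, l'.Nodup → (∀ y ∈ l', y ∈ l) → l'.IsChain H.Adj := by
    intro l' hn hm
    refine List.Pairwise.isChain (hn.imp_of_mem fun ha hb hab => ?_)
    exact hcl _ (hm _ ha) _ (hm _ hb) hab.symm
  have hlast : ∀ l' : List V, l' ≠ [] → (∀ y ∈ l', y ∈ l) →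
      ∃ e, l'.getLast? = some e ∧ feet H γ e = X := by
    intro l' hn hm
    exact ⟨l'.getLast hn, List.getLast?_eq_some_getLast hn, hfeet _ (hm _ (List.getLast_mem hn))⟩
  obtain ⟨K₀, hK₀, hwK, hclK, hpath⟩ := H.exists_reachable_part (K := D \ l.toFinset) (x := w)
    (by simp [hw, hwl])
  have hKD : K₀ ⊆ D := hK₀.trans Finset.sdiff_subset
  have hKl : ∀ y ∈ D \ l.toFinset, y ∉ l := fun y hy => by simpa using (Finset.mem_sdiff.mp hy).2
  have hempty : ∀ x ∈ K₀, feet H γ x = ∅ := by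
    intro x hx
    by_contra hne
    obtain ⟨a, ha⟩ := Finset.nonempty_iff_ne_empty.mpr hne
    obtain ⟨b, hb, hba⟩ := Finset.exists_mem_ne (show 1 < X.card by omega) a
    obtain ⟨q, hqc, hqn, hqK, hqh, hql⟩ := hpath x hx
    have hqne : q ≠ [] := by rintro rfl; simp at hqh
    have hperm := List.perm_cons_erase hu
    have hmem : ∀ y ∈ u :: l.erase u, y ∈ l := fun y hy => hperm.mem_iff.mpr hy
    have hnd' : (u :: l.erase u).Nodup := hperm.nodup_iff.mp hnd
    obtain ⟨e, he, hfe⟩ := hlast (u :: l.erase u) (by simp) hmem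
    have hT : Through H D (γ a) (γ b) (q.reverse ++ u :: l.erase u) := by
      refine Through.of_isChain (h := x) (e := e) ?_ ?_ ?_ ?_ ?_ (mem_feet.mp ha)
        (mem_feet.mp (hfe ▸ hb))
      · rw [List.isChain_append, List.isChain_reverse]
        refine ⟨hqc.imp fun _ _ e => e.symm, hchain _ hnd' hmem, ?_⟩
        intro y hy v hv
        rw [List.getLast?_reverse, hqh] at hy
        simp only [Option.mem_def, Option.some.injEq, List.head?_cons] at hy hv
        exact hy ▸ hv ▸ huw.symm
      · rw [List.nodup_append]
        refine ⟨by simpa using hqn, hnd', ?_⟩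
        rintro y hy v hv rfl
        exact hKl y (hqK y (by simpa using hy)) (hmem y hv)
      · intro y hy
        rcases List.mem_append.mp hy with hy | hy
        · exact (Finset.mem_sdiff.mp (hqK y (by simpa using hy))).1
        · exact hlD y (hmem y hy)
      · rw [List.head?_append_of_ne_nil _ (by simpa using hqne), List.head?_reverse, hql]
      · rw [List.getLast?_append_of_ne_nil _ (by simp), he]
    have h1 := hl.le a b _ hba.symm hT
    have h2 := hperm.length_eq
    have h3 := List.length_pos_iff.mpr hqne
    rw [List.length_append, List.length_reverse] at h1
    omega
  obtain ⟨x, hx, y, hy, hyK, hyu, hxy⟩ := h.two K₀ hKD ⟨w, hwK⟩ hempty u (hlD u hu)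
    (fun e => hKl u (hK₀ e) hu)
  have hyl : y ∈ l := by
    by_contra hyl
    exact hyK (hclK x hx y (by simp [hy, hyl]) hxy)
  obtain ⟨a, ha, b, hb, hab⟩ := Finset.one_lt_card.mp (show 1 < X.card by omega)
  obtain ⟨q, hqc, hqn, hqK, hqh, hql⟩ := hpath x hx
  have hqne : q ≠ [] := by rintro rfl; simp at hqh
  have hyl' : y ∈ l.erase u := (List.mem_erase_of_ne hyu).mpr hyl
  have hperm := List.perm_cons_erase hyl'
  have hmem : ∀ v ∈ y :: (l.erase u).erase y, v ∈ l := fun v hv =>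
    List.mem_of_mem_erase (hperm.mem_iff.mpr hv)
  have hnd' : (y :: (l.erase u).erase y).Nodup := hperm.nodup_iff.mp (hnd.erase u)
  have hunot : u ∉ y :: (l.erase u).erase y := fun hv => hnd.not_mem_erase (hperm.mem_iff.mpr hv)
  obtain ⟨e, he, hfe⟩ := hlast (y :: (l.erase u).erase y) (by simp) hmem
  have hT : Through H D (γ a) (γ b) (u :: (q ++ y :: (l.erase u).erase y)) := by
    refine Through.of_isChain (h := u) (e := e) ?_ ?_ ?_ rfl ?_ (mem_feet.mp (hfeet u hu ▸ ha))
      (mem_feet.mp (hfe ▸ hb))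
    · rw [List.isChain_cons, List.isChain_append]
      refine ⟨?_, hqc, hchain _ hnd' hmem, ?_⟩
      · intro v hv
        rw [List.head?_append_of_ne_nil _ hqne, hqh] at hv
        simp only [Option.mem_def, Option.some.injEq] at hv
        exact hv ▸ huw
      · intro p hp v hv
        rw [hql] at hp
        simp only [Option.mem_def, Option.some.injEq, List.head?_cons] at hp hv
        exact hp ▸ hv ▸ hxy
    · rw [List.nodup_cons, List.nodup_append]
      refine ⟨?_, hqn, hnd', ?_⟩
      · rw [List.mem_append, not_or]
        exact ⟨fun e => hKl u (hqK u e) hu, hunot⟩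
      · rintro v hv v' hv' rfl
        exact hKl v (hqK v hv) (hmem v hv')
    · intro v hv
      rcases List.mem_cons.mp hv with rfl | hv
      · exact hlD v hu
      rcases List.mem_append.mp hv with hv | hv
      · exact (Finset.mem_sdiff.mp (hqK v hv)).1
      · exact hlD v (hmem v hv)
    · rw [List.getLast?_cons_of_ne_nil (by simp), List.getLast?_append_of_ne_nil _ (by simp), he]
  have h1 := hl.le a b _ hab hT
  have h2 := hperm.length_eq
  have h3 := List.length_pos_iff.mpr hqne
  have h4 := (List.perm_cons_erase hu).length_eq
  rw [List.length_cons, List.length_append] at h1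
  rw [List.length_cons] at h4
  omega

/-- The main estimate: a piece `D` hanging off a cycle of length at most `2 * t + 1` meets at most
`(t - 1) * |D| + 1` edges. -/
theorem Hangs.load_le {V : Type*} {c : ℕ} [NeZero c] {H : SimpleGraph V} {γ : ZMod c → V}
    {D : Finset V} {t : ℕ} (h : Hangs H γ D) (hc : c ≤ 2 * t + 1) :
    load H γ D + 2 * D.card ≤ 2 * t * D.card + 2 := by
  classical
  induction hd : D.card using Nat.strong_induction_on generalizing H D with
  | _ d ih =>
  obtain ⟨x₀, hx₀, i₀, hi₀, -⟩ := h.feet_ne 0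
  have hpos : 0 < D.card := Finset.card_pos.mpr ⟨x₀, hx₀⟩
  by_cases hd1 : D.card = 1
  · obtain ⟨x, rfl⟩ := Finset.card_eq_one.mp hd1
    obtain ⟨x₁, hx₁, i₁, hi₁, hne⟩ := h.feet_ne i₀
    rw [Finset.mem_singleton] at hx₀ hx₁
    subst hx₀ hx₁
    have h2 : 2 ≤ (feet H γ x₁).card := Finset.one_lt_card.mpr ⟨_, hi₁, _, hi₀, hne⟩
    have := ZMod.card_mul_le_of_gap (g := 2) h2 fun i hi j hj hij =>
      h.detour i j [x₁] hij (by simp) (Through.of_isChain (by simp) (by simp) (by simp) rfl rfl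
        (mem_feet.mp hi) (mem_feet.mp hj))
    have e : ({x₁} : Finset V).filter (H.Adj x₁) = ∅ := by
      simp [Finset.filter_singleton]
    have e' : load H γ {x₁} = 2 * (feet H γ x₁).card := by
      rw [load, Finset.sum_singleton]
      simp [Finset.filter_singleton]
    rw [e', ← hd, hd1]
    omega
  by_contra! hlt
  obtain ⟨i, j, l, hl, hl2⟩ := h.exists_isLongestDetour (show 2 ≤ D.card by omega)
  have hE : Tight H γ D t := by
    intro i j s u v r hl
    have hu : u ∈ D := hl.through.2.2 u (by simp)
    have hv : v ∈ D := hl.through.2.2 v (by simp)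
    have huv : H.Adj u v := by
      have := hl.through.isChain
      exact (List.isChain_cons_cons.mp this.right_of_append).1
    have hH := h.contractOnto hu hv huv fun K hK hKn hf => hl.exists_adj_outside h hK hKn hf
    have h1 := ih _ (by rw [← hd]; exact Finset.card_erase_lt_of_mem hv) hH rfl
    have h2 := load_le_contractOnto h hu hv huv
    have h3 := Finset.card_erase_add_one hv
    rw [← hd, ← h3] at hlt
    have h4 : 2 * t * ((D.erase v).card + 1) = 2 * t * (D.erase v).card + 2 * t := by ring
    omega
  have hln : l ≠ [] := by rintro rfl; simp at hl2
  obtain ⟨x, hx⟩ : ∃ x, l.head? = some x := ⟨_, List.head?_eq_some_head hln⟩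
  obtain ⟨y, hy⟩ : ∃ y, l.getLast? = some y :=
    ⟨_, List.getLast?_eq_some_getLast hln⟩
  obtain ⟨-, hcard, hlt', -⟩ := hl.head_spec h hc hE hl2 hx hy
  have hcl := hl.clique h hc hE hl2 hx
  have hDl : ∀ z ∈ D, z ∈ l := fun z hz => hl.mem_of_mem h hln
    (show 2 ≤ (feet H γ x).card by omega) (fun u hu => (hcl u hu).1) (fun u hu => (hcl u hu).2) hz
  have hDc : D.card = l.length := by
    rw [← List.toFinset_card_of_nodup hl.through.2.1]
    congr 1
    ext z
    rw [List.mem_toFinset]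
    exact ⟨hDl z, hl.through.2.2 z⟩
  have hload : load H γ D ≤ D.card * (D.card - 1 + 2 * (feet H γ x).card) := by
    rw [load, ← smul_eq_mul]
    refine Finset.sum_le_card_nsmul _ _ _ fun z hz => ?_
    rw [(hcl z (hDl z hz)).1, ← Finset.card_erase_of_mem hz]
    refine Nat.add_le_add_right (Finset.card_le_card fun w hw => ?_) _
    have hw := Finset.mem_filter.mp hw
    exact Finset.mem_erase.mpr ⟨hw.2.ne.symm, hw.1⟩
  obtain ⟨m, hm⟩ := Nat.exists_eq_add_of_le (show 2 ≤ D.card by omega)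
  obtain ⟨f, hf⟩ : ∃ f, f = (feet H γ x).card := ⟨_, rfl⟩
  have ht : t = f + m + 1 := by omega
  rw [← hf, hm, show 2 + m - 1 = m + 1 by omega] at hload
  rw [← hd, hm, ht] at hlt
  nlinarith

theorem TwoConnected.exists_adj {V : Type*} {G : SimpleGraph V} (h : TwoConnected G) {w : V}
    {K : Finset V} (hK : K.Nonempty) (hwK : w ∉ K) {y : V} (hyK : y ∉ K) (hyw : y ≠ w) :
    ∃ x ∈ K, ∃ z, z ∉ K ∧ z ≠ w ∧ G.Adj x z := by
  obtain ⟨x, hx⟩ := hK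
  have hxw : x ≠ w := fun e => hwK (e ▸ hx)
  obtain ⟨p⟩ := (h.2 w).preconnected ⟨x, by simpa using hxw⟩ ⟨y, by simpa using hyw⟩
  obtain ⟨d, -, hd, hd'⟩ := p.exists_boundary_dart {v | v.1 ∈ K} hx hyK
  have hadj := d.adj
  rw [Subgraph.coe_adj] at hadj
  exact ⟨d.fst.1, hd, d.snd.1, hd', by simpa using d.snd.2, hadj.adj_sub⟩

/-- The list `l` runs once around a cycle. -/
structure SimpleGraph.IsCycleList {V : Type*} (G : SimpleGraph V) (l : List V) : Prop where
  isChain : l.IsChain G.Adj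
  nodup : l.Nodup
  three_le : 3 ≤ l.length
  closes : ∀ a ∈ l.head?, ∀ b ∈ l.getLast?, G.Adj b a

theorem SimpleGraph.IsCycleList.exists_isCycle {V : Type*} {G : SimpleGraph V} {l : List V}
    (h : G.IsCycleList l) : ∃ (v : V) (C : G.Walk v v), C.IsCycle ∧ C.length = l.length := by
  have hne : l ≠ [] := by
    rintro rfl
    simpa using h.three_le
  have h3 := h.three_le
  have hp : (Walk.ofSupport l hne h.isChain).IsPath :=
    Walk.IsPath.mk' (by rw [Walk.support_ofSupport]; exact h.nodup)
  have hadj := h.closes _ (List.head?_eq_some_head hne) _ (List.getLast?_eq_some_getLast hne)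
  refine ⟨_, Walk.cons hadj (Walk.ofSupport l hne h.isChain), ?_, ?_⟩
  · refine (Walk.cons_isCycle_iff _ _).mpr ⟨hp, fun he => ?_⟩
    rw [Sym2.eq_swap] at he
    have := hp.length_eq_one_of_mem_edges he
    rw [Walk.length_ofSupport] at this
    omega
  · rw [Walk.length_cons, Walk.length_ofSupport]
    omega

theorem TwoConnected.exists_isCycleList {V : Type*} [Fintype V] {G : SimpleGraph V}
    (h : TwoConnected G) : ∃ l, G.IsCycleList l := by
  classical
  have hV : 3 ≤ Fintype.card V := by simpa using h.1
  obtain ⟨x, w, hxw⟩ := Fintype.exists_pair_of_one_lt_card (show 1 < Fintype.card V by omega)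
  have key : ∀ w ≠ x, ∃ z, z ≠ w ∧ G.Adj x z := by
    intro w hw
    obtain ⟨y, hy⟩ : ∃ y, y ∉ ({x, w} : Finset V) := by
      by_contra! hcon
      have h1 := Finset.card_le_card (fun y _ => hcon y : Finset.univ ⊆ ({x, w} : Finset V))
      have h2 := Finset.card_le_two (a := x) (b := w)
      rw [Finset.card_univ] at h1
      omega
    simp only [Finset.mem_insert, Finset.mem_singleton, not_or] at hy
    obtain ⟨x', hx', z, -, hzw, hz⟩ := h.exists_adj (K := {x}) (by simp) (by simpa using hw)
      (by simpa using hy.1) hy.2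
    exact ⟨z, hzw, by simpa using Finset.mem_singleton.mp hx' ▸ hz⟩
  obtain ⟨a, -, hxa⟩ := key w hxw.symm
  obtain ⟨b, hba, hxb⟩ := key a hxa.ne.symm
  obtain ⟨K, hK, haK, hcl, hpath⟩ := G.exists_reachable_part (K := Finset.univ.erase x) (x := a)
    (by simpa using hxa.ne.symm)
  have hxK : x ∉ K := fun hx => by simpa using hK hx
  have hbK : b ∈ K := by
    by_contra hbK
    obtain ⟨u, hu, z, hz, hzx, huz⟩ := h.exists_adj ⟨a, haK⟩ hxK hbK hxb.ne.symm
    exact hz (hcl u hu z (by simpa using hzx) huz)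
  obtain ⟨q, hqc, hqn, hqK, hqh, hql⟩ := hpath b hbK
  refine ⟨x :: q, ?_, ?_, ?_, ?_⟩
  · rw [List.isChain_cons]
    exact ⟨fun z hz => by rw [hqh] at hz; exact (Option.mem_some_iff.mp hz) ▸ hxa, hqc⟩
  · exact List.nodup_cons.mpr ⟨fun hx => by simpa using hqK x hx, hqn⟩
  · match q, hqh, hql with
    | [_], hqh, hql => simp at hqh hql; exact absurd (hql.symm.trans hqh) hba
    | _ :: _ :: _, _, _ => simp
  · intro y hy z hz
    have hq : q ≠ [] := by rintro rfl; simp at hqh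
    rw [List.getLast?_cons_of_ne_nil hq, hql] at hz
    rw [List.head?_cons] at hy
    exact Option.mem_some_iff.mp hy ▸ Option.mem_some_iff.mp hz ▸ hxb.symm

/-- The map `γ` traverses a longest cycle of `G`. -/
structure IsLongestCycle {V : Type*} {c : ℕ} (G : SimpleGraph V) (γ : ZMod c → V) : Prop where
  three_le : 3 ≤ c
  injective : Function.Injective γ
  adj : ∀ i, G.Adj (γ i) (γ (i + 1))
  le : ∀ l, G.IsCycleList l → l.length ≤ c

theorem SimpleGraph.IsCycleList.exists_map {V : Type*} {G : SimpleGraph V} {l : List V}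
    (h : G.IsCycleList l) : ∃ γ : ZMod l.length → V, Function.Injective γ ∧
      ∀ i, G.Adj (γ i) (γ (i + 1)) := by
  have h3 := h.three_le
  have : NeZero l.length := ⟨by omega⟩
  refine ⟨fun i => l[i.val]'(ZMod.val_lt i), fun i j hij => ?_, fun i => ?_⟩
  · exact ZMod.val_injective _ ((h.nodup.getElem_inj_iff).mp hij)
  · have hi := ZMod.val_lt i
    have hv : (i + 1).val = (i.val + 1) % l.length := by
      rw [ZMod.val_add, ZMod.val_one'' (by omega)]
    by_cases hlt : i.val + 1 < l.length
    · have := List.isChain_iff_getElem.mp h.isChain i.val hlt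
      simpa [hv, Nat.mod_eq_of_lt hlt] using this
    · have he : i.val + 1 = l.length := by omega
      have h0 : (i + 1).val = 0 := by rw [hv, he, Nat.mod_self]
      simp only [h0]
      refine h.closes _ ?_ _ ?_
      · rw [Option.mem_def, List.head?_eq_getElem?, List.getElem?_eq_getElem (by omega)]
      · rw [Option.mem_def, List.getLast?_eq_getElem?, show l.length - 1 = i.val by omega,
          List.getElem?_eq_getElem hi]

theorem TwoConnected.exists_isLongestCycle {V : Type*} [Fintype V] {G : SimpleGraph V}
    (h : TwoConnected G) {k : ℕ}
    (hcyc : ∀ (v : V) (C : G.Walk v v), C.IsCycle → C.length < k) :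
    ∃ (c : ℕ) (γ : ZMod c → V), c < k ∧ IsLongestCycle G γ := by
  classical
  obtain ⟨l₀, hl₀⟩ := h.exists_isCycleList
  let P : ℕ → Prop := fun m => ∃ l, G.IsCycleList l ∧ l.length = m
  have hb : ∀ m, P m → m ≤ k - 1 := by
    rintro m ⟨l, hl, rfl⟩
    obtain ⟨v, C, hC, hlen⟩ := hl.exists_isCycle
    have := hcyc v C hC
    omega
  have hP : P l₀.length := ⟨l₀, hl₀, rfl⟩
  obtain ⟨l, hl, hlen⟩ := Nat.findGreatest_spec (hb _ hP) hP
  obtain ⟨γ, hγ, hadj⟩ := hl.exists_map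
  have h3 := hl.three_le
  have hlk := hb _ ⟨l, hl, rfl⟩
  refine ⟨l.length, γ, by omega, h3, hγ, hadj, fun l' hl' => ?_⟩
  rw [hlen]
  exact Nat.le_findGreatest (hb _ ⟨l', hl', rfl⟩) ⟨l', hl', rfl⟩

/-- The `n` vertices following and including `γ a` on the cycle `γ`. -/
def arc {V : Type*} {c : ℕ} (γ : ZMod c → V) (a : ZMod c) (n : ℕ) : List V :=
  (List.range n).map fun s : ℕ => γ (a + s)

theorem length_arc {V : Type*} {c : ℕ} (γ : ZMod c → V) (a : ZMod c) (n : ℕ) :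
    (arc γ a n).length = n := by
  simp [arc]

theorem mem_arc {V : Type*} {c : ℕ} {γ : ZMod c → V} {a : ZMod c} {n : ℕ} {x : V} :
    x ∈ arc γ a n ↔ ∃ s < n, γ (a + s) = x := by
  simp [arc]

theorem head?_arc {V : Type*} {c : ℕ} (γ : ZMod c → V) (a : ZMod c) {n : ℕ} (hn : n ≠ 0) :
    (arc γ a n).head? = some (γ a) := by
  simp [arc, List.head?_range, hn]

theorem getLast?_arc {V : Type*} {c : ℕ} (γ : ZMod c → V) (a : ZMod c) {n : ℕ} (hn : n ≠ 0) :
    (arc γ a n).getLast? = some (γ (a + (n - 1 : ℕ))) := by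
  rw [arc, List.getLast?_map, List.getLast?_range, if_neg hn, Option.map_some]

theorem IsLongestCycle.isChain_arc {V : Type*} {c : ℕ} {G : SimpleGraph V} {γ : ZMod c → V}
    (h : IsLongestCycle G γ) (a : ZMod c) (n : ℕ) : (arc γ a n).IsChain G.Adj := by
  rw [arc, List.isChain_map, List.isChain_range]
  intro m _
  have := h.adj (a + m)
  rwa [add_assoc, ← Nat.cast_succ] at this

theorem IsLongestCycle.nodup_arc {V : Type*} {c : ℕ} {G : SimpleGraph V} {γ : ZMod c → V}
    (h : IsLongestCycle G γ) (a : ZMod c) {n : ℕ} (hn : n ≤ c) : (arc γ a n).Nodup := by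
  refine List.Nodup.map_on (fun s hs s' hs' e => ?_) List.nodup_range
  rw [List.mem_range] at hs hs'
  have := congrArg ZMod.val (add_left_cancel (h.injective e))
  rwa [ZMod.val_natCast_of_lt (by omega), ZMod.val_natCast_of_lt (by omega)] at this

theorem IsLongestCycle.detour {V : Type*} {c : ℕ} [NeZero c] {G : SimpleGraph V}
    {γ : ZMod c → V} (h : IsLongestCycle G γ) {D : Finset V} (hD : ∀ i, γ i ∉ D) {i j : ZMod c}
    {l : List V} (hij : i ≠ j) (hl : l ≠ []) (hT : Through G D (γ i) (γ j) l) :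
    l.length + 1 ≤ (j - i).val := by
  have hval := ZMod.val_sub_add_val_sub hij
  have hpos : (i - j).val ≠ 0 := by
    rw [Ne, ZMod.val_eq_zero, sub_eq_zero]
    exact hij
  have hlen := List.length_pos_iff.mpr hl
  have hlt := ZMod.val_lt (i - j)
  have hlast : (arc γ j ((i - j).val + 1)).getLast? = some (γ i) := by
    rw [getLast?_arc _ _ (by omega)]
    simp
  have hch := hT.1
  rw [List.isChain_cons, List.isChain_append] at hch
  have := h.le (arc γ j ((i - j).val + 1) ++ l) ⟨?_, ?_, ?_, ?_⟩
  · rw [List.length_append, length_arc] at this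
    omega
  · rw [List.isChain_append]
    refine ⟨h.isChain_arc _ _, hT.isChain, fun x hx y hy => ?_⟩
    rw [hlast] at hx
    rw [← Option.mem_some_iff.mp hx]
    exact hch.1 y (by rwa [List.head?_append_of_ne_nil _ hl])
  · rw [List.nodup_append]
    refine ⟨h.nodup_arc _ (by omega), hT.2.1, ?_⟩
    rintro x hx y hy rfl
    obtain ⟨s, -, rfl⟩ := mem_arc.mp hx
    exact hD _ (hT.2.2 _ hy)
  · rw [List.length_append, length_arc]
    omega
  · intro x hx y hy
    rw [List.head?_append_of_ne_nil _ (by simp [arc]), head?_arc _ _ (by omega)] at hx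
    rw [List.getLast?_append_of_ne_nil _ hl] at hy
    rw [← Option.mem_some_iff.mp hx]
    exact hch.2.2.2 y hy _ (by simp)

/-- Successors on a longest cycle of two neighbours of an outside vertex are not adjacent. -/
theorem IsLongestCycle.not_adj_add_one {V : Type*} {c : ℕ} [NeZero c] {G : SimpleGraph V}
    {γ : ZMod c → V} (h : IsLongestCycle G γ) {x : V} (hx : ∀ i, γ i ≠ x) {i j : ZMod c}
    (hi : i ∈ feet G γ x) (hj : j ∈ feet G γ x) : ¬G.Adj (γ (i + 1)) (γ (j + 1)) := by
  intro hadj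
  have hij : i ≠ j := by
    rintro rfl
    exact hadj.ne rfl
  have hval := ZMod.val_sub_add_val_sub hij
  have hpos : (i - j).val ≠ 0 := by
    rw [Ne, ZMod.val_eq_zero, sub_eq_zero]
    exact hij
  have hpos' : (j - i).val ≠ 0 := by
    rw [Ne, ZMod.val_eq_zero, sub_eq_zero]
    exact hij.symm
  have h3 := h.three_le
  have hend : ∀ {a b : ZMod c}, (b - a).val ≠ 0 →
      (arc γ (a + 1) (b - a).val).getLast? = some (γ b) := by
    intro a b hab
    rw [getLast?_arc _ _ hab, Nat.cast_sub (by omega)]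
    simp
  have := h.le (x :: ((arc γ (j + 1) (i - j).val).reverse ++ arc γ (i + 1) (j - i).val))
    ⟨?_, ?_, ?_, ?_⟩
  · simp only [List.length_cons, List.length_append, List.length_reverse, length_arc] at this
    omega
  · rw [List.isChain_cons, List.isChain_append, List.isChain_reverse]
    refine ⟨fun y hy => ?_, (h.isChain_arc _ _).imp fun _ _ e => e.symm, h.isChain_arc _ _,
      fun y hy z hz => ?_⟩
    · rw [List.head?_append_of_ne_nil _ (by simp [arc, hpos]), List.head?_reverse,
        hend hpos] at hy
      exact Option.mem_some_iff.mp hy ▸ mem_feet.mp hi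
    · rw [List.getLast?_reverse, head?_arc _ _ hpos] at hy
      rw [head?_arc _ _ hpos'] at hz
      rw [← Option.mem_some_iff.mp hy, ← Option.mem_some_iff.mp hz]
      exact hadj.symm
  · rw [List.nodup_cons, List.nodup_append, List.nodup_reverse]
    refine ⟨?_, h.nodup_arc _ (ZMod.val_lt _).le, h.nodup_arc _ (ZMod.val_lt _).le, ?_⟩
    · rw [List.mem_append, List.mem_reverse, mem_arc, mem_arc]
      rintro (⟨s, -, hs⟩ | ⟨s, -, hs⟩) <;> exact hx _ hs
    · rintro y hy z hz rfl
      rw [List.mem_reverse, mem_arc] at hy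
      rw [mem_arc] at hz
      obtain ⟨s, hs, rfl⟩ := hy
      obtain ⟨s', hs', e⟩ := hz
      have e' : (s : ZMod c) = (i - j) + (s' : ZMod c) := by
        linear_combination -(h.injective e)
      have := congrArg ZMod.val e'
      rw [ZMod.val_natCast_of_lt (by omega), ZMod.val_add, ZMod.val_natCast_of_lt (by omega),
        Nat.mod_eq_of_lt (by omega)] at this
      omega
  · simp only [List.length_cons, List.length_append, List.length_reverse, length_arc]
    omega
  · intro y hy z hz
    rw [List.head?_cons] at hy
    rw [List.getLast?_cons_of_ne_nil (by simp [arc, hpos]),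
      List.getLast?_append_of_ne_nil _ (by simp [arc, hpos']), hend hpos'] at hz
    rw [← Option.mem_some_iff.mp hy, ← Option.mem_some_iff.mp hz]
    exact (mem_feet.mp hj).symm

theorem IsLongestCycle.neg {V : Type*} {c : ℕ} {G : SimpleGraph V} {γ : ZMod c → V}
    (h : IsLongestCycle G γ) : IsLongestCycle G fun i => γ (-i) :=
  ⟨h.three_le, h.injective.comp neg_injective,
    fun i => by simpa using (h.adj (-(i + 1))).symm, h.le⟩

theorem IsLongestCycle.not_adj_sub_one {V : Type*} {c : ℕ} [NeZero c] {G : SimpleGraph V}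
    {γ : ZMod c → V} (h : IsLongestCycle G γ) {x : V} (hx : ∀ i, γ i ≠ x) {i j : ZMod c}
    (hi : i ∈ feet G γ x) (hj : j ∈ feet G γ x) : ¬G.Adj (γ (i - 1)) (γ (j - 1)) := by
  have := h.neg.not_adj_add_one (x := x) (i := -i) (j := -j) (fun k => hx _)
    (mem_feet.mpr (by rw [neg_neg]; exact mem_feet.mp hi))
    (mem_feet.mpr (by rw [neg_neg]; exact mem_feet.mp hj))
  have e : ∀ a : ZMod c, -(-a + 1) = a - 1 := fun a => by ring
  rwa [e, e] at this

theorem List.IsChain.forall_mem_of_closed {V : Type*} {H : SimpleGraph V} {S W : Finset V}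
    (hcl : ∀ a ∈ S, ∀ b ∈ W, H.Adj a b → b ∈ S) {q : List V} (hc : q.IsChain H.Adj)
    (hW : ∀ y ∈ q, y ∈ W) (hh : ∀ y ∈ q.head?, y ∈ S) : ∀ y ∈ q, y ∈ S := by
  induction q with
  | nil => simp
  | cons a q ih =>
    rw [List.isChain_cons] at hc
    have ha : a ∈ S := hh a rfl
    have := ih hc.2 (fun y hy => hW y (by simp [hy])) fun y hy =>
      hcl a ha y (hW y (by simp [List.mem_of_mem_head? hy])) (hc.1 y hy)
    simpa [ha] using this

theorem IsLongestCycle.hangs {V : Type*} {c : ℕ} [NeZero c] {G : SimpleGraph V}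
    {γ : ZMod c → V} (h : IsLongestCycle G γ) (h2 : TwoConnected G) {D : Finset V}
    (hDn : D.Nonempty) (hD : ∀ i, γ i ∉ D)
    (hcl : ∀ x ∈ D, ∀ y, G.Adj x y → y ∈ D ∨ ∃ i, γ i = y)
    (hconn : ∀ K ⊆ D, K.Nonempty → (∀ x ∈ K, ∀ y ∈ D, G.Adj x y → y ∈ K) → K = D) :
    Hangs G γ D := by
  refine ⟨hD, fun i j l hij hl hT => h.detour hD hij hl hT, hconn, ?_, ?_⟩
  · intro K hK hKn hf w hw hwK
    obtain ⟨x, hx, z, hz, hzw, hxz⟩ := h2.exists_adj hKn hwK (y := γ 0) (fun e => hD _ (hK e))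
      (fun e => hD 0 (e ▸ hw))
    rcases hcl x (hK hx) z hxz with hzD | ⟨i, rfl⟩
    · exact ⟨x, hx, z, hzD, hz, hzw, hxz⟩
    · have := mem_feet.mpr hxz
      rw [hf x hx] at this
      simp at this
  · intro w
    obtain ⟨x, hx, z, hz, hzw, hxz⟩ := h2.exists_adj hDn (hD w) (y := γ (w + 1)) (hD _)
      (h.adj w).ne.symm
    rcases hcl x hx z hxz with hzD | ⟨i, rfl⟩
    · exact absurd hzD hz
    · exact ⟨x, hx, i, mem_feet.mpr hxz, fun e => hzw (by rw [e])⟩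

theorem load_union_of_not_adj {V : Type*} {c : ℕ} [NeZero c] [DecidableEq V] {H : SimpleGraph V}
    {γ : ZMod c → V} {A B : Finset V} (hAB : Disjoint A B)
    (hadj : ∀ a ∈ A, ∀ b ∈ B, ¬H.Adj a b) :
    load H γ (A ∪ B) = load H γ A + load H γ B := by
  classical
  rw [load, load, load, Finset.sum_union hAB]
  congr 1
  · refine Finset.sum_congr rfl fun x hx => ?_
    congr 2
    rw [Finset.filter_union, Finset.filter_eq_empty_iff.mpr (fun b hb => hadj x hx b hb),
      Finset.union_empty]
  · refine Finset.sum_congr rfl fun x hx => ?_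
    congr 2
    rw [Finset.filter_union, Finset.filter_eq_empty_iff.mpr
      (fun a ha e => hadj a ha x hx e.symm), Finset.empty_union]

theorem IsLongestCycle.load_le {V : Type*} {c : ℕ} [NeZero c] {G : SimpleGraph V}
    {γ : ZMod c → V} (h : IsLongestCycle G γ) (h2 : TwoConnected G) {N : ℕ}
    (hN : ∀ D, Hangs G γ D → load G γ D ≤ N * D.card) {W : Finset V} (hW : ∀ i, γ i ∉ W)
    (hcl : ∀ x ∈ W, ∀ y, G.Adj x y → y ∈ W ∨ ∃ i, γ i = y) : load G γ W ≤ N * W.card := by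
  classical
  induction hd : W.card using Nat.strong_induction_on generalizing W with
  | _ d ih =>
  rcases W.eq_empty_or_nonempty with rfl | ⟨x, hx⟩
  · simp [load]
  obtain ⟨K, hK, hxK, hKcl, hpath⟩ := G.exists_reachable_part hx
  have hconn : ∀ S ⊆ K, x ∈ S → (∀ a ∈ S, ∀ b ∈ K, G.Adj a b → b ∈ S) → S = K := by
    intro S hS hxS hSc
    refine hS.antisymm fun z hz => ?_
    obtain ⟨q, hqc, -, hqW, hqh, hql⟩ := hpath z hz
    refine hqc.forall_mem_of_closed (W := W) (fun a ha b hb hab =>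
      hSc a ha b (hKcl a (hS ha) b hb hab) hab) hqW (fun y hy => ?_) z
      (List.mem_of_getLast? hql)
    rw [hqh] at hy
    exact Option.mem_some_iff.mp hy ▸ hxS
  have hH : Hangs G γ K := by
    refine h.hangs h2 ⟨x, hxK⟩ (fun i hi => hW i (hK hi)) (fun a ha y hay => ?_) ?_
    · exact (hcl a (hK ha) y hay).imp_left fun hy => hKcl a ha y hy hay
    · intro S hS hSn hSc
      by_cases hxS : x ∈ S
      · exact hconn S hS hxS hSc
      · have := hconn (K \ S) Finset.sdiff_subset (by simp [hxK, hxS]) fun a ha b hb hab => by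
          rw [Finset.mem_sdiff] at ha ⊢
          exact ⟨hb, fun hbS => ha.2 (hSc b hbS a ha.1 hab.symm)⟩
        obtain ⟨s, hs⟩ := hSn
        have hsK := hS hs
        rw [← this] at hsK
        exact absurd hs (Finset.mem_sdiff.mp hsK).2
  have hcard := Finset.card_sdiff_add_card_eq_card hK
  have hpos : 0 < K.card := Finset.card_pos.mpr ⟨x, hxK⟩
  have h1 := ih (W \ K).card (by omega) (W := W \ K)
    (fun i hi => hW i (Finset.mem_sdiff.mp hi).1) (fun a ha y hay => by
      rw [Finset.mem_sdiff] at ha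
      refine (hcl a ha.1 y hay).imp_left fun hy => Finset.mem_sdiff.mpr ⟨hy, fun hyK => ha.2 ?_⟩
      exact hKcl y hyK a ha.1 hay.symm) rfl
  have h3 := hN K hH
  have h4 := load_union_of_not_adj (H := G) (γ := γ) (A := W \ K) (B := K)
    Finset.sdiff_disjoint fun a ha b hb hab => (Finset.mem_sdiff.mp ha).2
      (hKcl b hb a (Finset.mem_sdiff.mp ha).1 hab.symm)
  rw [Finset.sdiff_union_of_subset hK] at h4
  rw [h4, ← hd, ← hcard, mul_add]
  omega

/-- Twice the number of edges of `G` inside `S`. -/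
noncomputable def twiceEdges {V : Type*} (G : SimpleGraph V) (S : Finset V) : ℕ :=
  open Classical in ∑ x ∈ S, (S.filter (G.Adj x)).card

open Classical in
theorem twiceEdges_union {V : Type*} [DecidableEq V] (G : SimpleGraph V)
    {A B : Finset V} (hAB : Disjoint A B) :
    twiceEdges G (A ∪ B) =
      twiceEdges G A + twiceEdges G B + 2 * ∑ a ∈ A, (B.filter (G.Adj a)).card := by
  have h1 : ∀ x, ((A ∪ B).filter (G.Adj x)).card =
      (A.filter (G.Adj x)).card + (B.filter (G.Adj x)).card := fun x => by
    rw [Finset.filter_union, Finset.card_union_of_disjoint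
      (Finset.disjoint_filter_filter hAB)]
  have h2 : ∑ b ∈ B, (A.filter (G.Adj b)).card = ∑ a ∈ A, (B.filter (G.Adj a)).card := by
    have := Finset.sum_card_bipartiteAbove_eq_sum_card_bipartiteBelow G.Adj (s := A) (t := B)
    simp only [Finset.bipartiteAbove, Finset.bipartiteBelow] at this
    rw [this]
    simp only [G.adj_comm]
  rw [twiceEdges, twiceEdges, twiceEdges, Finset.sum_union hAB]
  simp only [h1, Finset.sum_add_distrib, h2]
  ring

theorem twiceEdges_univ {V : Type*} [Fintype V] (G : SimpleGraph V) :
    twiceEdges G Finset.univ = 2 * G.edgeSet.ncard := by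
  classical
  rw [← coe_edgeFinset, Set.ncard_coe_finset, ← sum_degrees_eq_twice_card_edges, twiceEdges]
  refine Finset.sum_congr rfl fun x _ => ?_
  rw [← card_neighborFinset_eq_degree]
  congr 1
  ext y
  simp

theorem twiceEdges_congr {V : Type*} {G H : SimpleGraph V} {S : Finset V}
    (h : ∀ a ∈ S, ∀ b ∈ S, G.Adj a b ↔ H.Adj a b) : twiceEdges G S = twiceEdges H S := by
  classical
  exact Finset.sum_congr rfl fun x hx => congrArg _ (Finset.filter_congr (h x hx))

theorem twiceEdges_eq_zero {V : Type*} {G : SimpleGraph V} {S : Finset V}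
    (h : ∀ a ∈ S, ∀ b ∈ S, ¬G.Adj a b) : twiceEdges G S = 0 := by
  classical
  exact Finset.sum_eq_zero fun x hx => by
    rw [Finset.card_eq_zero, Finset.filter_eq_empty_iff]
    exact h x hx

theorem twiceEdges_le {V : Type*} (G : SimpleGraph V) (S : Finset V) :
    twiceEdges G S ≤ S.card * (S.card - 1) := by
  classical
  rw [twiceEdges, ← smul_eq_mul]
  refine Finset.sum_le_card_nsmul _ _ _ fun z hz => ?_
  rw [← Finset.card_erase_of_mem hz]
  refine Finset.card_le_card fun w hw => ?_
  have hw := Finset.mem_filter.mp hw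
  exact Finset.mem_erase.mpr ⟨hw.2.ne.symm, hw.1⟩

theorem twiceEdges_induce {V : Type*} (G : SimpleGraph V) (S : Finset V) :
    twiceEdges G S = 2 * (G.induce (S : Set V)).edgeSet.ncard := by
  classical
  rw [← twiceEdges_univ, twiceEdges, twiceEdges, ← Finset.sum_coe_sort]
  refine Finset.sum_congr rfl fun x _ => ?_
  refine Finset.card_bij' (fun y hy => ⟨y, (Finset.mem_filter.mp hy).1⟩) (fun y _ => y.1)
    ?_ ?_ ?_ ?_
  · intro y hy
    simpa using (Finset.mem_filter.mp hy).2
  · intro y hy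
    have := (Finset.mem_filter.mp hy).2
    exact Finset.mem_filter.mpr ⟨y.2, by simpa using this⟩
  · intro y hy
    rfl
  · intro y hy
    rfl

theorem ncard_edgeSet_le_exK_s14 {V : Type*} [Fintype V] {F : SimpleGraph V} {r : ℕ}
    (h : F.CliqueFree r) : F.edgeSet.ncard ≤ exK (Fintype.card V) r := by
  classical
  let e := Fintype.equivFin V
  let F' : SimpleGraph (Fin (Fintype.card V)) := F.comap e.symm
  have i : F' ≃g F := ⟨e.symm, Iff.rfl⟩
  refine le_csSup ?_ ⟨F', ?_, ?_⟩
  · refine ⟨(⊤ : SimpleGraph (Fin (Fintype.card V))).edgeSet.ncard, ?_⟩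
    rintro m ⟨G, -, rfl⟩
    exact Set.ncard_le_ncard (edgeSet_mono le_top) (Set.toFinite _)
  · exact h.comap i.toEmbedding.isContained
  · rw [← Nat.card_coe_set_eq, ← Nat.card_coe_set_eq]
    exact Nat.card_congr i.mapEdgeSet

theorem twiceEdges_le_exK {V : Type*} {G : SimpleGraph V} {S : Finset V} {r : ℕ}
    (h : G.CliqueFreeOn (S : Set V) r) : twiceEdges G S ≤ 2 * exK S.card r := by
  have hF : (G.induce (S : Set V)).CliqueFree r :=
    (cliqueFree_induce_iff _ _ _).mpr h
  have := ncard_edgeSet_le_exK_s14 hF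
  rw [twiceEdges_induce]
  simpa using this

theorem IsLongestCycle.two_mul_ncard_edgeSet {V : Type*} {c : ℕ} [NeZero c] [Fintype V]
    [DecidableEq V] {G : SimpleGraph V} {γ : ZMod c → V} (h : IsLongestCycle G γ) :
    2 * G.edgeSet.ncard =
      twiceEdges G (Finset.univ.image γ) + load G γ (Finset.univ.image γ)ᶜ := by
  classical
  have hu := twiceEdges_union G (disjoint_compl_left (a := Finset.univ.image γ))
  rw [Finset.union_comm, Finset.union_compl, twiceEdges_univ] at hu
  rw [hu, load, Finset.sum_add_distrib, ← Finset.mul_sum]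
  have : ∀ x, ((Finset.univ.image γ).filter (G.Adj x)).card = (feet G γ x).card := by
    intro x
    rw [Finset.filter_image, Finset.card_image_of_injective _ h.injective, feet]
  simp only [this]
  rw [twiceEdges]
  ring

theorem SimpleGraph.CliqueFreeOn.of_forall_adj {V : Type*} {G : SimpleGraph V} {S T : Finset V}
    {r : ℕ} {x : V} (h : G.CliqueFreeOn (T : Set V) (r + 1)) (hx : x ∈ T) (hST : S ⊆ T)
    (hadj : ∀ a ∈ S, G.Adj x a) : G.CliqueFreeOn (S : Set V) r := by
  classical
  intro Q hQ hQc
  refine h ?_ (hQc.insert fun b hb => hadj b (hQ hb))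
  rw [Finset.coe_subset]
  exact Finset.insert_subset hx ((Finset.coe_subset.mp hQ).trans hST)

theorem twiceEdges_add_two_le_exK {V : Type*} {G : SimpleGraph V} {S : Finset V} {r : ℕ}
    (h : G.CliqueFreeOn (S : Set V) r) (hr : r ≤ S.card) :
    twiceEdges G S + 2 ≤ 2 * exK S.card (r + 1) := by
  classical
  obtain ⟨Q, hQS, hQ⟩ := Finset.exists_subset_card_eq hr
  have hQc : ¬G.IsClique (Q : Set V) := fun hc => h (Finset.coe_subset.mpr hQS) ⟨hc, hQ⟩
  simp only [IsClique, Set.Pairwise, not_forall] at hQc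
  obtain ⟨a, ha, b, hb, hab, hadj⟩ := hQc
  let F := G.induce (S : Set V)
  have hF : F.CliqueFree r := (cliqueFree_induce_iff _ _ _).mpr h
  let a' : (S : Set V) := ⟨a, hQS ha⟩
  let b' : (S : Set V) := ⟨b, hQS hb⟩
  have h1 := ncard_edgeSet_le_exK_s14 (hF.sup_edge a' b')
  have h2 := F.card_edgeFinset_sup_edge (s := a') (t := b') (by simpa [F, a', b'] using hadj)
    (by simpa [a', b'] using hab)
  rw [← coe_edgeFinset, Set.ncard_coe_finset, h2, ← Set.ncard_coe_finset, coe_edgeFinset] at h1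
  rw [twiceEdges_induce]
  simp only [Finset.coe_sort_coe, Fintype.card_coe] at h1
  change 2 * F.edgeSet.ncard + 2 ≤ _
  omega

theorem twiceEdges_le_two {V : Type*} {G : SimpleGraph V} {S : Finset V} {p q : V}
    (h : ∀ a ∈ S, ∀ b ∈ S, G.Adj a b → a = p ∧ b = q ∨ a = q ∧ b = p) :
    twiceEdges G S ≤ 2 := by
  classical
  have key : ∀ x ∈ S, (S.filter (G.Adj x)).card ≤
      (if x = p then 1 else 0) + (if x = q then 1 else 0) := by
    intro x hx
    have hle : (S.filter (G.Adj x)).card ≤ 1 := by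
      rw [Finset.card_le_one]
      intro a ha b hb
      rw [Finset.mem_filter] at ha hb
      have h1 := h x hx a ha.1 ha.2
      have h2 := h x hx b hb.1 hb.2
      grind
    by_cases hp : x = p
    · simp only [hp, if_true] at hle ⊢
      omega
    by_cases hq : x = q
    · simp only [hq, if_true] at hle ⊢
      omega
    rw [if_neg hp, if_neg hq, Nat.add_zero, Nat.le_zero, Finset.card_eq_zero,
      Finset.filter_eq_empty_iff]
    intro y hy hxy
    rcases h x hx y hy hxy with e | e
    · exact hp e.1
    · exact hq e.1
  refine (Finset.sum_le_sum key).trans ?_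
  rw [Finset.sum_add_distrib, Finset.sum_ite_eq', Finset.sum_ite_eq']
  split_ifs <;> omega

open Classical in
theorem twiceEdges_add_le_exK {V : Type*} {G : SimpleGraph V} {S : Finset V} {r : ℕ}
    (h : G.CliqueFree r) {s y : V} (hy : y ∉ S) :
    twiceEdges G S + 2 * (S.filter (G.Adj s)).card ≤ 2 * exK (S.card + 1) r := by
  have hne : ∀ w ∈ S, w ≠ y := fun w hw e => hy (e ▸ hw)
  have h1 := twiceEdges_le_exK (S := {y} ∪ S) (r := r)
    ((h.replaceVertex s y).cliqueFreeOn (s := ((({y} ∪ S : Finset V)) : Set V)))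
  rw [twiceEdges_union _ (Finset.disjoint_singleton_left.mpr hy), Finset.sum_singleton,
    twiceEdges_congr (S := S) (H := G) fun a ha b hb =>
      G.adj_replaceVertex_iff_of_ne s (hne a ha) (hne b hb),
    @Finset.filter_congr V _ (G.Adj s) (fun _ => Classical.propDecidable _)
      (fun _ => Classical.propDecidable _) S fun a ha =>
      G.adj_replaceVertex_iff_of_ne_right s (hne a ha),
    Finset.card_union_of_disjoint (Finset.disjoint_singleton_left.mpr hy),
    Finset.card_singleton, Nat.add_comm 1] at h1
  omega

theorem IsLongestCycle.add_one_notMem_feet {V : Type*} {c : ℕ} [NeZero c] {G : SimpleGraph V}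
    {γ : ZMod c → V} (h : IsLongestCycle G γ) {x : V} (hx : ∀ i, γ i ≠ x) {i : ZMod c}
    (hi : i ∈ feet G γ x) : i + 1 ∉ feet G γ x := by
  intro hj
  have h3 := h.three_le
  have h1 : (1 : ZMod c).val = 1 := ZMod.val_one'' (by omega)
  have := h.detour (D := {x}) (by simpa using hx) (i := i) (j := i + 1) (l := [x])
    (fun e => by
      have : (1 : ZMod c) = 0 := by simpa using e.symm
      simp [this] at h1) (by simp)
    (by simpa [Through] using ⟨(mem_feet.mp hi).symm, mem_feet.mp hj⟩)
  rw [add_sub_cancel_left, h1] at this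
  simp at this

theorem IsLongestCycle.two_mul_card_feet_le {V : Type*} {c : ℕ} [NeZero c] {G : SimpleGraph V}
    {γ : ZMod c → V} (h : IsLongestCycle G γ) {x : V} (hx : ∀ i, γ i ≠ x) :
    2 * (feet G γ x).card ≤ c := by
  have hd : Disjoint (feet G γ x) ((feet G γ x).image (· + 1)) := by
    rw [Finset.disjoint_right]
    intro j hj
    obtain ⟨i, hi, rfl⟩ := Finset.mem_image.mp hj
    exact h.add_one_notMem_feet hx hi
  have h1 := Finset.card_le_univ (feet G γ x ∪ (feet G γ x).image (· + 1))
  rw [Finset.card_union_of_disjoint hd,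
    Finset.card_image_of_injective _ (add_left_injective 1), ZMod.card] at h1
  omega

theorem IsLongestCycle.exists_eq_of_adj {V : Type*} {c t : ℕ} [NeZero c] {G : SimpleGraph V}
    {γ : ZMod c → V} (h : IsLongestCycle G γ) {x : V} (hx : ∀ i, γ i ≠ x)
    (ht : t = (feet G γ x).card) (hc : c = 2 * t + 1) :
    ∃ p q, ∀ i ∉ feet G γ x, ∀ j ∉ feet G γ x, G.Adj (γ i) (γ j) →
      i = p ∧ j = q ∨ i = q ∧ j = p := by
  classical
  set A := feet G γ x with hA
  have hS : (Aᶜ).card = t + 1 := by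
    rw [Finset.card_compl, ZMod.card]
    omega
  have hsub : A.image (· + 1) ⊆ Aᶜ := by
    intro j hj
    obtain ⟨i, hi, rfl⟩ := Finset.mem_image.mp hj
    exact Finset.mem_compl.mpr (h.add_one_notMem_feet hx hi)
  have hsub' : A.image (· - 1) ⊆ Aᶜ := by
    intro j hj
    obtain ⟨i, hi, rfl⟩ := Finset.mem_image.mp hj
    refine Finset.mem_compl.mpr fun hm => h.add_one_notMem_feet hx hm ?_
    simpa using hi
  have hq : (Aᶜ \ A.image (· + 1)).card = 1 := by
    rw [Finset.card_sdiff_of_subset hsub, hS,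
      Finset.card_image_of_injective _ (add_left_injective 1)]
    omega
  have hp : (Aᶜ \ A.image (· - 1)).card = 1 := by
    rw [Finset.card_sdiff_of_subset hsub', hS,
      Finset.card_image_of_injective _ (sub_left_injective)]
    omega
  obtain ⟨q, hq⟩ := Finset.card_eq_one.mp hq
  obtain ⟨p, hp⟩ := Finset.card_eq_one.mp hp
  have hpq : p = q - 1 := by
    have hqm : q ∈ Aᶜ \ A.image (· + 1) := by rw [hq]; exact Finset.mem_singleton_self q
    rw [Finset.mem_sdiff, Finset.mem_compl] at hqm
    have : q - 1 ∈ Aᶜ \ A.image (· - 1) := by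
      rw [Finset.mem_sdiff, Finset.mem_compl]
      refine ⟨fun hm => hqm.2 (Finset.mem_image.mpr ⟨_, hm, by simp⟩), fun hm => ?_⟩
      obtain ⟨i, hi, e⟩ := Finset.mem_image.mp hm
      exact hqm.1 (sub_left_injective e ▸ hi)
    rw [hp, Finset.mem_singleton] at this
    exact this.symm
  have h3 := h.three_le
  have hne : p ≠ q := by
    intro e
    have h1 : (1 : ZMod c).val = 1 := ZMod.val_one'' (by omega)
    have : (1 : ZMod c) = 0 := by
      rw [e] at hpq
      simpa using hpq.symm
    simp [this] at h1
  have hq' : ∀ i ∉ A, i = q ∨ i ∈ A.image (· + 1) := by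
    intro i hi
    by_contra! hcon
    have : i ∈ Aᶜ \ A.image (· + 1) := by
      rw [Finset.mem_sdiff, Finset.mem_compl]
      exact ⟨hi, hcon.2⟩
    rw [hq, Finset.mem_singleton] at this
    exact hcon.1 this
  have hp' : ∀ i ∉ A, i = p ∨ i ∈ A.image (· - 1) := by
    intro i hi
    by_contra! hcon
    have : i ∈ Aᶜ \ A.image (· - 1) := by
      rw [Finset.mem_sdiff, Finset.mem_compl]
      exact ⟨hi, hcon.2⟩
    rw [hp, Finset.mem_singleton] at this
    exact hcon.1 this
  refine ⟨p, q, fun i hi j hj hij => ?_⟩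
  have h1 : i = q ∨ j = q := by
    rcases hq' i hi with e | hi
    · exact Or.inl e
    rcases hq' j hj with e | hj
    · exact Or.inr e
    obtain ⟨a, ha, rfl⟩ := Finset.mem_image.mp hi
    obtain ⟨b, hb, rfl⟩ := Finset.mem_image.mp hj
    exact absurd hij (h.not_adj_add_one hx ha hb)
  have h2 : i = p ∨ j = p := by
    rcases hp' i hi with e | hi
    · exact Or.inl e
    rcases hp' j hj with e | hj
    · exact Or.inr e
    obtain ⟨a, ha, rfl⟩ := Finset.mem_image.mp hi
    obtain ⟨b, hb, rfl⟩ := Finset.mem_image.mp hj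
    exact absurd hij (h.not_adj_sub_one hx ha hb)
  grind

theorem IsLongestCycle.twiceEdges_image_le {V : Type*} {c t r : ℕ} [NeZero c] [DecidableEq V]
    {G : SimpleGraph V} {γ : ZMod c → V} (h : IsLongestCycle G γ) (hc : c = 2 * t ∨ c = 2 * t + 1)
    {x : V} (hx : ∀ i, γ i ≠ x) (hfx : t ≤ (feet G γ x).card) (hfree : G.CliqueFree (r + 1))
    (hr : r ≤ t) :
    twiceEdges G (Finset.univ.image γ) ≤ 2 * exK t r + 2 * (t * (c - t)) := by
  classical
  have h2A := h.two_mul_card_feet_le hx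
  set A := feet G γ x with hA
  have hAt : t = A.card := by omega
  let A' := A.image γ
  let B' := (Aᶜ).image γ
  have hAB : Disjoint A' B' :=
    (Finset.disjoint_image h.injective).mpr disjoint_compl_right
  have hC : Finset.univ.image γ = A' ∪ B' := by
    rw [← Finset.image_union, Finset.union_compl]
  have hA'c : A'.card = t := by rw [Finset.card_image_of_injective _ h.injective, hAt]
  have hB'c : B'.card = c - t := by
    rw [Finset.card_image_of_injective _ h.injective, Finset.card_compl, ZMod.card, hAt]
  have hxA : ∀ a ∈ A', G.Adj x a := by
    intro a ha
    obtain ⟨i, hi, rfl⟩ := Finset.mem_image.mp ha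
    exact mem_feet.mp hi
  have hA'f : G.CliqueFreeOn (A' : Set V) r :=
    (hfree.cliqueFreeOn (s := ((insert x A' : Finset V) : Set V))).of_forall_adj
      (Finset.mem_insert_self x A') (Finset.subset_insert _ _) hxA
  have hA'e := twiceEdges_le_exK hA'f
  have hle : ∀ a ∈ A', (B'.filter (G.Adj a)).card ≤ c - t := fun a _ =>
    (Finset.card_filter_le _ _).trans hB'c.le
  have hcross : ∑ a ∈ A', (B'.filter (G.Adj a)).card ≤ t * (c - t) := by
    have := Finset.sum_le_card_nsmul _ _ _ hle
    rwa [hA'c, smul_eq_mul] at this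
  rw [hC, twiceEdges_union G hAB]
  rw [hA'c] at hA'e
  by_cases hB : ∀ a ∈ B', ∀ b ∈ B', ¬G.Adj a b
  · rw [twiceEdges_eq_zero hB]
    omega
  push Not at hB
  obtain ⟨b₁, hb₁, b₂, hb₂, hb⟩ := hB
  have hB2 : twiceEdges G B' ≤ 2 := by
    rcases hc with hc | hc
    · exfalso
      have hsub : A.image (· + 1) = Aᶜ := by
        refine Finset.eq_of_subset_of_card_le (fun j hj => ?_) ?_
        · obtain ⟨i, hi, rfl⟩ := Finset.mem_image.mp hj
          exact Finset.mem_compl.mpr (h.add_one_notMem_feet hx hi)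
        · rw [Finset.card_compl, ZMod.card,
            Finset.card_image_of_injective _ (add_left_injective 1)]
          omega
      obtain ⟨i, hi, rfl⟩ := Finset.mem_image.mp hb₁
      obtain ⟨j, hj, rfl⟩ := Finset.mem_image.mp hb₂
      rw [← hsub] at hi hj
      obtain ⟨i', hi', rfl⟩ := Finset.mem_image.mp hi
      obtain ⟨j', hj', rfl⟩ := Finset.mem_image.mp hj
      exact h.not_adj_add_one hx hi' hj' hb
    · obtain ⟨p, q, hpq⟩ := h.exists_eq_of_adj hx hAt hc
      refine twiceEdges_le_two (p := γ p) (q := γ q) fun a ha b hb hab => ?_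
      obtain ⟨i, hi, rfl⟩ := Finset.mem_image.mp ha
      obtain ⟨j, hj, rfl⟩ := Finset.mem_image.mp hb
      rcases hpq i (Finset.mem_compl.mp hi) j (Finset.mem_compl.mp hj) hab with ⟨e, e'⟩ | ⟨e, e'⟩
      · exact Or.inl ⟨by rw [e], by rw [e']⟩
      · exact Or.inr ⟨by rw [e], by rw [e']⟩
  rcases hcross.lt_or_eq with hlt | heq
  · omega
  have hall : ∀ a ∈ A', ∀ b ∈ B', G.Adj a b := by
    intro a ha b hb
    have h1 := (Finset.sum_eq_sum_iff_of_le hle).mp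
      (by rw [heq, Finset.sum_const, hA'c, smul_eq_mul]) a ha
    rw [← hB'c] at h1
    exact (Finset.card_filter_eq_iff.mp h1) b hb
  cases r with
  | zero =>
    exact absurd hA'f (fun hf => hf (t := ∅) (by simp) (by simp))
  | succ r =>
    have h1 : G.CliqueFreeOn ((insert b₂ A' : Finset V) : Set V) (r + 1) :=
      (hfree.cliqueFreeOn (s := ((insert b₁ (insert b₂ A') : Finset V) : Set V))).of_forall_adj
        (Finset.mem_insert_self _ _) (Finset.subset_insert _ _) fun a ha => by
          rcases Finset.mem_insert.mp ha with rfl | ha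
          · exact hb
          · exact (hall a ha b₁ hb₁).symm
    have h2 : G.CliqueFreeOn (A' : Set V) r :=
      h1.of_forall_adj (Finset.mem_insert_self _ _) (Finset.subset_insert _ _)
        fun a ha => (hall a ha b₂ hb₂).symm
    have h3 := twiceEdges_add_two_le_exK h2 (by omega)
    rw [hA'c] at h3
    omega

theorem Hangs.load_le_of_card_feet_lt {V : Type*} {c t : ℕ} [NeZero c] {H : SimpleGraph V}
    {γ : ZMod c → V} {D : Finset V} (h : Hangs H γ D) (hc : c ≤ 2 * t + 1)
    (hf : ∀ x ∈ D, (feet H γ x).card < t) : load H γ D ≤ (2 * t - 1) * D.card := by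
  classical
  obtain ⟨x, hx, -⟩ := h.feet_ne 0
  have hle := h.load_le hc
  have ht := hf x hx
  obtain ⟨s, rfl⟩ : ∃ s, t = s + 1 := ⟨t - 1, by omega⟩
  have hpos : 0 < D.card := Finset.card_pos.mpr ⟨x, hx⟩
  rw [show 2 * (s + 1) - 1 = 2 * s + 1 by omega]
  by_cases h1 : D.card = 1
  · obtain ⟨y, rfl⟩ := Finset.card_eq_one.mp h1
    rw [load, Finset.sum_singleton, Finset.filter_singleton, if_neg H.irrefl]
    have := hf y (Finset.mem_singleton_self y)
    simp only [Finset.card_empty, Finset.card_singleton]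
    omega
  · nlinarith [show 2 ≤ D.card by omega]

/-- The bound of `stmt_14`, doubled and stated in `ℕ`. -/
theorem TwoConnected.two_mul_ncard_edgeSet_le {V : Type*} [Fintype V] {G : SimpleGraph V}
    {k r t m : ℕ} (h2 : TwoConnected G) (hfree : G.CliqueFree (r + 1))
    (hcyc : ∀ (v : V) (C : G.Walk v v), C.IsCycle → C.length < k)
    (hV : Fintype.card V = k + m) (hk : k = 2 * t + 1 ∨ k = 2 * t + 2) (ht : 1 ≤ t) (hr : r ≤ t) :
    2 * G.edgeSet.ncard ≤ 2 * (t * (k + m - t)) + 2 * exK t r ∨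
      2 * G.edgeSet.ncard ≤ (2 * t - 1) * (k + m - 1) ∨
      2 * G.edgeSet.ncard ≤ 2 * exK (k - 1) (r + 1) + (2 * t - 1) * (m + 1) := by
  classical
  obtain ⟨c, γ, hck, h⟩ := h2.exists_isLongestCycle hcyc
  have h3 := h.three_le
  have : NeZero c := ⟨by omega⟩
  have he := h.two_mul_ncard_edgeSet
  set C := Finset.univ.image γ with hC
  have hCc : C.card = c := by
    rw [Finset.card_image_of_injective _ h.injective, Finset.card_univ, ZMod.card]
  have hWc : Cᶜ.card = k + m - c := by rw [Finset.card_compl, hCc, hV]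
  have hW : ∀ i, γ i ∉ Cᶜ := by simp [hC]
  have hcl : ∀ x ∈ Cᶜ, ∀ y, G.Adj x y → y ∈ Cᶜ ∨ ∃ i, γ i = y := by
    intro x _ y _
    by_cases hy : y ∈ C
    · obtain ⟨i, -, hi⟩ := Finset.mem_image.mp hy
      exact Or.inr ⟨i, hi⟩
    · exact Or.inl (Finset.mem_compl.mpr hy)
  have hload : ∀ s, c ≤ 2 * s + 1 → load G γ Cᶜ ≤ 2 * s * (k + m - c) := by
    intro s hs
    rw [← hWc]
    refine h.load_le h2 (fun D hD => ?_) hW hcl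
    obtain ⟨x, hx, -⟩ := hD.feet_ne 0
    have hpos : 0 < D.card := Finset.card_pos.mpr ⟨x, hx⟩
    have := hD.load_le hs
    omega
  have hCe := twiceEdges_le G C
  rw [hCc] at hCe
  obtain ⟨w, hw⟩ : ∃ w, k + m = c + w := ⟨k + m - c, by omega⟩
  rw [hw] at hload ⊢
  rw [Nat.add_sub_cancel_left] at hload
  by_cases hct : c < 2 * t
  · right; left
    have h1 := hload (c / 2) (by omega)
    have h4 : 2 * (c / 2) * w ≤ c * w := Nat.mul_le_mul_right _ (by omega)
    have h5 : c * (c - 1) + c * w ≤ (2 * t - 1) * (c + w - 1) := by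
      rw [← Nat.mul_add, show c - 1 + w = c + w - 1 by omega]
      exact Nat.mul_le_mul_right _ (by omega)
    omega
  by_cases hx : ∃ x ∈ Cᶜ, t ≤ (feet G γ x).card
  · left
    obtain ⟨x, hx, hfx⟩ := hx
    have h1 := h.twiceEdges_image_le (t := t) (r := r) (by omega) (x := x)
      (fun i e => hW i (e ▸ hx)) hfx hfree hr
    rw [← hC] at h1
    have h4 := hload t (by omega)
    have h5 : 2 * (t * (c + w - t)) = 2 * (t * (c - t)) + 2 * t * w := by
      rw [show c + w - t = c - t + w by omega]
      ring
    omega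
  push Not at hx
  right
  have hload' : load G γ Cᶜ ≤ (2 * t - 1) * w := by
    obtain rfl : w = Cᶜ.card := by omega
    refine h.load_le h2 (fun D hD => hD.load_le_of_card_feet_lt (by omega) fun x hxD =>
      hx x ?_) hW hcl
    rw [Finset.mem_compl]
    intro hxC
    obtain ⟨i, -, rfl⟩ := Finset.mem_image.mp hxC
    exact hD.notMem i hxD
  by_cases hck' : c = k - 1
  · right
    have h1 := twiceEdges_le_exK (hfree.cliqueFreeOn (s := (C : Set V)))
    rw [hCc, hck'] at h1
    obtain rfl : w = m + 1 := by omega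
    omega
  have hc2 : c = 2 * t := by omega
  obtain rfl : w = m + 2 := by omega
  by_cases hs : ∃ s ∈ C, t ≤ (C.filter (G.Adj s)).card
  · right
    obtain ⟨s, -, hs⟩ := hs
    obtain ⟨y, hy⟩ : Cᶜ.Nonempty := Finset.card_pos.mp (by omega)
    have h1 := twiceEdges_add_le_exK hfree (s := s) (Finset.mem_compl.mp hy)
    rw [hCc, show c + 1 = k - 1 by omega] at h1
    have h4 : (2 * t - 1) * (m + 2) = (2 * t - 1) * (m + 1) + (2 * t - 1) := by ring
    omega
  · left
    push Not at hs
    have h1 : twiceEdges G C ≤ C.card • (t - 1) :=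
      Finset.sum_le_card_nsmul _ _ _ fun s hsC => Nat.le_sub_one_of_lt (hs s hsC)
    rw [hCc, smul_eq_mul, hc2] at h1
    rw [hc2, show 2 * t + (m + 2) - 1 = (2 * t - 1) + (m + 2) by omega, Nat.mul_add]
    have h4 : 2 * t * (t - 1) ≤ (2 * t - 1) * (2 * t - 1) :=
      (Nat.mul_le_mul_left _ (by omega : t - 1 ≤ t - 1)).trans (by
        obtain ⟨s, rfl⟩ : ∃ s, t = s + 1 := ⟨t - 1, by omega⟩
        rw [show 2 * (s + 1) - 1 = 2 * s + 1 by omega, Nat.add_sub_cancel]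
        nlinarith)
    omega

theorem stmt_14 {V : Type*} [Fintype V] (G : SimpleGraph V) (n k r : ℕ)
    (hcard : Fintype.card V = n)
    (h2c : TwoConnected G) (hfree : G.CliqueFree r)
    (hcyc : ∀ (v : V) (C : G.Walk v v), C.IsCycle → C.length < k)
    (hkn : k ≤ n) (hk : 5 ≤ k) (hr : r ≤ (k - 1) / 2 + 1) :
    (G.edgeSet.ncard : ℝ) ≤
      max (max
        ((((k - 1) / 2 : ℕ) : ℝ) * ((n : ℝ) - (((k - 1) / 2 : ℕ) : ℝ))
          + (exK ((k - 1) / 2) (r - 1) : ℝ))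
        (((((k - 1) / 2 : ℕ) : ℝ) - 1 / 2) * ((n : ℝ) - 1)))
        ((exK (k - 1) r : ℝ)
          + ((((k - 1) / 2 : ℕ) : ℝ) - 1 / 2) * ((n : ℝ) - (k : ℝ) + 1)) := by
  obtain ⟨m, rfl⟩ := Nat.exists_eq_add_of_le hkn
  cases r with
  | zero => exact absurd hfree (fun h => h ∅ (by simp))
  | succ r =>
  set t := (k - 1) / 2 with ht
  have ht2 : ((2 * t - 1 : ℕ) : ℝ) = 2 * t - 1 := by
    rw [Nat.cast_sub (by omega)]
    push_cast
    ring
  have key := h2c.two_mul_ncard_edgeSet_le hfree hcyc hcard (t := t) (by omega) (by omega)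
    (by omega)
  rw [Nat.add_sub_cancel]
  rcases key with h | h | h
  · refine le_max_of_le_left (le_max_of_le_left ?_)
    have h' : (2 * G.edgeSet.ncard : ℝ) ≤ 2 * (t * ((k + m - t : ℕ) : ℝ)) + 2 * exK t r := by
      exact_mod_cast h
    rw [Nat.cast_sub (by omega)] at h'
    linarith
  · refine le_max_of_le_left (le_max_of_le_right ?_)
    have h' : (2 * G.edgeSet.ncard : ℝ) ≤ ((2 * t - 1 : ℕ) : ℝ) * ((k + m - 1 : ℕ) : ℝ) := by
      exact_mod_cast h
    rw [ht2, Nat.cast_sub (by omega), Nat.cast_one] at h'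
    linarith
  · refine le_max_of_le_right ?_
    have h' : (2 * G.edgeSet.ncard : ℝ) ≤
        2 * exK (k - 1) (r + 1) + ((2 * t - 1 : ℕ) : ℝ) * (m + 1) := by
      exact_mod_cast h
    rw [ht2] at h'
    push_cast
    linarith
end
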